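/- arXiv:2010.10692 — 2 statements merged into one kernel-verified Lean document; each statement's English description precedes it below -/
import Mathlib

section
/- Let B be the open unit ball in ℝⁿ, let F = F(A,p,u,x) be a C² real-valued function on Symₙ(ℝ) × ℝⁿ × ℝ × B such that for each fixed p ∈ ℝⁿ the map (A,u,x) ↦ F(A⁻¹,p,u,x) is locally convex on Sym⁺ₙ(ℝ) × ℝ × B, and let u ∈ C⁴(B) be a convex solution of F(D²u, Du, u, x) = 0 on B satisfying Λ⁻¹|ξ|² ≤ F^{ij}(D²u,Du,u,x) ξᵢ ξⱼ ≤ Λ|ξ|² for all ξ ∈ ℝⁿ, for some Λ > 0. Let 0 ≤ λ₁ ≤ ⋯ ≤ λₙ be the eigenvalues of D²u, and for 1 ≤ k ≤ n set Q = Q_k = λ_k + 2λ_{k−1} + ⋯ + k λ₁. Then there exist a constant C and uniformly bounded functions b^{i,j} on B, all depending only on n, Λ, ‖u‖_{C³(B)} and ‖F‖_{C²} (and not on any C⁴ bound for u), such that F^{ab} Q_{ab} ≤ C Q + Σ_{i=1}^{k} b^{i,j} (λ_i)_j almost everywhere on B, where Q_{ab} and (λ_i)_j denote second and first derivatives of Q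 and λ_i at points where the eigenvalue functions are twice differentiable in the Alexandrov sense (which is almost every point), and F^{ab} is evaluated at (D²u, Du, u, x). -/
open Metric MeasureTheory Asymptotics

/-- The `i`-th partial derivative (0-based, junk value `0` if `i ≥ n`). -/
noncomputable def pd {n : ℕ} (f : EuclideanSpace ℝ (Fin n) → ℝ)
    (x : EuclideanSpace ℝ (Fin n)) (i : ℕ) : ℝ :=
  if h : i < n then fderiv ℝ f x (EuclideanSpace.single ⟨i, h⟩ 1) else 0

/-- The Hessian matrix of second partial derivatives. -/
noncomputable def hessM {n : ℕ} (u : EuclideanSpace ℝ (Fin n) → ℝ)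
    (x : EuclideanSpace ℝ (Fin n)) : Matrix (Fin n) (Fin n) ℝ :=
  Matrix.of fun i j => pd (fun y => pd u y (j : ℕ)) x (i : ℕ)

/-- The derivative `F^{ab}` of `F` in the matrix entry `A_{ab}`, evaluated at
`(D²u(x), Du(x), u(x), x)`. -/
noncomputable def Fmat {n : ℕ}
    (F : (Fin n → Fin n → ℝ) × (Fin n → ℝ) × ℝ × EuclideanSpace ℝ (Fin n) → ℝ)
    (u : EuclideanSpace ℝ (Fin n) → ℝ) (x : EuclideanSpace ℝ (Fin n)) (i j : Fin n) : ℝ :=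
  fderiv ℝ (fun A => F (A, fun l => pd u x l, u x, x)) (fun a b => hessM u x a b)
    (fun a b => if a = i ∧ b = j then (1 : ℝ) else 0)

/-- The curve `f` has the second order expansion `f t = a + t b + t² c + o(t²)` at `t = 0`. -/
def HasTaylorTwo {E : Type*} [NormedAddCommGroup E] [NormedSpace ℝ E] (f : ℝ → E) (a b c : E) :
    Prop :=
  (fun t : ℝ => f t - (a + t • b + t ^ 2 • c)) =o[nhds 0] fun t : ℝ => t ^ 2

namespace HasTaylorTwo

section Normed

variable {E : Type*} [NormedAddCommGroup E] [NormedSpace ℝ E] {f g : ℝ → E} {a b c a' b' c' : E}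

theorem const (a : E) : HasTaylorTwo (fun _ => a) a 0 0 := by
  simp [HasTaylorTwo]

theorem add (hf : HasTaylorTwo f a b c) (hg : HasTaylorTwo g a' b' c') :
    HasTaylorTwo (fun t => f t + g t) (a + a') (b + b') (c + c') := by
  refine (IsLittleO.add hf hg).congr_left fun t => ?_
  simp only [smul_add]; abel

theorem smul (r : ℝ) (hf : HasTaylorTwo f a b c) :
    HasTaylorTwo (fun t => r • f t) (r • a) (r • b) (r • c) := by
  refine (IsLittleO.const_smul_left hf r).congr_left fun t => ?_
  simp only [Pi.smul_apply, smul_sub, smul_add, smul_smul, mul_comm r]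

theorem sum {ι : Type*} (s : Finset ι) {f : ι → ℝ → E} {a b c : ι → E}
    (h : ∀ i ∈ s, HasTaylorTwo (f i) (a i) (b i) (c i)) :
    HasTaylorTwo (fun t => ∑ i ∈ s, f i t) (∑ i ∈ s, a i) (∑ i ∈ s, b i) (∑ i ∈ s, c i) := by
  refine (IsLittleO.sum h).congr_left fun t => ?_
  simp only [Finset.sum_apply, Finset.sum_sub_distrib, Finset.sum_add_distrib, Finset.smul_sum]

theorem congr' (hf : HasTaylorTwo f a b c) (h : f =ᶠ[nhds 0] g) : HasTaylorTwo g a b c :=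
  IsLittleO.congr' hf (by filter_upwards [h] with t ht; rw [ht]) Filter.EventuallyEq.rfl

theorem isBigO_sub (hf : HasTaylorTwo f a b c) :
    (fun t => f t - a) =O[nhds 0] fun t : ℝ => t := by
  have h1 : (fun t : ℝ => t ^ 2) =O[nhds 0] fun t : ℝ => t := by
    have := (isBigO_refl (fun t : ℝ => t) (nhds 0)).mul
      ((Filter.tendsto_id (x := nhds (0 : ℝ))).isBigO_one ℝ)
    simpa [sq] using this
  have h2 : (fun t : ℝ => t • b) =O[nhds 0] fun t : ℝ => t := by
    simpa using (isBigO_refl (fun t : ℝ => t) (nhds 0)).smul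
      (isBigO_const_const b (one_ne_zero (α := ℝ)) (nhds (0 : ℝ)))
  have h3 : (fun t : ℝ => t ^ 2 • c) =O[nhds 0] fun t : ℝ => t := by
    simpa using h1.smul (isBigO_const_const c (one_ne_zero (α := ℝ)) (nhds (0 : ℝ)))
  refine (((IsLittleO.isBigO hf).trans h1).add (h2.add h3)).congr_left fun t => ?_
  abel

theorem tendsto (hf : HasTaylorTwo f a b c) : Filter.Tendsto f (nhds 0) (nhds a) := by
  have := hf.isBigO_sub.trans_tendsto Filter.tendsto_id
  simpa using this.add_const a

end Normed

variable {f g : ℝ → ℝ} {a b c a' b' c' : ℝ}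

theorem isBigO_cube : (fun t : ℝ => t ^ 3) =o[nhds 0] fun t : ℝ => t ^ 2 :=
  isLittleO_pow_pow (by norm_num)

theorem mul (hf : HasTaylorTwo f a b c) (hg : HasTaylorTwo g a' b' c') :
    HasTaylorTwo (fun t => f t * g t) (a * a') (a * b' + b * a') (a * c' + b * b' + c * a') := by
  have h1 : (fun t : ℝ => (f t - (a + t • b + t ^ 2 • c)) * g t) =o[nhds 0] fun t : ℝ => t ^ 2 := by
    simpa using IsLittleO.mul_isBigO hf (hg.tendsto.isBigO_one ℝ)
  have hc : Filter.Tendsto (fun t : ℝ => a + t • b + t ^ 2 • c) (nhds 0)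
      (nhds (a + (0 : ℝ) • b + (0 : ℝ) ^ 2 • c)) :=
    Continuous.tendsto (by fun_prop) _
  have h2 : (fun t : ℝ => (a + t • b + t ^ 2 • c) * (g t - (a' + t • b' + t ^ 2 • c')))
      =o[nhds 0] fun t : ℝ => t ^ 2 := by
    simpa using (hc.isBigO_one ℝ).mul_isLittleO hg
  have hd : Filter.Tendsto (fun t : ℝ => b * c' + c * b' + t * (c * c')) (nhds 0)
      (nhds (b * c' + c * b' + 0 * (c * c'))) :=
    Continuous.tendsto (by fun_prop) _
  have h3 : (fun t : ℝ => t ^ 3 * (b * c' + c * b' + t * (c * c')))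
      =o[nhds 0] fun t : ℝ => t ^ 2 := by
    simpa using isBigO_cube.mul_isBigO (hd.isBigO_one ℝ)
  refine ((h1.add h2).add h3).congr_left fun t => ?_
  simp only [smul_eq_mul]; ring

/-- If an expansion has constant term zero and stays nonnegative, the linear coefficient vanishes
and the quadratic one is nonnegative. -/
theorem nonneg (hf : HasTaylorTwo f 0 b c) (h : ∀ᶠ t in nhds 0, 0 ≤ f t) : b = 0 ∧ 0 ≤ c := by
  have key : ∀ ε > 0, ∀ᶠ t : ℝ in nhds 0, 0 ≤ t * b + t ^ 2 * (c + ε) := by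
    intro ε hε
    filter_upwards [h, IsLittleO.def hf hε] with t h0 h1
    simp only [Real.norm_eq_abs, abs_pow, sq_abs, smul_eq_mul, zero_add] at h1
    nlinarith [(abs_le.1 h1).2]
  have hb : b = 0 := by
    obtain ⟨δ, hδ, H⟩ := Metric.eventually_nhds_iff.1 (key 1 one_pos)
    by_contra hb
    have hb' : 0 < |b| := abs_pos.2 hb
    set M := |c + 1| + 1 with hM
    have hMp : 0 < M := by positivity
    have hlt : c + 1 < M := lt_of_le_of_lt (le_abs_self _) (by linarith)
    obtain ⟨s, hs, hs1, hs2⟩ : ∃ s : ℝ, 0 < s ∧ s * |b| < δ ∧ s * M < 1 := by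
      refine ⟨min (δ / (2 * |b|)) (1 / (2 * M)), by positivity, ?_, ?_⟩
      · calc _ ≤ δ / (2 * |b|) * |b| := by gcongr; exact min_le_left _ _
          _ = δ / 2 := by field_simp
          _ < δ := by linarith
      · calc _ ≤ 1 / (2 * M) * M := by gcongr; exact min_le_right _ _
          _ = 1 / 2 := by field_simp
          _ < 1 := by norm_num
    have := @H (-s * b) (by simpa [abs_mul, abs_of_pos hs] using hs1)
    have hb2 : 0 < b ^ 2 := by positivity
    have h4 : 0 ≤ s * b ^ 2 * (s * (c + 1) - 1) := by nlinarith
    have h5 : s * (c + 1) < 1 := by nlinarith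
    have h6 : s * b ^ 2 * (s * (c + 1) - 1) < 0 :=
      mul_neg_of_pos_of_neg (by positivity) (by linarith)
    linarith
  refine ⟨hb, ?_⟩
  by_contra! hc
  obtain ⟨δ, hδ, H⟩ := Metric.eventually_nhds_iff.1 (key (-c / 2) (by linarith))
  have := @H (δ / 2) (by simp [abs_of_pos hδ]; linarith)
  rw [hb] at this
  nlinarith [sq_nonneg δ, mul_pos hδ hδ]

theorem le (hf : HasTaylorTwo f a b c) (hg : HasTaylorTwo g a b' c')
    (h : ∀ᶠ t in nhds 0, f t ≤ g t) : b = b' ∧ c ≤ c' := by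
  have h1 := hg.add (hf.smul (-1))
  have h2 := nonneg (f := fun t => g t + (-1 : ℝ) • f t) (b := b' + (-1 : ℝ) • b)
    (c := c' + (-1 : ℝ) • c) (by simpa using h1) (by
      filter_upwards [h] with t ht; simp; linarith)
  simp only [smul_eq_mul] at h2
  constructor <;> linarith [h2.1, h2.2]

end HasTaylorTwo

section Calculus

variable {E : Type*} [NormedAddCommGroup E] [NormedSpace ℝ E]

/-- Second order Taylor formula with Peano remainder. -/
theorem ContDiffAt.isLittleO_taylor_two {f : E → ℝ} {z : E} (hf : ContDiffAt ℝ 2 f z) :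
    (fun h : E => f (z + h) - (f z + fderiv ℝ f z h + (1 / 2) * fderiv ℝ (fderiv ℝ f) z h h))
      =o[nhds 0] fun h : E => ‖h‖ ^ 2 := by
  have hsymm : IsSymmSndFDerivAt ℝ f z := hf.isSymmSndFDerivAt (by simp)
  have hdiff : ∀ᶠ y in nhds z, DifferentiableAt ℝ f y := by
    filter_upwards [hf.eventually (by simp)] with y hy using hy.differentiableAt (by simp)
  have hd2 : DifferentiableAt ℝ (fderiv ℝ f) z :=
    (hf.fderiv_right (m := 1) (by norm_num)).differentiableAt (by simp)
  set L := fderiv ℝ (fderiv ℝ f) z with hL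
  have hlo : (fun y => fderiv ℝ f y - fderiv ℝ f z - L (y - z)) =o[nhds z] fun y => y - z :=
    hd2.hasFDerivAt.isLittleO
  rw [isLittleO_iff]
  intro ε hε
  have h1 := (isLittleO_iff.1 hlo hε).and hdiff
  obtain ⟨δ, hδ, H⟩ := Metric.eventually_nhds_iff.1 h1
  refine Metric.eventually_nhds_iff.2 ⟨δ, hδ, fun h hh => ?_⟩
  rw [dist_zero_right] at hh
  let φ : E → ℝ := fun k => f (z + k) - (f z + fderiv ℝ f z k + (1 / 2) * L k k)
  have hderiv : ∀ k ∈ Metric.ball (0 : E) δ,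
      HasFDerivAt φ (fderiv ℝ f (z + k) - fderiv ℝ f z - L k) k := by
    intro k hk
    have hk' : Dist.dist (z + k) z < δ := by simpa using hk
    have hA : HasFDerivAt (fun k => f (z + k)) (fderiv ℝ f (z + k)) k := by
      exact (H hk').2.hasFDerivAt.comp k ((hasFDerivAt_id k).const_add z)
    have hB : HasFDerivAt (fun k => L k k) (2 • L k) k := by
      have := (L.hasFDerivAt (x := k)).clm_apply (hasFDerivAt_id k)
      refine this.congr_fderiv ?_
      ext v
      have := hsymm k v
      simp [two_smul] at this ⊢
      rw [hL]; linarith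
    have := hA.sub (((hasFDerivAt_const (f z) k).add ((fderiv ℝ f z).hasFDerivAt (x := k))).add
      (hB.const_mul (1 / 2)))
    refine this.congr_fderiv ?_
    ext v; simp; ring
  have hmv := ((convex_ball (0 : E) δ).inter (convex_closedBall 0 ‖h‖)).norm_image_sub_le_of_norm_hasFDerivWithin_le
    (f := φ) (C := ε * ‖h‖) (x := 0) (y := h) (fun k hk => (hderiv k hk.1).hasFDerivWithinAt)
    (fun k hk => ?_) (by simp [hδ]) (by simp [hh])
  · have h0 : φ 0 = 0 := by simp [φ]
    rw [h0, sub_zero, sub_zero] at hmv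
    simpa [φ, sq, mul_assoc] using hmv
  · have hk1 : Dist.dist (z + k) z < δ := by simpa using hk.1
    have hk2 : ‖k‖ ≤ ‖h‖ := by simpa using hk.2
    have := (H hk1).1
    rw [add_sub_cancel_left] at this
    exact this.trans (by gcongr)

theorem HasTaylorTwo.comp_contDiffAt {f : E → ℝ} {c : ℝ → E} {z δ η : E}
    (hf : ContDiffAt ℝ 2 f z) (hc : HasTaylorTwo c z δ η) :
    HasTaylorTwo (fun t => f (c t)) (f z) (fderiv ℝ f z δ)
      (fderiv ℝ f z η + (1 / 2) * fderiv ℝ (fderiv ℝ f) z δ δ) := by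
  set L := fderiv ℝ f z
  set B := fderiv ℝ (fderiv ℝ f) z
  have ht0 : Filter.Tendsto (fun t => c t - z) (nhds 0) (nhds 0) := by
    simpa using hc.tendsto.sub_const z
  have h1 : (fun t => f (c t) - (f z + L (c t - z) + (1 / 2) * B (c t - z) (c t - z)))
      =o[nhds 0] fun t : ℝ => t ^ 2 := by
    have := (hf.isLittleO_taylor_two.comp_tendsto ht0).trans_isBigO
      (hc.isBigO_sub.norm_left.pow 2)
    refine this.congr_left fun t => ?_
    simp [L, B]
  have h2 : (fun t => L (c t - (z + t • δ + t ^ 2 • η))) =o[nhds 0] fun t : ℝ => t ^ 2 :=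
    (L.isBigO_comp _ _).trans_isLittleO hc
  have h3 : (fun t => c t - z - t • δ) =o[nhds 0] fun t : ℝ => t := by
    have e1 : (fun t : ℝ => t ^ 2) =o[nhds 0] fun t : ℝ => t := by
      simpa using isLittleO_pow_pow (𝕜 := ℝ) (m := 1) (n := 2) (by norm_num)
    have e2 : (fun t : ℝ => t ^ 2 • η) =o[nhds 0] fun t : ℝ => t := by
      simpa using e1.smul_isBigO (isBigO_const_const η (one_ne_zero (α := ℝ)) (nhds (0 : ℝ)))
    refine ((IsLittleO.trans hc e1).add e2).congr_left fun t => ?_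
    abel
  have hδ : (fun t : ℝ => t • δ) =O[nhds 0] fun t : ℝ => t := by
    simpa using (isBigO_refl (fun t : ℝ => t) (nhds 0)).smul
      (isBigO_const_const δ (one_ne_zero (α := ℝ)) (nhds (0 : ℝ)))
  have hB : ∀ {p q : ℝ → E} {k : ℝ → ℝ}, (fun t => ‖p t‖ * ‖q t‖) =o[nhds 0] k →
      (fun t => B (p t) (q t)) =o[nhds 0] k := by
    intro p q k h
    refine (IsBigO.of_bound ‖B‖ (Filter.Eventually.of_forall fun t => ?_)).trans_isLittleO h
    simpa [mul_assoc] using B.le_opNorm₂ (p t) (q t)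
  have h4 : (fun t => B (c t - z - t • δ) (c t - z)) =o[nhds 0] fun t : ℝ => t ^ 2 :=
    hB (by simpa [sq] using h3.norm_left.mul_isBigO hc.isBigO_sub.norm_left)
  have h5 : (fun t => B (t • δ) (c t - z - t • δ)) =o[nhds 0] fun t : ℝ => t ^ 2 :=
    hB (by simpa [sq] using hδ.norm_left.mul_isLittleO h3.norm_left)
  refine (((h1.add h2).add (h4.const_mul_left (1 / 2))).add
    (h5.const_mul_left (1 / 2))).congr_left fun t => ?_
  simp only [map_sub, map_add, map_smul, smul_eq_mul, sub_apply,
    smul_apply]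
  ring

end Calculus

section MatrixCurves

variable {m : Type*} [Fintype m] [DecidableEq m]

/-- Second order expansion of the resolvent `(1 - tM)⁻¹`. -/
theorem Matrix.hasTaylorTwo_inv_one_sub_smul (M : Matrix m m ℝ) (i j : m) :
    HasTaylorTwo (fun t : ℝ => (1 - t • M)⁻¹ i j) ((1 : Matrix m m ℝ) i j) (M i j)
      ((M * M) i j) := by
  have hcont : Continuous fun t : ℝ => (1 - t • M : Matrix m m ℝ) := by fun_prop
  have hdet : Filter.Tendsto (fun t : ℝ => (1 - t • M : Matrix m m ℝ).det) (nhds 0) (nhds 1) := by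
    have := hcont.matrix_det.tendsto 0
    simpa using this
  have hne : ∀ᶠ t : ℝ in nhds 0, (1 - t • M : Matrix m m ℝ).det ≠ 0 :=
    hdet.eventually_ne one_ne_zero
  have hinv : Filter.Tendsto (fun t : ℝ => (1 - t • M : Matrix m m ℝ)⁻¹) (nhds 0)
      (nhds (1 : Matrix m m ℝ)) := by
    have h1 := (hdet.inv₀ one_ne_zero).smul (hcont.matrix_adjugate.tendsto 0)
    have h2 : ((1 : ℝ)⁻¹ • (1 - (0 : ℝ) • M : Matrix m m ℝ).adjugate) = 1 := by simp
    rw [h2] at h1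
    refine h1.congr fun t => ?_
    rw [Matrix.inv_def, Ring.inverse_eq_inv']
  have hrem : Filter.Tendsto (fun t : ℝ => (M * M * M * (1 - t • M : Matrix m m ℝ)⁻¹) i j) (nhds 0)
      (nhds ((M * M * M * (1 : Matrix m m ℝ)) i j)) := by
    have hc : Continuous fun N : Matrix m m ℝ => (M * M * M * N) i j := by fun_prop
    exact (hc.tendsto _).comp hinv
  have hO : (fun t : ℝ => t ^ 3 * (M * M * M * (1 - t • M : Matrix m m ℝ)⁻¹) i j)
      =o[nhds 0] fun t : ℝ => t ^ 2 := by
    simpa using HasTaylorTwo.isBigO_cube.mul_isBigO (hrem.isBigO_one ℝ)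
  refine hO.congr' ?_ Filter.EventuallyEq.rfl
  filter_upwards [hne] with t ht
  set R := (1 - t • M : Matrix m m ℝ)⁻¹ with hR
  have h1 : (1 - t • M) * R = 1 := Matrix.mul_nonsing_inv _ (isUnit_iff_ne_zero.2 ht)
  have h2 : R = 1 + t • (M * R) := by
    have : R - t • (M * R) = 1 := by rw [← h1, sub_mul, one_mul, smul_mul_assoc]
    rw [← this]; abel
  have h3 : R = 1 + t • M + t ^ 2 • (M * M) + t ^ 3 • (M * M * M * R) := by
    have e : M * R = M + t • (M * M * R) := by
      conv_lhs => rw [h2]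
      rw [mul_add, mul_one, mul_smul_comm, mul_assoc]
    have e2 : M * M * R = M * M + t • (M * M * M * R) := by
      conv_lhs => rw [h2]
      rw [mul_add, mul_one, mul_smul_comm]; simp only [mul_assoc]
    conv_lhs => rw [h2, e, e2]
    simp only [smul_add, smul_smul]
    rw [show t * (t * t) = t ^ 3 by ring, show t * t = t ^ 2 by ring]; abel
  have h4 := congrFun (congrFun h3 i) j
  simp only [Matrix.add_apply, Matrix.smul_apply, smul_eq_mul] at h4 ⊢
  linarith

/-- Every skew-symmetric matrix is the velocity of a curve of orthogonal matrices. -/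
theorem Matrix.exists_orthogonal_curve (K : Matrix m m ℝ) (hK : K.transpose = -K) :
    ∃ O : ℝ → Matrix m m ℝ, (∀ᶠ t in nhds 0, (O t).transpose * O t = 1) ∧
      ∀ i j, HasTaylorTwo (fun t => O t i j) ((1 : Matrix m m ℝ) i j) (K i j)
        ((1 / 2) * (K * K) i j) := by
  set M : Matrix m m ℝ := (1 / 2 : ℝ) • K with hM
  have hMt : M.transpose = -M := by simp [hM, hK]
  refine ⟨fun t => (2 : ℝ) • (1 - t • M)⁻¹ - 1, ?_, fun i j => ?_⟩
  · have hcont : Continuous fun t : ℝ => (1 - t • M : Matrix m m ℝ).det :=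
      Continuous.matrix_det (by fun_prop)
    have hne : ∀ᶠ t : ℝ in nhds 0, (1 - t • M : Matrix m m ℝ).det ≠ 0 :=
      (hcont.tendsto 0).eventually_ne (by simp)
    filter_upwards [hne] with t ht
    set R := (1 - t • M : Matrix m m ℝ)⁻¹ with hR
    have hu := isUnit_iff_ne_zero.2 ht
    have h1 : (1 - t • M) * R = 1 := Matrix.mul_nonsing_inv _ hu
    have h2 : R.transpose * (1 + t • M) = 1 := by
      have := congrArg Matrix.transpose h1
      simpa [Matrix.transpose_mul, hMt, sub_neg_eq_add] using this
    have h3 : R.transpose * ((1 - t • M) + (1 + t • M)) * R = R.transpose + R := by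
      rw [mul_add, add_mul, h2, one_mul, mul_assoc, h1, mul_one]
    have h4 : (1 - t • M) + (1 + t • M) = (2 : ℝ) • (1 : Matrix m m ℝ) := by
      rw [two_smul]; abel
    rw [h4] at h3
    simp only [mul_smul_comm, mul_one, smul_mul_assoc] at h3
    rw [Matrix.transpose_sub, Matrix.transpose_smul, Matrix.transpose_one, sub_mul, mul_sub,
      smul_mul_smul_comm, mul_one, one_mul, mul_comm (2 : ℝ) 2, mul_smul, h3, smul_add]
    abel
  · have h := ((Matrix.hasTaylorTwo_inv_one_sub_smul M i j).smul 2).add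
      (HasTaylorTwo.const (-(1 : Matrix m m ℝ) i j))
    simp only [smul_eq_mul, add_zero] at h
    convert h using 1
    · ext t
      simp only [Matrix.sub_apply, Matrix.smul_apply, smul_eq_mul]; ring
    · ring
    · simp [hM]
    · simp [hM, ← mul_assoc]

/-- Two families with the same multiset of values differ by a permutation of the index type. -/
theorem exists_perm_comp_eq_of_map_univ_eq {m α : Type*} [Fintype m] [DecidableEq α] {f g : m → α}
    (h : Multiset.map f Finset.univ.val = Multiset.map g Finset.univ.val) :
    ∃ σ : Equiv.Perm m, f ∘ σ = g := by
  have hc : ∀ c, Fintype.card {a // g a = c} = Fintype.card {a // f a = c} := by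
    intro c
    have := congrArg (Multiset.count c) h
    rw [Multiset.count_map, Multiset.count_map] at this
    rw [Fintype.card_subtype, Fintype.card_subtype, Finset.card_def, Finset.card_def,
      Finset.filter_val, Finset.filter_val]
    simpa only [eq_comm] using this.symm
  refine ⟨Equiv.ofFiberEquiv fun c => Fintype.equivOfCardEq (hc c), funext fun a => ?_⟩
  exact Equiv.ofFiberEquiv_map _ a

/-- A real symmetric matrix is orthogonally diagonalizable, with the roots of the characteristic
polynomial listed in any prescribed order. -/
theorem Matrix.exists_orthogonal_diagonalization {A : Matrix m m ℝ} (hA : A.transpose = A)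
    {lam : m → ℝ} (hlam : A.charpoly = ∏ i, (Polynomial.X - Polynomial.C (lam i))) :
    ∃ E : Matrix m m ℝ, E.transpose * E = 1 ∧
      E.transpose * A * E = Matrix.diagonal lam := by
  have hH : A.IsHermitian := by rwa [Matrix.IsHermitian, Matrix.conjTranspose_eq_transpose_of_trivial]
  have hms : Multiset.map hH.eigenvalues Finset.univ.val = Multiset.map lam Finset.univ.val := by
    have h1 := hH.roots_charpoly_eq_eigenvalues
    rw [hlam, Polynomial.roots_prod _ _ (by
      simp [Finset.prod_ne_zero_iff, Polynomial.X_sub_C_ne_zero])] at h1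
    simpa using h1.symm
  obtain ⟨σ, hσ⟩ : ∃ σ : Equiv.Perm m, hH.eigenvalues ∘ σ = lam :=
    exists_perm_comp_eq_of_map_univ_eq hms
  set U : Matrix m m ℝ := (hH.eigenvectorUnitary : Matrix m m ℝ) with hU
  have hUU : U.transpose * U = 1 := by
    have := (Matrix.mem_unitaryGroup_iff' (A := U)).1 hH.eigenvectorUnitary.2
    rwa [Matrix.star_eq_conjTranspose, Matrix.conjTranspose_eq_transpose_of_trivial] at this
  have hAU : U.transpose * A * U = Matrix.diagonal hH.eigenvalues := by
    have := hH.conjStarAlgAut_star_eigenvectorUnitary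
    rw [Unitary.conjStarAlgAut_star_apply] at this
    rw [Matrix.star_eq_conjTranspose, Matrix.conjTranspose_eq_transpose_of_trivial] at this
    simpa [Function.comp_def] using this
  refine ⟨U.submatrix id σ, ?_, ?_⟩
  · ext a b
    have := congrFun (congrFun hUU (σ a)) (σ b)
    simpa [Matrix.mul_apply, Matrix.one_apply] using this
  · ext a b
    have := congrFun (congrFun hAU (σ a)) (σ b)
    rw [← hσ]
    simpa [Matrix.mul_apply, Matrix.diagonal_apply] using this

/-- Schur's majorization: among all orthonormal frames, a decreasingly weighted sum of diagonal
entries is smallest in the frame of increasingly ordered eigenvectors. -/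
theorem Matrix.sum_mul_eigenvalue_le {n : ℕ} {A E O : Matrix (Fin n) (Fin n) ℝ}
    {lam w : Fin n → ℝ} (hE : E.transpose * E = 1)
    (hA : E.transpose * A * E = Matrix.diagonal lam) (hlam : Monotone lam) (hw : Antitone w)
    (hO : O.transpose * O = 1) :
    ∑ i, w i * lam i ≤ ∑ i, w i * (O.transpose * A * O) i i := by
  have hE' : E * E.transpose = 1 := mul_eq_one_comm.1 hE
  set V := E.transpose * O with hV
  have hVV : V.transpose * V = 1 := by
    rw [hV, Matrix.transpose_mul, Matrix.transpose_transpose, mul_assoc, ← mul_assoc E, hE',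
      one_mul, hO]
  have hVV' : V * V.transpose = 1 := mul_eq_one_comm.1 hVV
  have hA' : O.transpose * A * O = V.transpose * Matrix.diagonal lam * V := by
    have e : O.transpose * A * O =
        O.transpose * (E * E.transpose) * A * (E * E.transpose) * O := by
      rw [hE', mul_one, mul_one]
    rw [e, hV, ← hA, Matrix.transpose_mul, Matrix.transpose_transpose]
    simp only [mul_assoc]
  have hentry : ∀ i, (O.transpose * A * O) i i = ∑ j, V j i ^ 2 * lam j := by
    intro i
    rw [hA', Matrix.mul_apply]
    refine Finset.sum_congr rfl fun j _ => ?_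
    rw [Matrix.mul_diagonal, Matrix.transpose_apply]; ring
  set S : Matrix (Fin n) (Fin n) ℝ := Matrix.of fun i j => V j i ^ 2 with hS
  have hSd : S ∈ doublyStochastic ℝ (Fin n) := by
    rw [mem_doublyStochastic_iff_sum]
    refine ⟨fun i j => by simp [hS, sq_nonneg], fun i => ?_, fun j => ?_⟩
    · have := congrFun (congrFun hVV i) i
      simpa [Matrix.mul_apply, hS, sq] using this
    · have := congrFun (congrFun hVV' j) j
      simpa [Matrix.mul_apply, hS, sq] using this
  obtain ⟨c, hc0, hc1, hcS⟩ := exists_eq_sum_perm_of_mem_doublyStochastic hSd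
  have hSij : ∀ i j, V j i ^ 2 = ∑ σ, c σ * (if σ i = j then 1 else 0) := by
    intro i j
    have := congrFun (congrFun hcS i) j
    simp only [hS, Matrix.of_apply, Matrix.sum_apply, Matrix.smul_apply, smul_eq_mul] at this
    rw [← this]
    refine Finset.sum_congr rfl fun σ _ => ?_
    simp [Equiv.Perm.permMatrix, PEquiv.toMatrix_apply, eq_comm]
  have hval : ∑ i, w i * (O.transpose * A * O) i i = ∑ σ, c σ * ∑ i, w i * lam (σ i) := by
    have hrow : ∀ i, (O.transpose * A * O) i i = ∑ σ, c σ * lam (σ i) := by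
      intro i
      simp_rw [hentry, hSij, Finset.sum_mul]
      rw [Finset.sum_comm]
      simp
    simp_rw [hrow, Finset.mul_sum]
    rw [Finset.sum_comm]
    exact Finset.sum_congr rfl fun σ _ => Finset.sum_congr rfl fun i _ => by ring
  rw [hval]
  have hanti : Antivary w lam := hw.antivary hlam
  calc ∑ i, w i * lam i = ∑ σ, c σ * ∑ i, w i * lam i := by rw [← Finset.sum_mul, hc1, one_mul]
    _ ≤ _ := Finset.sum_le_sum fun σ _ => mul_le_mul_of_nonneg_left
      (hanti.sum_mul_le_sum_mul_comp_perm) (hc0 σ)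

end MatrixCurves

section SecondVariation

variable {n : ℕ}

theorem Finset.sum_mul_of_antisymm (w : Fin n → ℝ) (g : Fin n → Fin n → ℝ)
    (hg : ∀ i j, g i j = -g j i) :
    ∑ i, w i * ∑ j, g i j = (1 / 2) * ∑ i, ∑ j, (w i - w j) * g i j := by
  have h1 : ∑ i, ∑ j, w j * g i j = -∑ i, ∑ j, w i * g i j := by
    rw [Finset.sum_comm, ← Finset.sum_neg_distrib]
    refine Finset.sum_congr rfl fun i _ => ?_
    rw [← Finset.sum_neg_distrib]
    exact Finset.sum_congr rfl fun j _ => by rw [hg j i]; ring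
  simp only [sub_mul, Finset.sum_sub_distrib, h1, Finset.mul_sum]
  ring

/-- First and second variation of a decreasingly weighted sum of the ordered eigenvalues along a
curve of symmetric matrices, compared with the diagonal in a rotating frame. -/
theorem Matrix.eigenvalue_second_variation_diagonal {H : ℝ → Matrix (Fin n) (Fin n) ℝ}
    {B C : Matrix (Fin n) (Fin n) ℝ} {l : ℝ → Fin n → ℝ} {l₀ p q w : Fin n → ℝ}
    (hH : ∀ i j, HasTaylorTwo (fun t => H t i j) (Matrix.diagonal l₀ i j) (B i j) (C i j))
    (hsymm : ∀ᶠ t in nhds 0, (H t).transpose = H t)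
    (hl : ∀ᶠ t in nhds 0, Monotone (l t) ∧
      (H t).charpoly = ∏ i, (Polynomial.X - Polynomial.C (l t i)))
    (hB : B.transpose = B) (hT : ∀ i, HasTaylorTwo (fun t => l t i) (l₀ i) (p i) (q i))
    (hw : Antitone w) {K : Matrix (Fin n) (Fin n) ℝ} (hK : K.transpose = -K) :
    ∑ i, w i * p i = ∑ i, w i * B i i ∧
      ∑ i, w i * q i ≤ ∑ i, w i * C i i +
        ∑ i, ∑ j, (w i - w j) * (B i j * K j i + (1 / 2) * (l₀ j - l₀ i) * K j i ^ 2) := by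
  obtain ⟨O, hO, hOT⟩ := Matrix.exists_orthogonal_curve K hK
  have hKs : ∀ i j, K i j = -K j i := fun i j => by
    have := congrFun (congrFun hK j) i; simpa using this
  have hBs : ∀ i j, B i j = B j i := fun i j => by
    have := congrFun (congrFun hB j) i; simpa using this
  have hle : ∀ᶠ t in nhds 0, ∑ i, w i * l t i ≤
      ∑ i, w i * ∑ a, ∑ b, O t a i * (H t a b * O t b i) := by
    filter_upwards [hO, hsymm, hl] with t h1 h2 h3
    obtain ⟨E, hE, hEA⟩ := Matrix.exists_orthogonal_diagonalization h2 h3.2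
    refine (Matrix.sum_mul_eigenvalue_le hE hEA h3.1 hw h1).trans (le_of_eq ?_)
    refine Finset.sum_congr rfl fun i _ => ?_
    rw [mul_assoc, Matrix.mul_apply]
    simp only [Matrix.mul_apply, Matrix.transpose_apply, Finset.mul_sum]
  have hf : HasTaylorTwo (fun t => ∑ i, w i * l t i) (∑ i, w i * l₀ i) (∑ i, w i * p i)
      (∑ i, w i * q i) := HasTaylorTwo.sum _ fun i _ => (hT i).smul (w i)
  have hg : HasTaylorTwo (fun t => ∑ i, w i * ∑ a, ∑ b, O t a i * (H t a b * O t b i)) _ _ _ :=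
    HasTaylorTwo.sum _ fun i _ => HasTaylorTwo.smul (w i) <|
      HasTaylorTwo.sum Finset.univ fun a _ => HasTaylorTwo.sum Finset.univ fun b _ =>
        (hOT a i).mul ((hH a b).mul (hOT b i))
  have hzero : ∀ i, ∑ a, ∑ b, (1 : Matrix (Fin n) (Fin n) ℝ) a i *
      (Matrix.diagonal l₀ a b * (1 : Matrix (Fin n) (Fin n) ℝ) b i) = l₀ i := by
    intro i
    simp [Matrix.one_apply, Matrix.diagonal_apply]
  simp only [smul_eq_mul, hzero] at hg
  obtain ⟨h1, h2⟩ := hf.le hg hle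
  constructor
  · rw [h1]
    refine Finset.sum_congr rfl fun i _ => ?_
    have : K i i = 0 := by linarith [hKs i i]
    congr 1
    simp [Matrix.one_apply, Matrix.diagonal_apply, Finset.sum_add_distrib, mul_add, this]
  · refine h2.trans (le_of_eq ?_)
    have hK2 : ∀ i, (K * K) i i = -∑ a, K a i ^ 2 := by
      intro i
      rw [Matrix.mul_apply, ← Finset.sum_neg_distrib]
      exact Finset.sum_congr rfl fun a _ => by rw [hKs i a]; ring
    have key : ∀ i, (∑ a, ∑ b, ((1 : Matrix (Fin n) (Fin n) ℝ) a i * (Matrix.diagonal l₀ a b *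
        (1 / 2 * (K * K) b i) + B a b * K b i + C a b * (1 : Matrix (Fin n) (Fin n) ℝ) b i) +
        K a i * (Matrix.diagonal l₀ a b * K b i + B a b * (1 : Matrix (Fin n) (Fin n) ℝ) b i) +
        1 / 2 * (K * K) a i * (Matrix.diagonal l₀ a b * (1 : Matrix (Fin n) (Fin n) ℝ) b i))) =
        C i i + ∑ j, (2 * (B i j * K j i) + (l₀ j - l₀ i) * K j i ^ 2) := by
      intro i
      have e : (∑ a, ∑ b, ((1 : Matrix (Fin n) (Fin n) ℝ) a i * (Matrix.diagonal l₀ a b *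
        (1 / 2 * (K * K) b i) + B a b * K b i + C a b * (1 : Matrix (Fin n) (Fin n) ℝ) b i) +
        K a i * (Matrix.diagonal l₀ a b * K b i + B a b * (1 : Matrix (Fin n) (Fin n) ℝ) b i) +
        1 / 2 * (K * K) a i * (Matrix.diagonal l₀ a b * (1 : Matrix (Fin n) (Fin n) ℝ) b i))) =
          l₀ i * (K * K) i i + C i i + ∑ j, (B i j * K j i) + ∑ j, K j i * (l₀ j * K j i) +
            ∑ j, K j i * B j i := by
        simp only [Matrix.one_apply, Matrix.diagonal_apply, Finset.sum_add_distrib, mul_add,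
          ite_mul, mul_ite, one_mul, mul_one, zero_mul, mul_zero, Finset.sum_ite_eq,
          Finset.sum_ite_eq', Finset.mem_univ, if_true, Finset.sum_ite_irrel,
          Finset.sum_const_zero]
        ring
      rw [e, hK2]
      simp only [mul_neg, Finset.mul_sum, ← Finset.sum_neg_distrib]
      rw [add_comm _ (C i i)]
      simp only [add_assoc, ← Finset.sum_add_distrib]
      congr 1
      refine Finset.sum_congr rfl fun j _ => ?_
      rw [hBs j i]; ring
    rw [Finset.sum_congr rfl fun i _ => congrArg (w i * ·) (key i)]
    have hsplit : ∀ g : Fin n → ℝ, ∑ i, w i * (C i i + g i) =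
        ∑ i, w i * C i i + ∑ i, w i * g i := fun g => by
      simp only [mul_add, Finset.sum_add_distrib]
    rw [hsplit]
    rw [Finset.sum_mul_of_antisymm w
      (fun i j => 2 * (B i j * K j i) + (l₀ j - l₀ i) * K j i ^ 2) fun i j => by
      rw [hBs j i, hKs j i]; ring]
    congr 1
    simp only [Finset.mul_sum]
    exact Finset.sum_congr rfl fun i _ => Finset.sum_congr rfl fun j _ => by ring

/-- First and second variation of a decreasingly weighted sum of the ordered eigenvalues along a
curve of symmetric matrices, compared with the diagonal in a rotating eigenframe. -/
theorem Matrix.eigenvalue_second_variation {H : ℝ → Matrix (Fin n) (Fin n) ℝ}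
    {A B C E : Matrix (Fin n) (Fin n) ℝ} {l : ℝ → Fin n → ℝ} {l₀ p q w : Fin n → ℝ}
    (hH : ∀ i j, HasTaylorTwo (fun t => H t i j) (A i j) (B i j) (C i j))
    (hsymm : ∀ᶠ t in nhds 0, (H t).transpose = H t)
    (hl : ∀ᶠ t in nhds 0, Monotone (l t) ∧
      (H t).charpoly = ∏ i, (Polynomial.X - Polynomial.C (l t i)))
    (hE : E.transpose * E = 1) (hA : E.transpose * A * E = Matrix.diagonal l₀)
    (hB : B.transpose = B) (hT : ∀ i, HasTaylorTwo (fun t => l t i) (l₀ i) (p i) (q i))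
    (hw : Antitone w) {K : Matrix (Fin n) (Fin n) ℝ} (hK : K.transpose = -K) :
    ∑ i, w i * p i = ∑ i, w i * (E.transpose * B * E) i i ∧
      ∑ i, w i * q i ≤ ∑ i, w i * (E.transpose * C * E) i i +
        ∑ i, ∑ j, (w i - w j) *
          ((E.transpose * B * E) i j * K j i + (1 / 2) * (l₀ j - l₀ i) * K j i ^ 2) := by
  have hconj : ∀ (M : Matrix (Fin n) (Fin n) ℝ) i j,
      (E.transpose * M * E) i j = ∑ b, ∑ a, (E a i * E b j) * M a b := by
    intro M i j
    simp only [Matrix.mul_apply, Matrix.transpose_apply, Finset.sum_mul]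
    exact Finset.sum_congr rfl fun b _ => Finset.sum_congr rfl fun a _ => by ring
  refine Matrix.eigenvalue_second_variation_diagonal
    (H := fun t => E.transpose * H t * E) (l := l) ?_ ?_ ?_ ?_ hT hw hK
  · intro i j
    rw [← hA]
    simp only [hconj]
    exact HasTaylorTwo.sum _ fun b _ => HasTaylorTwo.sum _ fun a _ =>
      (hH a b).smul (E a i * E b j)
  · filter_upwards [hsymm] with t ht
    simp only [Matrix.transpose_mul, Matrix.transpose_transpose, ht, mul_assoc]
  · filter_upwards [hl] with t ht
    refine ⟨ht.1, ?_⟩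
    rw [Matrix.charpoly_mul_comm, ← mul_assoc, mul_eq_one_comm.1 hE, one_mul, ht.2]
  · simp only [Matrix.transpose_mul, Matrix.transpose_transpose, hB, mul_assoc]

end SecondVariation

section Symmetrization

variable {m : Type*} [Fintype m] [DecidableEq m]

theorem Matrix.PosDef.exists_orthogonal_diagonalization {A : Matrix m m ℝ} (hA : A.PosDef) :
    ∃ (E : Matrix m m ℝ) (d : m → ℝ), E.transpose * E = 1 ∧ (∀ i, 0 < d i) ∧
      E.transpose * A * E = Matrix.diagonal d := by
  obtain ⟨E, h1, h2⟩ := Matrix.exists_orthogonal_diagonalization (A := A)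
    (by simpa [Matrix.IsHermitian] using hA.isHermitian) (by simpa using hA.isHermitian.charpoly_eq)
  exact ⟨E, _, h1, hA.eigenvalues_pos, h2⟩

/-- Two positive definite matrices are simultaneously diagonalizable by congruence. -/
theorem Matrix.PosDef.exists_simultaneous_diagonalization {H D : Matrix m m ℝ} (hH : H.PosDef)
    (hD : D.PosDef) :
    ∃ (P R : Matrix m m ℝ) (d : m → ℝ), P * R = 1 ∧ R * P = 1 ∧ (∀ i, 0 < d i) ∧
      H = P.transpose * P ∧ D = P.transpose * Matrix.diagonal d * P := by
  obtain ⟨E, e, hE, he, hHE⟩ := hH.exists_orthogonal_diagonalization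
  have hE' : E * E.transpose = 1 := mul_eq_one_comm.mp hE
  set B : Matrix m m ℝ := Matrix.diagonal (fun i => √(e i)) * E.transpose with hBdef
  set B' : Matrix m m ℝ := E * Matrix.diagonal (fun i => (√(e i))⁻¹) with hB'def
  have hne : ∀ i, √(e i) ≠ 0 := fun i => (Real.sqrt_pos.mpr (he i)).ne'
  have hBB' : B * B' = 1 := by
    rw [hBdef, hB'def, Matrix.mul_assoc, ← Matrix.mul_assoc _ E, hE, Matrix.one_mul,
      Matrix.diagonal_mul_diagonal]
    simp [hne]
  have hB'B : B' * B = 1 := mul_eq_one_comm.mp hBB'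
  have hHB : H = B.transpose * B := by
    have : H = E * (E.transpose * H * E) * E.transpose := by
      rw [show E * (E.transpose * H * E) * E.transpose = (E * E.transpose) * H * (E * E.transpose) by
        simp only [Matrix.mul_assoc], hE', Matrix.one_mul, Matrix.mul_one]
    rw [this, hHE, hBdef, Matrix.transpose_mul, Matrix.transpose_transpose,
      Matrix.diagonal_transpose, Matrix.mul_assoc, Matrix.mul_assoc, ← Matrix.mul_assoc (Matrix.diagonal _),
      Matrix.diagonal_mul_diagonal]
    congr; ext i; rw [Real.mul_self_sqrt (he i).le]
  have hD' : (B'.transpose * D * B').PosDef := by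
    have := hD.conjTranspose_mul_mul_same (B := B') (by
      intro x y hxy
      have := congrArg (B.mulVec) hxy
      simpa [Matrix.mulVec_mulVec, hBB'] using this)
    simpa using this
  obtain ⟨O, d, hO, hd, hDO⟩ := hD'.exists_orthogonal_diagonalization
  have hO' : O * O.transpose = 1 := mul_eq_one_comm.mp hO
  refine ⟨O.transpose * B, B' * O, d, ?_, ?_, hd, ?_, ?_⟩
  · rw [Matrix.mul_assoc, ← Matrix.mul_assoc B, hBB', Matrix.one_mul, hO]
  · rw [Matrix.mul_assoc, ← Matrix.mul_assoc O, hO', Matrix.one_mul, hB'B]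
  · rw [Matrix.transpose_mul, Matrix.transpose_transpose, Matrix.mul_assoc, ← Matrix.mul_assoc O,
      hO', Matrix.one_mul, hHB]
  · rw [← hDO, Matrix.transpose_mul, Matrix.transpose_transpose]
    have h2 : B.transpose * B'.transpose = 1 := by
      rw [← Matrix.transpose_mul, hB'B, Matrix.transpose_one]
    calc D = (B.transpose * B'.transpose) * D * (B' * B) := by rw [h2, hB'B]; simp
      _ = B.transpose * (O * O.transpose) * B'.transpose * D * B' * (O * O.transpose) * B := by
        rw [hO']; simp [Matrix.mul_assoc]
      _ = _ := by simp only [Matrix.mul_assoc]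

theorem Matrix.trace_mul_transpose_mul_diagonal (P W : Matrix m m ℝ) (d : m → ℝ) :
    (P.transpose * Matrix.diagonal d * P * W.transpose * (P.transpose * P) * W).trace =
      ∑ i, ∑ j, d j * (P * W * P.transpose) i j ^ 2 := by
  have : (P.transpose * Matrix.diagonal d * P * W.transpose * (P.transpose * P) * W).trace =
      ((P * W * P.transpose) * Matrix.diagonal d * (P * W * P.transpose).transpose).trace := by
    rw [Matrix.transpose_mul, Matrix.transpose_mul, Matrix.transpose_transpose,
      show P.transpose * Matrix.diagonal d * P * W.transpose * (P.transpose * P) * W =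
        (P.transpose * Matrix.diagonal d * P * W.transpose * P.transpose) * (P * W) by
        simp only [Matrix.mul_assoc], Matrix.trace_mul_comm]
    simp only [Matrix.mul_assoc]
  rw [this]
  simp only [Matrix.trace, Matrix.diag_apply, Matrix.mul_apply (M := _ * Matrix.diagonal d),
    Matrix.mul_diagonal, Matrix.transpose_apply]
  exact Finset.sum_congr rfl fun i _ => Finset.sum_congr rfl fun j _ => by ring

/-- A perturbation `S + Z` of a symmetric matrix `S` can be replaced by a symmetric matrix
without increasing the energy `tr (D Wᵀ H W)`, at a distance from `S` controlled by `Z`. -/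
theorem Matrix.exists_symmetric_energy_le {L : ℝ} (hL : 0 < L) {H D S Z : Matrix m m ℝ}
    (hHs : H.transpose = H)
    (hH : ∀ ξ : m → ℝ, L⁻¹ * ∑ i, ξ i ^ 2 ≤ ξ ⬝ᵥ H.mulVec ξ ∧
      ξ ⬝ᵥ H.mulVec ξ ≤ L * ∑ i, ξ i ^ 2)
    (hD : D.PosDef) (hS : S.transpose = S) :
    ∃ X : Matrix m m ℝ, X.transpose = X ∧
      (D * X.transpose * H * X).trace ≤ (D * (S + Z).transpose * H * (S + Z)).trace ∧
      ∀ i j, |(X - S) i j| ≤ 2 * (Fintype.card m) ^ 2 * L ^ 2 * ∑ a, ∑ b, |Z a b| := by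
  have hHpos : H.PosDef := by
    refine Matrix.PosDef.of_dotProduct_mulVec_pos (by simpa [Matrix.IsHermitian] using hHs) ?_
    intro x hx
    have h1 := (hH x).1
    have h2 : 0 < ∑ i, x i ^ 2 := by
      obtain ⟨i, hi⟩ := Function.ne_iff.mp hx
      exact Finset.sum_pos' (fun i _ => sq_nonneg _) ⟨i, Finset.mem_univ _, by
        have : x i ≠ 0 := hi
        positivity⟩
    have : 0 < L⁻¹ * ∑ i, x i ^ 2 := by positivity
    simpa using this.trans_le h1
  obtain ⟨P, R, d, hPR, hRP, hd, hHP, hDP⟩ := hHpos.exists_simultaneous_diagonalization hD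
  have hquad : ∀ ξ : m → ℝ, ξ ⬝ᵥ H.mulVec ξ = ∑ k, (P.mulVec ξ k) ^ 2 := by
    intro ξ
    rw [hHP, ← Matrix.mulVec_mulVec, Matrix.dotProduct_mulVec, Matrix.vecMul_transpose]
    simp [dotProduct, sq]
  have hPb : ∀ k j, P k j ^ 2 ≤ L := by
    intro k j
    have h1 := (hH (Pi.single j 1)).2
    rw [hquad] at h1
    have h2 : ∑ i, (Pi.single j (1 : ℝ) : m → ℝ) i ^ 2 = 1 := by
      simp [Pi.single_apply]
    rw [h2, mul_one] at h1
    refine le_trans ?_ h1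
    have := Finset.single_le_sum (f := fun k => (P.mulVec (Pi.single j 1) k) ^ 2)
      (fun i _ => sq_nonneg _) (Finset.mem_univ k)
    simpa using this
  have hRb : ∀ i j, R i j ^ 2 ≤ L := by
    intro i j
    have h1 := (hH (fun i => R i j)).1
    rw [hquad] at h1
    have h2 : ∑ k, (P.mulVec (fun i => R i j) k) ^ 2 = 1 := by
      have : ∀ k, P.mulVec (fun i => R i j) k = (1 : Matrix m m ℝ) k j := by
        intro k; rw [← hPR]; rfl
      simp [this, Matrix.one_apply]
    rw [h2, inv_mul_le_iff₀ hL, mul_one] at h1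
    exact (Finset.single_le_sum (f := fun i => R i j ^ 2)
      (fun i _ => sq_nonneg _) (Finset.mem_univ i)).trans h1
  set W : Matrix m m ℝ := P * (S + Z) * P.transpose with hW
  set S' : Matrix m m ℝ := P * S * P.transpose with hS'
  set Z' : Matrix m m ℝ := P * Z * P.transpose with hZ'
  have hWS : W = S' + Z' := by rw [hW, hS', hZ', Matrix.mul_add, Matrix.add_mul]
  have hS's : ∀ i j, S' i j = S' j i := by
    intro i j
    have : S'.transpose = S' := by
      rw [hS', Matrix.transpose_mul, Matrix.transpose_mul, hS, Matrix.transpose_transpose,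
        Matrix.mul_assoc]
    exact congrFun (congrFun this j) i
  set X' : Matrix m m ℝ :=
    Matrix.of fun i j => (d j * W i j + d i * W j i) / (d i + d j) with hX'
  have hX's : X'.transpose = X' := by
    ext i j
    simp only [hX', Matrix.transpose_apply, Matrix.of_apply]
    rw [add_comm, add_comm (d i)]
  have hRPt : P.transpose * R.transpose = 1 := by
    rw [← Matrix.transpose_mul, hRP, Matrix.transpose_one]
  have hPRt : R.transpose * P.transpose = 1 := mul_eq_one_comm.mp hRPt
  set X : Matrix m m ℝ := R * X' * R.transpose with hX
  have hXX' : P * X * P.transpose = X' := by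
    calc P * X * P.transpose = (P * R) * X' * (R.transpose * P.transpose) := by
          simp only [hX, Matrix.mul_assoc]
      _ = X' := by rw [hPR, hPRt]; simp
  have hSS' : S = R * S' * R.transpose := by
    calc S = (R * P) * S * (P.transpose * R.transpose) := by rw [hRP, hRPt]; simp
      _ = _ := by simp only [hS', Matrix.mul_assoc]
  refine ⟨X, ?_, ?_, ?_⟩
  · rw [hX, Matrix.transpose_mul, Matrix.transpose_mul, hX's, Matrix.transpose_transpose,
      Matrix.mul_assoc]
  · rw [hHP, hDP, Matrix.trace_mul_transpose_mul_diagonal,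
      Matrix.trace_mul_transpose_mul_diagonal, hXX', ← hW]
    have hsw : ∀ Y : Matrix m m ℝ, ∑ i, ∑ j, d j * Y i j ^ 2 =
        (1 / 2) * ∑ i, ∑ j, (d j * Y i j ^ 2 + d i * Y j i ^ 2) := by
      intro Y
      have : ∑ i, ∑ j, d i * Y j i ^ 2 = ∑ i, ∑ j, d j * Y i j ^ 2 := Finset.sum_comm
      simp only [Finset.sum_add_distrib, this]; ring
    rw [hsw X', hsw W]
    refine mul_le_mul_of_nonneg_left (Finset.sum_le_sum fun i _ => Finset.sum_le_sum fun j _ => ?_)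
      (by norm_num)
    have h1 : X' j i = X' i j := congrFun (congrFun hX's i) j
    rw [h1]
    have hs : 0 < d i + d j := add_pos (hd i) (hd j)
    have hx : (d i + d j) * X' i j = d j * W i j + d i * W j i := by
      simp only [hX', Matrix.of_apply]; field_simp
    have key : (d i + d j) * ((d i + d j) * X' i j ^ 2) ≤
        (d i + d j) * (d j * W i j ^ 2 + d i * W j i ^ 2) := by
      have : (d i + d j) * ((d i + d j) * X' i j ^ 2) = (d j * W i j + d i * W j i) ^ 2 := by
        rw [← hx]; ring
      rw [this]
      nlinarith [mul_nonneg (mul_pos (hd i) (hd j)).le (sq_nonneg (W i j - W j i))]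
    have := le_of_mul_le_mul_left key hs
    linarith
  · intro i j
    set z : ℝ := ∑ a, ∑ b, |Z a b| with hz
    have hz0 : 0 ≤ z := Finset.sum_nonneg fun _ _ => Finset.sum_nonneg fun _ _ => abs_nonneg _
    have hmul : ∀ {M : Matrix m m ℝ}, (∀ i j, M i j ^ 2 ≤ L) → ∀ i a j b, |M i a * M j b| ≤ L := by
      intro M hM i a j b
      rw [abs_le]
      constructor <;> nlinarith [hM i a, hM j b, sq_nonneg (M i a + M j b),
        sq_nonneg (M i a - M j b)]
    have hZ'b : ∀ i j, |Z' i j| ≤ L * z := by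
      intro i j
      have : Z' i j = ∑ b, ∑ a, (P i a * P j b) * Z a b := by
        simp only [hZ', Matrix.mul_apply, Matrix.transpose_apply, Finset.sum_mul]
        exact Finset.sum_congr rfl fun b _ => Finset.sum_congr rfl fun a _ => by ring
      rw [this, hz, Finset.sum_comm, Finset.mul_sum]
      refine (Finset.abs_sum_le_sum_abs _ _).trans (Finset.sum_le_sum fun a _ => ?_)
      rw [Finset.mul_sum]
      refine (Finset.abs_sum_le_sum_abs _ _).trans (Finset.sum_le_sum fun b _ => ?_)
      rw [abs_mul]
      exact mul_le_mul_of_nonneg_right (hmul hPb _ _ _ _) (abs_nonneg _)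
    have hdiff : ∀ i j, |(X' - S') i j| ≤ 2 * (L * z) := by
      intro i j
      have hs : 0 < d i + d j := add_pos (hd i) (hd j)
      have : (X' - S') i j = d j / (d i + d j) * Z' i j + d i / (d i + d j) * Z' j i := by
        rw [Matrix.sub_apply]
        simp only [hX', Matrix.of_apply, hWS, Matrix.add_apply, hS's j i]
        field_simp
        ring
      rw [this]
      have e1 : |d j / (d i + d j) * Z' i j| ≤ L * z := by
        rw [abs_mul, abs_of_pos (div_pos (hd j) hs)]
        calc d j / (d i + d j) * |Z' i j| ≤ 1 * |Z' i j| :=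
              mul_le_mul_of_nonneg_right ((div_le_one hs).mpr (by linarith [hd i])) (abs_nonneg _)
          _ ≤ _ := by rw [one_mul]; exact hZ'b _ _
      have e2 : |d i / (d i + d j) * Z' j i| ≤ L * z := by
        rw [abs_mul, abs_of_pos (div_pos (hd i) hs)]
        calc d i / (d i + d j) * |Z' j i| ≤ 1 * |Z' j i| :=
              mul_le_mul_of_nonneg_right ((div_le_one hs).mpr (by linarith [hd j])) (abs_nonneg _)
          _ ≤ _ := by rw [one_mul]; exact hZ'b _ _
      linarith [abs_add_le (d j / (d i + d j) * Z' i j) (d i / (d i + d j) * Z' j i)]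
    have : (X - S) i j = ∑ b, ∑ a, (R i a * R j b) * (X' - S') a b := by
      have : X - S = R * (X' - S') * R.transpose := by
        rw [Matrix.mul_sub, Matrix.sub_mul, ← hX, ← hSS']
      rw [this]
      simp only [Matrix.mul_apply, Matrix.transpose_apply, Finset.sum_mul]
      exact Finset.sum_congr rfl fun b _ => Finset.sum_congr rfl fun a _ => by ring
    rw [this]
    calc |∑ b, ∑ a, (R i a * R j b) * (X' - S') a b|
        ≤ ∑ b : m, ∑ a : m, L * (2 * (L * z)) := by
          refine (Finset.abs_sum_le_sum_abs _ _).trans (Finset.sum_le_sum fun b _ => ?_)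
          refine (Finset.abs_sum_le_sum_abs _ _).trans (Finset.sum_le_sum fun a _ => ?_)
          rw [abs_mul]
          exact mul_le_mul (hmul hRb _ _ _ _) (hdiff _ _) (abs_nonneg _) hL.le
      _ = _ := by simp; ring

end Symmetrization

section StructureCondition

namespace HasTaylorTwo

theorem prodMk {E G : Type*} [NormedAddCommGroup E] [NormedSpace ℝ E] [NormedAddCommGroup G]
    [NormedSpace ℝ G] {f : ℝ → E} {g : ℝ → G} {a b c : E} {a' b' c' : G}
    (hf : HasTaylorTwo f a b c) (hg : HasTaylorTwo g a' b' c') :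
    HasTaylorTwo (fun t => (f t, g t)) (a, a') (b, b') (c, c') := by
  have := IsLittleO.prod_left hf hg
  exact this

theorem pi {ι : Type*} [Fintype ι] {E : Type*} [NormedAddCommGroup E] [NormedSpace ℝ E]
    {f : ℝ → ι → E} {a b c : ι → E} (h : ∀ i, HasTaylorTwo (fun t => f t i) (a i) (b i) (c i)) :
    HasTaylorTwo f a b c :=
  isLittleO_pi.mpr h

theorem line {E : Type*} [NormedAddCommGroup E] [NormedSpace ℝ E] (a b : E) :
    HasTaylorTwo (fun t => a + t • b) a b 0 := by
  simp [HasTaylorTwo]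

theorem comp_neg {E : Type*} [NormedAddCommGroup E] [NormedSpace ℝ E] {f : ℝ → E} {a b c : E}
    (h : HasTaylorTwo f a b c) : HasTaylorTwo (fun t => f (-t)) a (-b) c := by
  have h1 : Filter.Tendsto (fun t : ℝ => -t) (nhds 0) (nhds 0) := by
    simpa using (continuous_neg (G := ℝ)).tendsto 0
  have := IsLittleO.comp_tendsto h h1
  simpa [HasTaylorTwo, Function.comp_def] using this

end HasTaylorTwo

theorem Matrix.PosDef.eventually_add_smul {m : Type*} [Fintype m] [DecidableEq m]
    {B Y : Matrix m m ℝ} (hB : B.PosDef) (hY : Y.transpose = Y) :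
    ∀ᶠ t in nhds (0 : ℝ), (B + t • Y).PosDef := by
  obtain ⟨P, R, d, hPR, hRP, hd, hBP, -⟩ := hB.exists_simultaneous_diagonalization hB
  have hM : (R.transpose * Y * R).transpose = R.transpose * Y * R := by
    rw [Matrix.transpose_mul, Matrix.transpose_mul, hY, Matrix.transpose_transpose,
      Matrix.mul_assoc]
  have hMh : (R.transpose * Y * R).IsHermitian := by simpa [Matrix.IsHermitian] using hM
  obtain ⟨E, hE, hEM⟩ := Matrix.exists_orthogonal_diagonalization hM
    (by simpa using hMh.charpoly_eq)
  set l := hMh.eigenvalues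
  have hE' : E * E.transpose = 1 := mul_eq_one_comm.mp hE
  have hRPt : P.transpose * R.transpose = 1 := by
    rw [← Matrix.transpose_mul, hRP, Matrix.transpose_one]
  have hev : ∀ᶠ t in nhds (0 : ℝ), ∀ i, 0 < 1 + t * l i := by
    refine Filter.eventually_all.mpr fun i => ?_
    have : ContinuousAt (fun t : ℝ => 1 + t * l i) 0 := by fun_prop
    exact this.eventually_const_lt (by simp)
  filter_upwards [hev] with t ht
  have h1 : (Matrix.diagonal fun i => 1 + t * l i).PosDef := Matrix.PosDef.diagonal ht
  have h2 := h1.conjTranspose_mul_mul_same (B := E.transpose * P) (by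
    intro x y hxy
    have := congrArg ((R * E).mulVec) hxy
    have h3 : R * E * (E.transpose * P) = 1 := by
      rw [Matrix.mul_assoc, ← Matrix.mul_assoc E, hE', Matrix.one_mul, hRP]
    simpa [Matrix.mulVec_mulVec, h3] using this)
  have h4 : Matrix.diagonal (fun i => 1 + t * l i) = 1 + t • Matrix.diagonal l := by
    rw [← Matrix.diagonal_one, ← Matrix.diagonal_smul, Matrix.diagonal_add]; rfl
  have h5 : E * Matrix.diagonal l * E.transpose = R.transpose * Y * R := by
    rw [← hEM]
    calc _ = (E * E.transpose) * (R.transpose * Y * R) * (E * E.transpose) := by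
          simp only [Matrix.mul_assoc]
      _ = _ := by rw [hE']; simp
  convert h2 using 1
  rw [h4, Matrix.conjTranspose_eq_transpose_of_trivial, Matrix.transpose_mul,
    Matrix.transpose_transpose]
  calc B + t • Y = P.transpose * P + t • ((P.transpose * R.transpose) * Y * (R * P)) := by
        rw [hRPt, hRP, ← hBP]; simp
    _ = P.transpose * (E * E.transpose) * P
        + t • (P.transpose * (E * Matrix.diagonal l * E.transpose) * P) := by
        rw [h5, hE']; simp [Matrix.mul_assoc]
    _ = _ := by
        simp only [Matrix.mul_add, Matrix.add_mul, Matrix.mul_assoc, Matrix.smul_mul,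
          Matrix.mul_smul, Matrix.one_mul]

theorem ConvexOn.eventually_two_mul_le {V : Type*} [AddCommGroup V] [Module ℝ V]
    {s : Set V} {G : V → ℝ} {z w : V} (hG : ConvexOn ℝ s G)
    (h : ∀ᶠ t in nhds (0 : ℝ), z + t • w ∈ s) :
    ∀ᶠ t in nhds (0 : ℝ), 2 * G z ≤ G (z + t • w) + G (z + (-t) • w) := by
  have h1 : Filter.Tendsto (fun t : ℝ => -t) (nhds 0) (nhds 0) := by
    simpa using (continuous_neg (G := ℝ)).tendsto 0
  filter_upwards [h, h1.eventually h] with t h2 h3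
  have := hG.2 h2 h3 (by norm_num : (0 : ℝ) ≤ 1 / 2) (by norm_num : (0 : ℝ) ≤ 1 / 2)
    (by norm_num : (1 / 2 : ℝ) + 1 / 2 = 1)
  have e : (1 / 2 : ℝ) • (z + t • w) + (1 / 2 : ℝ) • (z + (-t) • w) = z := by module
  rw [e] at this
  simp only [smul_eq_mul] at this
  linarith

/-- Second-order consequence of the local convexity of `(A, u, x) ↦ F (A⁻¹, p, u, x)`. -/
theorem second_derivative_nonneg_of_convexOn_inv {n : ℕ} {E : Type*} [NormedAddCommGroup E]
    [NormedSpace ℝ E] {F : (Fin n → Fin n → ℝ) × (Fin n → ℝ) × ℝ × E → ℝ}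
    {A : Matrix (Fin n) (Fin n) ℝ} (hA : A.PosDef) {p : Fin n → ℝ} {r : ℝ} {x : E} {U : Set E}
    (hU : IsOpen U) (hx : x ∈ U) (hF : ContDiffAt ℝ 2 F (fun i j => A i j, p, r, x))
    (hconv : ∃ t : Set ((Fin n → Fin n → ℝ) × ℝ × E),
      IsOpen t ∧ (fun i j => A⁻¹ i j, r, x) ∈ t ∧
        ConvexOn ℝ ({w | (Matrix.of w.1).PosDef ∧ w.2.2 ∈ U} ∩ t)
          (fun w => F (fun i j => (Matrix.of w.1)⁻¹ i j, p, w.2.1, w.2.2)))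
    {X : Matrix (Fin n) (Fin n) ℝ} (hX : X.transpose = X) (τ : ℝ) (v : E) :
    0 ≤ fderiv ℝ F (fun i j => A i j, p, r, x) (fun i j => (X * A⁻¹ * X) i j, 0, 0, 0) +
      (1 / 2) * fderiv ℝ (fderiv ℝ F) (fun i j => A i j, p, r, x)
        (fun i j => X i j, 0, τ, v) (fun i j => X i j, 0, τ, v) := by
  obtain ⟨t, ht, hzt, hG⟩ := hconv
  set Y : Matrix (Fin n) (Fin n) ℝ := -(A⁻¹ * X * A⁻¹) with hY
  have hdet : IsUnit A.det := (Matrix.isUnit_iff_isUnit_det A).mp hA.isUnit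
  have hAs : A.transpose = A := by simpa [Matrix.IsHermitian] using hA.isHermitian
  have hYs : Y.transpose = Y := by
    rw [hY, Matrix.transpose_neg, Matrix.transpose_mul, Matrix.transpose_mul, hX,
      Matrix.transpose_nonsing_inv, hAs, Matrix.mul_assoc]
  set z : (Fin n → Fin n → ℝ) × ℝ × E := (fun i j => A⁻¹ i j, r, x) with hz
  set w : (Fin n → Fin n → ℝ) × ℝ × E := (fun i j => Y i j, τ, v) with hw
  have hline : Filter.Tendsto (fun s : ℝ => z + s • w) (nhds 0) (nhds z) := by
    have : ContinuousAt (fun s : ℝ => z + s • w) 0 := by fun_prop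
    simpa [ContinuousAt] using this
  have hmem : ∀ᶠ s in nhds (0 : ℝ), z + s • w ∈ {w : (Fin n → Fin n → ℝ) × ℝ × E |
      (Matrix.of w.1).PosDef ∧ w.2.2 ∈ U} ∩ t := by
    have h1 := hA.inv.eventually_add_smul hYs
    have h2 := hline.eventually (ht.mem_nhds hzt)
    have h3 := hline.eventually (((continuous_snd.comp continuous_snd).isOpen_preimage U hU).mem_nhds hx)
    filter_upwards [h1, h2, h3] with s h1 h2 h3
    exact ⟨⟨h1, h3⟩, h2⟩
  have hconv2 := hG.eventually_two_mul_le hmem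
  have hcurve : HasTaylorTwo (fun s : ℝ => ((fun i j => (A⁻¹ + s • Y)⁻¹ i j : Fin n → Fin n → ℝ), p,
      r + s • τ, x + s • v)) (fun i j => A i j, p, r, x) (fun i j => X i j, 0, τ, v)
      (fun i j => (X * A⁻¹ * X) i j, 0, 0, 0) := by
    refine HasTaylorTwo.prodMk (HasTaylorTwo.pi fun i => HasTaylorTwo.pi fun j => ?_)
      ((HasTaylorTwo.const p).prodMk ((HasTaylorTwo.line r τ).prodMk (HasTaylorTwo.line x v)))
    have h1 : ∀ s : ℝ, (A⁻¹ + s • Y)⁻¹ i j = ∑ k, A k j • (1 - s • (X * A⁻¹))⁻¹ i k := by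
      intro s
      have : A⁻¹ + s • Y = A⁻¹ * (1 - s • (X * A⁻¹)) := by
        rw [hY, Matrix.mul_sub, Matrix.mul_smul, Matrix.mul_one, Matrix.mul_assoc]
        module
      rw [this, Matrix.mul_inv_rev, Matrix.nonsing_inv_nonsing_inv _ hdet, Matrix.mul_apply]
      exact Finset.sum_congr rfl fun k _ => by rw [smul_eq_mul, mul_comm]
    simp only [h1]
    have h2 := HasTaylorTwo.sum Finset.univ fun k (_ : k ∈ Finset.univ) =>
      (Matrix.hasTaylorTwo_inv_one_sub_smul (X * A⁻¹) i k).smul (A k j)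
    have e0 : ∀ M : Matrix (Fin n) (Fin n) ℝ, ∑ k, A k j • M i k = (M * A) i j := by
      intro M
      rw [Matrix.mul_apply]
      exact Finset.sum_congr rfl fun k _ => by rw [smul_eq_mul, mul_comm]
    rw [e0, e0, e0] at h2
    have e1 : X * A⁻¹ * A = X := by rw [Matrix.mul_assoc, Matrix.nonsing_inv_mul _ hdet, Matrix.mul_one]
    have e2 : X * A⁻¹ * (X * A⁻¹) * A = X * A⁻¹ * X := by
      rw [Matrix.mul_assoc, e1]
    rw [Matrix.one_mul, e1, e2] at h2
    exact h2
  have hT := hcurve.comp_contDiffAt hF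
  have hsum := (hT.add hT.comp_neg).add (HasTaylorTwo.const (-(2 * F (fun i j => A i j, p, r, x))))
  have h0 : F (fun i j => A i j, p, r, x) + F (fun i j => A i j, p, r, x) +
      -(2 * F (fun i j => A i j, p, r, x)) = 0 := by ring
  rw [h0] at hsum
  have := (hsum.nonneg (by
    filter_upwards [hconv2] with s hs
    have e : (fun i j => (Matrix.of z.1)⁻¹ i j : Fin n → Fin n → ℝ) = fun i j => A i j := by
      have : (Matrix.of z.1)⁻¹ = A := Matrix.nonsing_inv_nonsing_inv A hdet
      rw [this]
    rw [e] at hs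
    change 2 * F (fun i j => A i j, p, r, x) ≤ F (fun i j => (A⁻¹ + s • Y)⁻¹ i j, p, r + s • τ, x + s • v) +
      F (fun i j => (A⁻¹ + (-s) • Y)⁻¹ i j, p, r + (-s) • τ, x + (-s) • v) at hs
    linarith)).2
  linarith

end StructureCondition

section StructureEstimate

variable {n : ℕ} {Base : Type*} [NormedAddCommGroup Base] [NormedSpace ℝ Base]

/-- The partial derivatives of `F` in the matrix entries. -/
noncomputable def matrixGradient (F : (Fin n → Fin n → ℝ) × (Fin n → ℝ) × ℝ × Base → ℝ)
    (z : (Fin n → Fin n → ℝ) × (Fin n → ℝ) × ℝ × Base) : Matrix (Fin n) (Fin n) ℝ :=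
  Matrix.of fun i j => fderiv ℝ F z (fun a b => if a = i ∧ b = j then (1 : ℝ) else 0, 0, 0, 0)

theorem fderiv_apply_matrix (F : (Fin n → Fin n → ℝ) × (Fin n → ℝ) × ℝ × Base → ℝ)
    (z : (Fin n → Fin n → ℝ) × (Fin n → ℝ) × ℝ × Base) (M : Fin n → Fin n → ℝ) :
    fderiv ℝ F z (M, 0, 0, 0) = ∑ i, ∑ j, matrixGradient F z i j * M i j := by
  have h : ((M, 0, 0, 0) : (Fin n → Fin n → ℝ) × (Fin n → ℝ) × ℝ × Base) =
      ∑ i, ∑ j, M i j •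
        ((fun a b => if a = i ∧ b = j then (1 : ℝ) else 0, 0, 0, 0) :
          (Fin n → Fin n → ℝ) × (Fin n → ℝ) × ℝ × Base) := by
    refine Prod.ext ?_ (Prod.ext ?_ (Prod.ext ?_ ?_))
    · ext a b
      simp [Prod.fst_sum, Finset.sum_apply, ite_and]
    all_goals simp [Prod.snd_sum]
  rw [h]
  simp only [map_sum, map_smul, smul_eq_mul, matrixGradient, Matrix.of_apply]
  exact Finset.sum_congr rfl fun i _ => Finset.sum_congr rfl fun j _ => mul_comm _ _

theorem sum_mul_mul_eq_trace (H X D : Matrix (Fin n) (Fin n) ℝ) (hX : X.transpose = X)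
    (hD : D.transpose = D) :
    ∑ i, ∑ j, H i j * (X * D * X) i j =
      (D * X.transpose * ((1 / 2 : ℝ) • (H + H.transpose)) * X).trace := by
  set Y := X * D * X with hY
  have hs : ∀ i j, Y j i = Y i j := by
    intro i j
    have : Y.transpose = Y := by
      rw [hY, Matrix.transpose_mul, Matrix.transpose_mul, hX, hD, Matrix.mul_assoc]
    exact congrFun (congrFun this i) j
  have h1 : ∀ G : Matrix (Fin n) (Fin n) ℝ,
      (D * X.transpose * G * X).trace = ∑ i, ∑ j, G i j * Y i j := by
    intro G
    rw [hX, Matrix.trace_mul_comm, ← Matrix.mul_assoc, ← Matrix.mul_assoc, Matrix.trace_mul_comm,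
      Matrix.trace]
    refine Finset.sum_congr rfl fun i _ => ?_
    rw [Matrix.diag_apply, Matrix.mul_apply]
    exact Finset.sum_congr rfl fun j _ => by rw [← hY, hs]
  have h2 : ∑ i, ∑ j, H j i * Y i j = ∑ i, ∑ j, H i j * Y i j := by
    rw [Finset.sum_comm]
    exact Finset.sum_congr rfl fun i _ => Finset.sum_congr rfl fun j _ => by rw [hs]
  rw [h1]
  simp only [Matrix.smul_apply, Matrix.add_apply, smul_eq_mul, mul_assoc, add_mul, mul_add,
    Finset.sum_add_distrib, ← Finset.mul_sum, Matrix.transpose_apply, h2]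
  ring

theorem dotProduct_symmetrization_mulVec (H : Matrix (Fin n) (Fin n) ℝ) (ξ : Fin n → ℝ) :
    ξ ⬝ᵥ ((1 / 2 : ℝ) • (H + H.transpose)).mulVec ξ = ∑ i, ∑ j, H i j * ξ i * ξ j := by
  have h2 : ∑ i, ∑ j, ξ i * (H j i * ξ j) = ∑ i, ∑ j, ξ i * (H i j * ξ j) := by
    rw [Finset.sum_comm]
    exact Finset.sum_congr rfl fun i _ => Finset.sum_congr rfl fun j _ => by ring
  have h3 : ∑ i, ∑ j, H i j * ξ i * ξ j = ∑ i, ∑ j, ξ i * (H i j * ξ j) :=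
    Finset.sum_congr rfl fun i _ => Finset.sum_congr rfl fun j _ => by ring
  rw [h3]
  simp only [dotProduct, Matrix.mulVec, Matrix.smul_apply, Matrix.add_apply, smul_eq_mul,
    Matrix.transpose_apply, Finset.mul_sum]
  have h4 : ∀ i j, ξ i * (1 / 2 * (H i j + H j i) * ξ j) =
      1 / 2 * (ξ i * (H i j * ξ j)) + 1 / 2 * (ξ i * (H j i * ξ j)) := fun i j => by ring
  simp only [h4, Finset.sum_add_distrib, ← Finset.mul_sum _ _ (1 / 2 : ℝ), h2]
  ring

/-- The energy `tr (A⁻¹ Wᵀ H W)` when `W = S Π`, with `Π` a spectral projection of `A`. -/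
theorem trace_spectral_projection (H S E : Matrix (Fin n) (Fin n) ℝ) (d : Fin n → ℝ)
    (hE : E.transpose * E = 1) (hS : S.transpose = S) (R : Finset (Fin n)) :
    (E * Matrix.diagonal (fun i => (d i)⁻¹) * E.transpose *
        (S * (E * Matrix.diagonal (fun i => if i ∈ R then 1 else 0) * E.transpose)).transpose * H *
        (S * (E * Matrix.diagonal (fun i => if i ∈ R then 1 else 0) * E.transpose))).trace =
      ∑ c ∈ R, (d c)⁻¹ * ((fun a => (S * E) a c) ⬝ᵥ H.mulVec (fun a => (S * E) a c)) := by
  set Δ : Matrix (Fin n) (Fin n) ℝ := Matrix.diagonal (fun i => (d i)⁻¹)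
  set T : Matrix (Fin n) (Fin n) ℝ := Matrix.diagonal (fun i => if i ∈ R then 1 else 0)
  have hTD : T * Δ * T = Matrix.diagonal (fun i => if i ∈ R then (d i)⁻¹ else 0) := by
    simp only [T, Δ, Matrix.diagonal_mul_diagonal]
    congr; ext i; split_ifs <;> simp
  have hT : T.transpose = T := Matrix.diagonal_transpose _
  have h1 : (E * Δ * E.transpose * (S * (E * T * E.transpose)).transpose * H *
        (S * (E * T * E.transpose))).trace =
      ((T * Δ * T) * (E.transpose * S * H * S * E)).trace := by
    have e : (S * (E * T * E.transpose)).transpose = E * T * E.transpose * S := by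
      simp only [Matrix.transpose_mul, Matrix.transpose_transpose, hT, hS, Matrix.mul_assoc]
    rw [e]
    calc _ = (E * (Δ * (E.transpose * E) * T * E.transpose * S * H *
        S * E * T * E.transpose)).trace := by simp only [Matrix.mul_assoc]
      _ = (Δ * (E.transpose * E) * T * E.transpose * S * H *
        S * E * T * (E.transpose * E)).trace := by
          rw [Matrix.trace_mul_comm]; simp only [Matrix.mul_assoc]
      _ = ((Δ * T * E.transpose * S * H * S * E) * T).trace := by
          rw [hE]; simp only [Matrix.mul_one]
      _ = _ := by rw [Matrix.trace_mul_comm]; simp only [Matrix.mul_assoc]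
  rw [h1, hTD, Matrix.trace, ← Finset.sum_filter_add_sum_filter_not _ (fun i => i ∈ R)]
  have h2 : ∑ i with i ∉ R, (Matrix.diagonal (fun i => if i ∈ R then (d i)⁻¹ else 0) *
      (E.transpose * S * H * S * E)).diag i = 0 := by
    refine Finset.sum_eq_zero fun i hi => ?_
    simp [(Finset.mem_filter.mp hi).2]
  rw [h2, add_zero, Finset.filter_univ_mem]
  refine Finset.sum_congr rfl fun c hc => ?_
  rw [Matrix.diag_apply, Matrix.diagonal_mul, if_pos hc]
  congr 1
  have : E.transpose * S * H * S * E = (S * E).transpose * (H * (S * E)) := by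
    rw [Matrix.transpose_mul, hS]; simp only [Matrix.mul_assoc]
  rw [this]
  rfl

/-- The second derivative of `F` in a direction `(S, 0, τ, v)` at a positive definite matrix. -/
theorem neg_second_derivative_le_of_posDef {L K N : ℝ} (hL : 0 < L) (hK : 0 ≤ K) (hN : 0 ≤ N)
    {F : (Fin n → Fin n → ℝ) × (Fin n → ℝ) × ℝ × Base → ℝ}
    {A E : Matrix (Fin n) (Fin n) ℝ} {d : Fin n → ℝ} (hE : E.transpose * E = 1)
    (hd : ∀ i, 0 < d i) (hAE : A = E * Matrix.diagonal d * E.transpose)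
    {p : Fin n → ℝ} {r : ℝ} {x : Base} {U : Set Base}
    (hU : IsOpen U) (hx : x ∈ U) (hF : ContDiffAt ℝ 2 F (fun i j => A i j, p, r, x))
    (hF2 : ‖fderiv ℝ (fderiv ℝ F) (fun i j => A i j, p, r, x)‖ ≤ K)
    (hell : ∀ ξ : Fin n → ℝ,
      L⁻¹ * ∑ i, ξ i ^ 2 ≤
        ∑ i, ∑ j, matrixGradient F (fun i j => A i j, p, r, x) i j * ξ i * ξ j ∧
      ∑ i, ∑ j, matrixGradient F (fun i j => A i j, p, r, x) i j * ξ i * ξ j ≤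
        L * ∑ i, ξ i ^ 2)
    (hconv : ∃ t : Set ((Fin n → Fin n → ℝ) × ℝ × Base),
      IsOpen t ∧ (fun i j => A⁻¹ i j, r, x) ∈ t ∧
        ConvexOn ℝ ({w | (Matrix.of w.1).PosDef ∧ w.2.2 ∈ U} ∩ t)
          (fun w => F (fun i j => (Matrix.of w.1)⁻¹ i j, p, w.2.1, w.2.2)))
    {S : Matrix (Fin n) (Fin n) ℝ} (hS : S.transpose = S) (τ : ℝ) (v : Base)
    (hSN : ‖((fun i j => S i j, 0, τ, v) :
      (Fin n → Fin n → ℝ) × (Fin n → ℝ) × ℝ × Base)‖ ≤ N) (R : Finset (Fin n)) :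
    -(fderiv ℝ (fderiv ℝ F) (fun i j => A i j, p, r, x)
        (fun i j => S i j, 0, τ, v) (fun i j => S i j, 0, τ, v)) ≤
      2 * ∑ c ∈ R, (d c)⁻¹ * ∑ a, ∑ b, matrixGradient F (fun i j => A i j, p, r, x) a b *
          (S * E) a c * (S * E) b c +
        K * (2 * n ^ 2 * L ^ 2 * n) * (2 * N + 2 * n ^ 2 * L ^ 2 * n * (n ^ 3 * N)) *
          ∑ c ∈ Rᶜ, ∑ a, |(S * E) a c| := by
  have hE' : E * E.transpose = 1 := mul_eq_one_comm.mp hE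
  have hE1 : ∀ b c, |E b c| ≤ 1 := by
    intro b c
    have h1 : ∑ k, E k c ^ 2 = 1 := by
      have := congrFun (congrFun hE c) c
      simpa [Matrix.mul_apply, sq] using this
    have h2 := Finset.single_le_sum (f := fun k => E k c ^ 2) (fun i _ => sq_nonneg _)
      (Finset.mem_univ b)
    rw [h1] at h2
    exact (sq_le_one_iff_abs_le_one _).mp h2
  have hinv : A⁻¹ = E * Matrix.diagonal (fun i => (d i)⁻¹) * E.transpose := by
    refine Matrix.inv_eq_right_inv ?_
    rw [hAE]
    calc _ = E * Matrix.diagonal d * (E.transpose * E) * Matrix.diagonal (fun i => (d i)⁻¹) *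
          E.transpose := by simp only [Matrix.mul_assoc]
      _ = E * (Matrix.diagonal d * Matrix.diagonal (fun i => (d i)⁻¹)) * E.transpose := by
          rw [hE]; simp only [Matrix.mul_one, Matrix.mul_assoc]
      _ = 1 := by
          rw [Matrix.diagonal_mul_diagonal]
          simp [(hd _).ne', hE']
  have hA : A.PosDef := by
    rw [hAE]
    have := (Matrix.PosDef.diagonal hd).conjTranspose_mul_mul_same (B := E.transpose) (by
      intro y y' hy
      simpa [Matrix.mulVec_mulVec, hE'] using congrArg E.mulVec hy)
    simpa using this
  have hAi : (A⁻¹).transpose = A⁻¹ := by simpa [Matrix.IsHermitian] using hA.inv.isHermitian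
  set z : (Fin n → Fin n → ℝ) × (Fin n → ℝ) × ℝ × Base := (fun i j => A i j, p, r, x) with hz
  set G := matrixGradient F z with hG
  set Hs : Matrix (Fin n) (Fin n) ℝ := (1 / 2 : ℝ) • (G + G.transpose) with hHs
  have hHsT : Hs.transpose = Hs := by
    rw [hHs, Matrix.transpose_smul, Matrix.transpose_add, Matrix.transpose_transpose, add_comm]
  set T : Matrix (Fin n) (Fin n) ℝ := Matrix.diagonal (fun i => if i ∈ R then 1 else 0) with hT
  set Z : Matrix (Fin n) (Fin n) ℝ := S * (E * T * E.transpose) - S with hZ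
  set s : ℝ := ∑ c ∈ Rᶜ, ∑ a, |(S * E) a c| with hs
  have hs0 : 0 ≤ s := Finset.sum_nonneg fun _ _ => Finset.sum_nonneg fun _ _ => abs_nonneg _
  have hSent : ∀ i j, |S i j| ≤ N := by
    intro i j
    have h1 := (norm_fst_le _).trans hSN
    have h2 := (norm_le_pi_norm (fun i j => S i j) i).trans h1
    exact (norm_le_pi_norm (fun j => S i j) j).trans h2
  have hZab : ∀ a b, |Z a b| ≤ ∑ c ∈ Rᶜ, |(S * E) a c| := by
    intro a b
    have h1 : Z = (S * E) * (T - 1) * E.transpose := by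
      rw [Matrix.mul_sub, Matrix.sub_mul, Matrix.mul_one, Matrix.mul_assoc S E E.transpose, hE',
        Matrix.mul_one, hZ]
      simp only [Matrix.mul_assoc]
    have h2 : T - 1 = Matrix.diagonal (fun i => if i ∈ R then (0 : ℝ) else -1) := by
      rw [hT, ← Matrix.diagonal_one, Matrix.diagonal_sub]
      congr; ext i; split_ifs <;> simp
    rw [h1, h2, Matrix.mul_apply]
    simp only [Matrix.mul_diagonal, Matrix.transpose_apply]
    refine (Finset.abs_sum_le_sum_abs _ _).trans ?_
    rw [← Finset.sum_add_sum_compl R]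
    have h3 : ∑ c ∈ R, |(S * E) a c * (if c ∈ R then (0 : ℝ) else -1) * E b c| = 0 :=
      Finset.sum_eq_zero fun c hc => by simp [hc]
    rw [h3, zero_add]
    refine Finset.sum_le_sum fun c hc => ?_
    rw [if_neg (Finset.mem_compl.mp hc), abs_mul, mul_neg_one, abs_neg]
    exact mul_le_of_le_one_right (abs_nonneg _) (hE1 b c)
  have hZs : ∑ a, ∑ b, |Z a b| ≤ n * s := by
    calc ∑ a, ∑ b, |Z a b| ≤ ∑ a, ∑ _b : Fin n, ∑ c ∈ Rᶜ, |(S * E) a c| :=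
          Finset.sum_le_sum fun a _ => Finset.sum_le_sum fun b _ => hZab a b
      _ = n * s := by
          simp only [Finset.sum_const, Finset.card_univ, Fintype.card_fin, nsmul_eq_mul,
            ← Finset.mul_sum]
          rw [Finset.sum_comm]
  have hsN : s ≤ n ^ 3 * N := by
    have h1 : ∀ a c, |(S * E) a c| ≤ n * N := by
      intro a c
      rw [Matrix.mul_apply]
      refine (Finset.abs_sum_le_sum_abs _ _).trans ?_
      calc ∑ k, |S a k * E k c| ≤ ∑ _k : Fin n, N := Finset.sum_le_sum fun k _ => by
            rw [abs_mul]
            exact (mul_le_of_le_one_right (abs_nonneg _) (hE1 k c)).trans (hSent a k)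
        _ = n * N := by simp
    calc s ≤ ∑ c : Fin n, ∑ a, |(S * E) a c| :=
          Finset.sum_le_sum_of_subset_of_nonneg (Finset.subset_univ _)
            fun _ _ _ => Finset.sum_nonneg fun _ _ => abs_nonneg _
      _ ≤ ∑ _c : Fin n, ∑ _a : Fin n, n * N :=
          Finset.sum_le_sum fun c _ => Finset.sum_le_sum fun a _ => h1 a c
      _ = n ^ 3 * N := by simp; ring
  obtain ⟨X, hXs, hXle, hXS⟩ := Matrix.exists_symmetric_energy_le (H := Hs) (D := A⁻¹) (Z := Z) hL hHsT
    (fun ξ => by rw [hHs, dotProduct_symmetrization_mulVec]; exact hell ξ) hA.inv hS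
  have hmain := second_derivative_nonneg_of_convexOn_inv hA hU hx hF hconv hXs τ v
  rw [fderiv_apply_matrix, sum_mul_mul_eq_trace _ _ _ hXs hAi] at hmain
  have hSZ : S + Z = S * (E * T * E.transpose) := by rw [hZ]; abel
  have htr : (A⁻¹ * (S + Z).transpose * Hs * (S + Z)).trace =
      ∑ c ∈ R, (d c)⁻¹ * ∑ a, ∑ b, G a b * (S * E) a c * (S * E) b c := by
    rw [hSZ, hinv, trace_spectral_projection Hs S E d hE hS R]
    exact Finset.sum_congr rfl fun c _ => by rw [hHs, dotProduct_symmetrization_mulVec]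
  set B := fderiv ℝ (fderiv ℝ F) z with hB
  set δS : (Fin n → Fin n → ℝ) × (Fin n → ℝ) × ℝ × Base := (fun i j => S i j, 0, τ, v) with hδS
  set δX : (Fin n → Fin n → ℝ) × (Fin n → ℝ) × ℝ × Base := (fun i j => X i j, 0, τ, v) with hδX
  set e : ℝ := 2 * n ^ 2 * L ^ 2 * n * s with he
  have he0 : 0 ≤ e := by positivity
  have hdiff : ‖δX - δS‖ ≤ e := by
    have h1 : δX - δS = (fun i j => (X - S) i j, 0, 0, 0) := by
      simp [hδX, hδS, Prod.ext_iff]; rfl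
    rw [h1]
    refine max_le ((pi_norm_le_iff_of_nonneg he0).mpr fun i =>
      (pi_norm_le_iff_of_nonneg he0).mpr fun j => ?_) (by simp [he0])
    refine (hXS i j).trans ?_
    rw [Fintype.card_fin, he, mul_assoc _ (n : ℝ) s]
    exact mul_le_mul_of_nonneg_left hZs (by positivity)
  have hδXn : ‖δX‖ ≤ N + e := by
    have : δX = δS + (δX - δS) := by abel
    rw [this]
    exact (norm_add_le _ _).trans (add_le_add hSN hdiff)
  have hBop : ∀ y y' : (Fin n → Fin n → ℝ) × (Fin n → ℝ) × ℝ × Base, |B y y'| ≤ K * ‖y‖ * ‖y'‖ :=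
    fun y y' => (B.le_opNorm₂ y y').trans (by gcongr)
  have hBdiff : B δX δX - B δS δS ≤ K * e * (2 * N + e) := by
    have h1 : B δX δX - B δS δS = B (δX - δS) δX + B δS (δX - δS) := by
      simp only [map_sub, sub_apply]; ring
    rw [h1]
    have h2 := (le_abs_self _).trans (hBop (δX - δS) δX)
    have h3 := (le_abs_self _).trans (hBop δS (δX - δS))
    have h4 : K * ‖δX - δS‖ * ‖δX‖ ≤ K * e * (N + e) := by gcongr
    have h5 : K * ‖δS‖ * ‖δX - δS‖ ≤ K * N * e := by gcongr
    nlinarith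
  have hfin : K * e * (2 * N + e) ≤
      K * (2 * n ^ 2 * L ^ 2 * n) * (2 * N + 2 * n ^ 2 * L ^ 2 * n * (n ^ 3 * N)) * s := by
    have : e ≤ 2 * n ^ 2 * L ^ 2 * n * (n ^ 3 * N) := by rw [he]; gcongr
    calc K * e * (2 * N + e) ≤ K * e * (2 * N + 2 * n ^ 2 * L ^ 2 * n * (n ^ 3 * N)) := by gcongr
      _ = _ := by rw [he]; ring
  rw [← htr]
  linarith

end StructureEstimate

section StructureLimit

variable {n : ℕ} {Base : Type*} [NormedAddCommGroup Base] [NormedSpace ℝ Base]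

theorem ContDiffAt.continuousAt_fderiv_fderiv {V : Type*} [NormedAddCommGroup V] [NormedSpace ℝ V]
    {F : V → ℝ} {z : V} (hF : ContDiffAt ℝ 2 F z) : ContinuousAt (fderiv ℝ (fderiv ℝ F)) z := by
  have h1 : ContDiffAt ℝ 1 (fderiv ℝ F) z := hF.fderiv_right (by norm_num)
  exact (h1.fderiv_right (m := 0) (by norm_num)).continuousAt

theorem ContDiffAt.continuousAt_matrixGradient
    {F : (Fin n → Fin n → ℝ) × (Fin n → ℝ) × ℝ × Base → ℝ}
    {z : (Fin n → Fin n → ℝ) × (Fin n → ℝ) × ℝ × Base} (hF : ContDiffAt ℝ 2 F z) (i j : Fin n) :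
    ContinuousAt (fun z => matrixGradient F z i j) z := by
  have h1 : ContinuousAt (fderiv ℝ F) z :=
    (hF.fderiv_right (m := 1) (by norm_num)).continuousAt
  exact h1.clm_apply continuousAt_const

theorem abs_sum_sum_mul_mul_le (G : Fin n → Fin n → ℝ) (ξ : Fin n → ℝ) :
    |∑ i, ∑ j, G i j * ξ i * ξ j| ≤ (∑ i, ∑ j, |G i j|) * ∑ i, ξ i ^ 2 := by
  rw [Finset.sum_mul]
  refine (Finset.abs_sum_le_sum_abs _ _).trans (Finset.sum_le_sum fun i _ => ?_)
  rw [Finset.sum_mul]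
  refine (Finset.abs_sum_le_sum_abs _ _).trans (Finset.sum_le_sum fun j _ => ?_)
  rw [mul_assoc, abs_mul]
  refine mul_le_mul_of_nonneg_left ?_ (abs_nonneg _)
  have h1 := Finset.single_le_sum (f := fun k => ξ k ^ 2) (fun i _ => sq_nonneg _)
    (Finset.mem_univ i)
  have h2 := Finset.single_le_sum (f := fun k => ξ k ^ 2) (fun i _ => sq_nonneg _)
    (Finset.mem_univ j)
  rw [abs_le]
  constructor <;> nlinarith [sq_nonneg (ξ i + ξ j), sq_nonneg (ξ i - ξ j)]

/-- The second derivative of `F` in a direction `(S, 0, τ, v)` at a positive semidefinite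
matrix. -/
theorem neg_second_derivative_le {L K N : ℝ} (hL : 0 < L) (hK : 0 ≤ K) (hN : 0 ≤ N)
    {F : (Fin n → Fin n → ℝ) × (Fin n → ℝ) × ℝ × Base → ℝ} {U : Set Base} (hU : IsOpen U)
    (hF : ContDiffOn ℝ 2 F {z | z.2.2.2 ∈ U})
    (hF2 : ∀ z : (Fin n → Fin n → ℝ) × (Fin n → ℝ) × ℝ × Base, z.2.2.2 ∈ U →
      ‖fderiv ℝ (fderiv ℝ F) z‖ ≤ K)
    {A E : Matrix (Fin n) (Fin n) ℝ} {d : Fin n → ℝ} (hE : E.transpose * E = 1)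
    (hd : ∀ i, 0 ≤ d i) (hAE : A = E * Matrix.diagonal d * E.transpose)
    {p : Fin n → ℝ} {r : ℝ} {x : Base} (hx : x ∈ U)
    (hell : ∀ ξ : Fin n → ℝ,
      L⁻¹ * ∑ i, ξ i ^ 2 ≤
        ∑ i, ∑ j, matrixGradient F (fun i j => A i j, p, r, x) i j * ξ i * ξ j ∧
      ∑ i, ∑ j, matrixGradient F (fun i j => A i j, p, r, x) i j * ξ i * ξ j ≤
        L * ∑ i, ξ i ^ 2)
    (hconv : ∀ z ∈ {w : (Fin n → Fin n → ℝ) × ℝ × Base | (Matrix.of w.1).PosDef ∧ w.2.2 ∈ U},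
      ∃ t : Set ((Fin n → Fin n → ℝ) × ℝ × Base), IsOpen t ∧ z ∈ t ∧
        ConvexOn ℝ ({w | (Matrix.of w.1).PosDef ∧ w.2.2 ∈ U} ∩ t)
          (fun w => F (fun i j => (Matrix.of w.1)⁻¹ i j, p, w.2.1, w.2.2)))
    {S : Matrix (Fin n) (Fin n) ℝ} (hS : S.transpose = S) (τ : ℝ) (v : Base)
    (hSN : ‖((fun i j => S i j, 0, τ, v) :
      (Fin n → Fin n → ℝ) × (Fin n → ℝ) × ℝ × Base)‖ ≤ N) (R : Finset (Fin n))
    (hR : ∀ c ∈ R, 0 < d c) :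
    -(fderiv ℝ (fderiv ℝ F) (fun i j => A i j, p, r, x)
        (fun i j => S i j, 0, τ, v) (fun i j => S i j, 0, τ, v)) ≤
      2 * ∑ c ∈ R, (d c)⁻¹ * ∑ a, ∑ b, matrixGradient F (fun i j => A i j, p, r, x) a b *
          (S * E) a c * (S * E) b c +
        K * (2 * n ^ 2 * (2 * L) ^ 2 * n) *
          (2 * N + 2 * n ^ 2 * (2 * L) ^ 2 * n * (n ^ 3 * N)) *
          ∑ c ∈ Rᶜ, ∑ a, |(S * E) a c| := by
  have hE' : E * E.transpose = 1 := mul_eq_one_comm.mp hE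
  set Aε : ℝ → Matrix (Fin n) (Fin n) ℝ := fun ε => A + ε • (1 : Matrix (Fin n) (Fin n) ℝ) with hAε
  have hAεE : ∀ ε, Aε ε = E * Matrix.diagonal (fun i => d i + ε) * E.transpose := by
    intro ε
    have : Matrix.diagonal (fun i => d i + ε) = Matrix.diagonal d + ε • (1 : Matrix (Fin n) (Fin n) ℝ) := by
      rw [← Matrix.diagonal_one, ← Matrix.diagonal_smul, Matrix.diagonal_add]
      congr; ext i; simp
    rw [this, Matrix.mul_add, Matrix.add_mul, ← hAE, Matrix.mul_smul, Matrix.mul_one,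
      Matrix.smul_mul, hE']
  set z : ℝ → (Fin n → Fin n → ℝ) × (Fin n → ℝ) × ℝ × Base :=
    fun ε => (fun i j => Aε ε i j, p, r, x) with hz
  have hz0 : z 0 = (fun i j => A i j, p, r, x) := by simp [hz, hAε]
  have hzc : Filter.Tendsto z (nhdsWithin 0 (Set.Ioi 0)) (nhds (z 0)) := by
    refine Filter.Tendsto.mono_left ?_ nhdsWithin_le_nhds
    refine Continuous.tendsto (continuous_prodMk.mpr ⟨?_, continuous_const⟩) 0
    refine continuous_pi fun i => continuous_pi fun j => ?_
    simp only [hAε, Matrix.add_apply, Matrix.smul_apply]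
    fun_prop
  have hdom : IsOpen {z : (Fin n → Fin n → ℝ) × (Fin n → ℝ) × ℝ × Base | z.2.2.2 ∈ U} :=
    hU.preimage (by fun_prop)
  have hFat : ∀ ε, ContDiffAt ℝ 2 F (z ε) := fun ε => hF.contDiffAt (hdom.mem_nhds hx)
  rw [← hz0] at hell ⊢
  have hGc : ∀ i j, Filter.Tendsto (fun ε => matrixGradient F (z ε) i j)
      (nhdsWithin 0 (Set.Ioi 0)) (nhds (matrixGradient F (z 0) i j)) := fun i j =>
    ((hFat 0).continuousAt_matrixGradient i j).tendsto.comp hzc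
  have hBc : Filter.Tendsto (fun ε => fderiv ℝ (fderiv ℝ F) (z ε) (fun i j => S i j, 0, τ, v)
      (fun i j => S i j, 0, τ, v)) (nhdsWithin 0 (Set.Ioi 0))
      (nhds (fderiv ℝ (fderiv ℝ F) (z 0) (fun i j => S i j, 0, τ, v)
      (fun i j => S i j, 0, τ, v))) := by
    have h2 : Continuous fun B : ((Fin n → Fin n → ℝ) × (Fin n → ℝ) × ℝ × Base) →L[ℝ]
        ((Fin n → Fin n → ℝ) × (Fin n → ℝ) × ℝ × Base) →L[ℝ] ℝ =>
        B (fun i j => S i j, 0, τ, v) (fun i j => S i j, 0, τ, v) := by fun_prop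
    exact (h2.tendsto _).comp ((hFat 0).continuousAt_fderiv_fderiv.tendsto.comp hzc)
  have hsmall : ∀ᶠ ε in nhdsWithin 0 (Set.Ioi 0),
      ∑ i, ∑ j, |matrixGradient F (z ε) i j - matrixGradient F (z 0) i j| < min (2 * L)⁻¹ L := by
    have h1 : Filter.Tendsto
        (fun ε => ∑ i, ∑ j, |matrixGradient F (z ε) i j - matrixGradient F (z 0) i j|)
        (nhdsWithin 0 (Set.Ioi 0)) (nhds 0) := by
      have h2 := tendsto_finsetSum Finset.univ fun i (_ : i ∈ Finset.univ) =>
        tendsto_finsetSum Finset.univ fun j (_ : j ∈ Finset.univ) =>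
          ((hGc i j).sub_const (matrixGradient F (z 0) i j)).abs
      simpa using h2
    exact h1.eventually_lt_const (lt_min (by positivity) hL)
  refine le_of_tendsto_of_tendsto hBc.neg (((tendsto_finsetSum _ fun c hc => Filter.Tendsto.mul
    (f := fun ε => (d c + ε)⁻¹) ?_ (tendsto_finsetSum _ fun a _ => tendsto_finsetSum _ fun b _ =>
      ((hGc a b).mul_const _).mul_const _)).const_mul 2).add tendsto_const_nhds) ?_
  · refine Filter.Tendsto.inv₀ ?_ (hR c hc).ne'
    have : Continuous fun ε : ℝ => d c + ε := by fun_prop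
    simpa using (this.tendsto 0).mono_left nhdsWithin_le_nhds
  · filter_upwards [hsmall, self_mem_nhdsWithin] with ε hε hpos
    have hdε : ∀ i, 0 < d i + ε := fun i => add_pos_of_nonneg_of_pos (hd i) hpos
    have hpd : (Aε ε).PosDef := by
      rw [hAεE]
      have := (Matrix.PosDef.diagonal hdε).conjTranspose_mul_mul_same (B := E.transpose) (by
        intro y y' hy
        simpa [Matrix.mulVec_mulVec, hE'] using congrArg E.mulVec hy)
      simpa using this
    refine neg_second_derivative_le_of_posDef (L := 2 * L) (by positivity) hK hN hE hdε (hAεE ε)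
      hU hx (hFat ε) (hF2 _ hx) ?_ (hconv (fun i j => (Aε ε)⁻¹ i j, r, x) ⟨hpd.inv, hx⟩) hS τ v hSN R
    intro ξ
    have h0 : 0 ≤ ∑ i, ξ i ^ 2 := Finset.sum_nonneg fun _ _ => sq_nonneg _
    have h1 := abs_sum_sum_mul_mul_le
      (fun i j => matrixGradient F (z ε) i j - matrixGradient F (z 0) i j) ξ
    have h2 : ∑ i, ∑ j, (matrixGradient F (z ε) i j - matrixGradient F (z 0) i j) * ξ i * ξ j =
        ∑ i, ∑ j, matrixGradient F (z ε) i j * ξ i * ξ j -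
          ∑ i, ∑ j, matrixGradient F (z 0) i j * ξ i * ξ j := by
      simp only [sub_mul, Finset.sum_sub_distrib]
    rw [h2] at h1
    have h3 := mul_le_mul_of_nonneg_right (hε.le.trans (min_le_left _ _)) h0
    have h4 := mul_le_mul_of_nonneg_right (hε.le.trans (min_le_right _ _)) h0
    have h5 := abs_le.mp h1
    have h6 := hell ξ
    have h7 : (2 * L)⁻¹ * ∑ i, ξ i ^ 2 = L⁻¹ * ∑ i, ξ i ^ 2 / 2 := by
      rw [← Finset.sum_div]; field_simp
    have h8 : (2 * L)⁻¹ * ∑ i, ξ i ^ 2 = L⁻¹ * (∑ i, ξ i ^ 2) / 2 := by field_simp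
    constructor <;> linarith

end StructureLimit

section PartialDerivatives

variable {n : ℕ} {f g : EuclideanSpace ℝ (Fin n) → ℝ} {x : EuclideanSpace ℝ (Fin n)}

theorem pd_coe (f : EuclideanSpace ℝ (Fin n) → ℝ) (x : EuclideanSpace ℝ (Fin n)) (i : Fin n) :
    pd f x i = fderiv ℝ f x (EuclideanSpace.single i 1) := by
  simp [pd]

theorem fderiv_eq_sum_pd (f : EuclideanSpace ℝ (Fin n) → ℝ) (x ξ : EuclideanSpace ℝ (Fin n)) :
    fderiv ℝ f x ξ = ∑ c : Fin n, ξ c * pd f x c := by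
  conv_lhs => rw [← (EuclideanSpace.basisFun (Fin n) ℝ).sum_repr ξ]
  simp [pd_coe]

theorem contDiffAt_pd {m : WithTop ℕ∞} (hf : ContDiffAt ℝ (m + 1) f x) (i : Fin n) :
    ContDiffAt ℝ m (fun y => pd f y i) x := by
  simp only [pd_coe]
  exact (hf.fderiv_right le_rfl).clm_apply contDiffAt_const

theorem Filter.EventuallyEq.pd_eq (h : f =ᶠ[nhds x] g) (i : ℕ) : pd f x i = pd g x i := by
  simp only [pd, h.fderiv_eq]

theorem fderiv_fderiv_eq_sum_pd (hf : ContDiffAt ℝ 2 f x) (ξ η : EuclideanSpace ℝ (Fin n)) :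
    fderiv ℝ (fderiv ℝ f) x ξ η = ∑ c : Fin n, ∑ d : Fin n, ξ c * η d * pd (fun y => pd f y d) x c := by
  have h1 : DifferentiableAt ℝ (fderiv ℝ f) x :=
    (hf.fderiv_right (m := 1) (by norm_num)).differentiableAt (by norm_num)
  have h2 : fderiv ℝ (fun y => fderiv ℝ f y η) x ξ = fderiv ℝ (fderiv ℝ f) x ξ η := by
    rw [fderiv_clm_apply h1 (differentiableAt_const η)]
    simp
  rw [← h2]
  have h3 : (fun y => fderiv ℝ f y η) = fun y => ∑ d : Fin n, η d * pd f y d :=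
    funext fun y => fderiv_eq_sum_pd f y η
  have h4 : ∀ d : Fin n, DifferentiableAt ℝ (fun y => pd f y d) x := fun d =>
    (contDiffAt_pd (m := 1) hf d).differentiableAt (by norm_num)
  rw [h3, fderiv_fun_sum fun d _ => (h4 d).const_mul _, sum_apply, Finset.sum_comm]
  refine Finset.sum_congr rfl fun d _ => ?_
  rw [fderiv_const_mul (h4 d), smul_apply, fderiv_eq_sum_pd, smul_eq_mul, Finset.mul_sum]
  exact Finset.sum_congr rfl fun c _ => by ring

theorem pd_pd_comm (hf : ContDiffAt ℝ 2 f x) (i j : Fin n) :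
    pd (fun y => pd f y i) x j = pd (fun y => pd f y j) x i := by
  have h := hf.isSymmSndFDerivAt (by simp) (EuclideanSpace.single i 1) (EuclideanSpace.single j 1)
  rw [fderiv_fderiv_eq_sum_pd hf, fderiv_fderiv_eq_sum_pd hf] at h
  simpa [PiLp.single_apply, ite_and] using h.symm

theorem ContDiffAt.hasTaylorTwo_line (hf : ContDiffAt ℝ 2 f x) (ξ : EuclideanSpace ℝ (Fin n)) :
    HasTaylorTwo (fun t : ℝ => f (x + t • ξ)) (f x) (∑ c : Fin n, ξ c * pd f x c)
      ((1 / 2) * ∑ c : Fin n, ∑ d : Fin n, ξ c * ξ d * pd (fun y => pd f y c) x d) := by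
  have h := (HasTaylorTwo.line x ξ).comp_contDiffAt hf
  rw [map_zero, zero_add, fderiv_fderiv_eq_sum_pd hf, fderiv_eq_sum_pd] at h
  simp only [pd_pd_comm hf] at h ⊢
  exact h

theorem norm_iteratedFDeriv_pd_le {m : ℕ} (hf : ContDiffAt ℝ (m + 1) f x) (i : Fin n) :
    ‖iteratedFDeriv ℝ m (fun y => pd f y i) x‖ ≤ ‖iteratedFDeriv ℝ (m + 1) f x‖ := by
  have h1 : (fun y => pd f y i) =
      ContinuousLinearMap.apply ℝ ℝ (EuclideanSpace.single i (1 : ℝ)) ∘ fderiv ℝ f :=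
    funext fun y => pd_coe f y i
  rw [h1, ← norm_iteratedFDeriv_fderiv]
  refine (ContinuousLinearMap.norm_iteratedFDeriv_comp_left _
    (hf.fderiv_right (m := m) le_rfl) le_rfl).trans ?_
  refine mul_le_of_le_one_left (norm_nonneg _) ?_
  refine ContinuousLinearMap.opNorm_le_bound _ zero_le_one fun L => ?_
  rw [ContinuousLinearMap.apply_apply, one_mul]
  simpa using L.le_opNorm (EuclideanSpace.single i (1 : ℝ))

end PartialDerivatives

section HigherDerivatives

variable {n : ℕ} {u : EuclideanSpace ℝ (Fin n) → ℝ} {x : EuclideanSpace ℝ (Fin n)}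

/-- Third partial derivatives. -/
noncomputable def thirdDeriv (u : EuclideanSpace ℝ (Fin n) → ℝ) (x : EuclideanSpace ℝ (Fin n))
    (i j c : Fin n) : ℝ :=
  pd (fun y => hessM u y i j) x c

/-- Fourth partial derivatives. -/
noncomputable def fourthDeriv (u : EuclideanSpace ℝ (Fin n) → ℝ) (x : EuclideanSpace ℝ (Fin n))
    (i j c d : Fin n) : ℝ :=
  pd (fun y => thirdDeriv u y i j c) x d

theorem contDiffAt_hessM {m : WithTop ℕ∞} (hu : ContDiffAt ℝ (m + 1 + 1) u x) (i j : Fin n) :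
    ContDiffAt ℝ m (fun y => hessM u y i j) x :=
  contDiffAt_pd (contDiffAt_pd hu j) i

theorem hessM_comm (hu : ContDiffAt ℝ 2 u x) (i j : Fin n) : hessM u x i j = hessM u x j i :=
  pd_pd_comm hu j i

theorem hessM_transpose (hu : ContDiffAt ℝ 2 u x) : (hessM u x).transpose = hessM u x :=
  Matrix.ext fun i j => hessM_comm hu j i

theorem ContDiffAt.eventually_contDiffAt {V : Type*} [NormedAddCommGroup V] [NormedSpace ℝ V]
    {f : V → ℝ} {z : V} {k m : ℕ} (hf : ContDiffAt ℝ k f z) (hm : m ≤ k) :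
    ∀ᶠ y in nhds z, ContDiffAt ℝ m f y := by
  filter_upwards [hf.eventually (by simp)] with y hy
  exact hy.of_le (by exact_mod_cast hm)

theorem thirdDeriv_comm₁₂ (hu : ContDiffAt ℝ 3 u x) (i j c : Fin n) :
    thirdDeriv u x i j c = thirdDeriv u x j i c := by
  refine Filter.EventuallyEq.pd_eq ?_ c
  filter_upwards [ContDiffAt.eventually_contDiffAt (k := 3) (m := 2) hu (by norm_num)] with y hy
  exact hessM_comm hy i j

theorem thirdDeriv_comm₁₃ (hu : ContDiffAt ℝ 3 u x) (i j c : Fin n) :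
    thirdDeriv u x i j c = thirdDeriv u x c j i :=
  pd_pd_comm (contDiffAt_pd (m := 2) hu j) i c

theorem thirdDeriv_comm₂₃ (hu : ContDiffAt ℝ 3 u x) (i j c : Fin n) :
    thirdDeriv u x i j c = thirdDeriv u x i c j := by
  rw [thirdDeriv_comm₁₂ hu, thirdDeriv_comm₁₃ hu, thirdDeriv_comm₁₂ hu]

theorem fourthDeriv_comm₃₄ (hu : ContDiffAt ℝ 4 u x) (i j c d : Fin n) :
    fourthDeriv u x i j c d = fourthDeriv u x i j d c :=
  pd_pd_comm (contDiffAt_hessM (m := 2) hu i j) c d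

theorem fourthDeriv_comm₁₃ (hu : ContDiffAt ℝ 4 u x) (i j c d : Fin n) :
    fourthDeriv u x i j c d = fourthDeriv u x c j i d := by
  refine Filter.EventuallyEq.pd_eq ?_ d
  filter_upwards [ContDiffAt.eventually_contDiffAt (k := 4) (m := 3) hu (by norm_num)] with y hy
  exact thirdDeriv_comm₁₃ hy i j c

theorem fourthDeriv_comm₁₂ (hu : ContDiffAt ℝ 4 u x) (i j c d : Fin n) :
    fourthDeriv u x i j c d = fourthDeriv u x j i c d := by
  refine Filter.EventuallyEq.pd_eq ?_ d
  filter_upwards [ContDiffAt.eventually_contDiffAt (k := 4) (m := 3) hu (by norm_num)] with y hy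
  exact thirdDeriv_comm₁₂ hy i j c

theorem fourthDeriv_swap (hu : ContDiffAt ℝ 4 u x) (i j c d : Fin n) :
    fourthDeriv u x i j c d = fourthDeriv u x c d i j := by
  rw [fourthDeriv_comm₁₃ hu, fourthDeriv_comm₃₄ hu, fourthDeriv_comm₁₂ hu, fourthDeriv_comm₁₃ hu,
    fourthDeriv_comm₁₂ hu, fourthDeriv_comm₃₄ hu]

theorem abs_pd_le {K : ℝ} (hu : ContDiffAt ℝ 1 u x) (h : ‖iteratedFDeriv ℝ 1 u x‖ ≤ K) (i : Fin n) :
    |pd u x i| ≤ K := by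
  have := (norm_iteratedFDeriv_pd_le (m := 0) (by simpa using hu) i).trans h
  simpa using this

theorem abs_hessM_le {K : ℝ} (hu : ContDiffAt ℝ 2 u x) (h : ‖iteratedFDeriv ℝ 2 u x‖ ≤ K)
    (i j : Fin n) : |hessM u x i j| ≤ K :=
  abs_pd_le (contDiffAt_pd (m := 1) hu j)
    ((norm_iteratedFDeriv_pd_le (m := 1) hu j).trans h) i

theorem abs_thirdDeriv_le {K : ℝ} (hu : ContDiffAt ℝ 3 u x) (h : ‖iteratedFDeriv ℝ 3 u x‖ ≤ K)
    (i j c : Fin n) : |thirdDeriv u x i j c| ≤ K :=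
  abs_pd_le (contDiffAt_hessM (m := 1) hu i j)
    ((norm_iteratedFDeriv_pd_le (m := 1) (contDiffAt_pd (m := 2) hu j) i).trans
      ((norm_iteratedFDeriv_pd_le (m := 2) hu j).trans h)) c

/-- A second order expansion at a point restricts to lines. -/
theorem hasTaylorTwo_of_isLittleO {l : EuclideanSpace ℝ (Fin n) → ℝ} {p : Fin n → ℝ}
    {q : Matrix (Fin n) (Fin n) ℝ}
    (h : (fun y => l y - l x - ∑ a, p a * (y - x) a -
      (1 / 2) * ∑ a, ∑ b, q a b * (y - x) a * (y - x) b) =o[nhds x] fun y => ‖y - x‖ ^ 2)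
    (ξ : EuclideanSpace ℝ (Fin n)) :
    HasTaylorTwo (fun t : ℝ => l (x + t • ξ)) (l x) (∑ a, p a * ξ a)
      ((1 / 2) * ∑ a, ∑ b, q a b * ξ a * ξ b) := by
  have hl : Filter.Tendsto (fun t : ℝ => x + t • ξ) (nhds 0) (nhds x) := by
    have : Continuous fun t : ℝ => x + t • ξ := by fun_prop
    simpa using this.tendsto 0
  have h1 := h.comp_tendsto hl
  have h2 : ((fun y => ‖y - x‖ ^ 2) ∘ fun t : ℝ => x + t • ξ) =O[nhds 0] fun t : ℝ => t ^ 2 := by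
    refine IsBigO.of_bound (‖ξ‖ ^ 2) (Filter.Eventually.of_forall fun t => le_of_eq ?_)
    simp [norm_smul, mul_pow, mul_comm]
  refine (h1.trans_isBigO h2).congr_left fun t => ?_
  simp only [Function.comp_apply, add_sub_cancel_left, PiLp.smul_apply, smul_eq_mul]
  have e1 : ∑ a, p a * (t * ξ a) = t * ∑ a, p a * ξ a := by
    rw [Finset.mul_sum]; exact Finset.sum_congr rfl fun a _ => by ring
  have e2 : ∑ a, ∑ b, q a b * (t * ξ a) * (t * ξ b) = t ^ 2 * ∑ a, ∑ b, q a b * ξ a * ξ b := by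
    rw [Finset.mul_sum]; refine Finset.sum_congr rfl fun a _ => ?_
    rw [Finset.mul_sum]; exact Finset.sum_congr rfl fun a _ => by ring
  rw [e1, e2]; ring

/-- First and second variation, in the direction `ξ`, of a decreasingly weighted sum of the ordered
eigenvalues of the Hessian. -/
theorem hessM_eigenvalue_second_variation {U : Set (EuclideanSpace ℝ (Fin n))} (hU : IsOpen U)
    (hu : ContDiffOn ℝ 4 u U) {lam : EuclideanSpace ℝ (Fin n) → Fin n → ℝ}
    (hlam : ∀ y ∈ U, Monotone (lam y) ∧
      (hessM u y).charpoly = ∏ i, (Polynomial.X - Polynomial.C (lam y i))) (hx : x ∈ U)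
    {Dl : Fin n → Fin n → ℝ} {D2l : Fin n → Matrix (Fin n) (Fin n) ℝ}
    (hD : ∀ i, (fun y => lam y i - lam x i - ∑ a, Dl i a * (y - x) a -
      (1 / 2) * ∑ a, ∑ b, D2l i a b * (y - x) a * (y - x) b) =o[nhds x] fun y => ‖y - x‖ ^ 2)
    {E : Matrix (Fin n) (Fin n) ℝ} (hE : E.transpose * E = 1)
    (hA : E.transpose * hessM u x * E = Matrix.diagonal (lam x))
    {w : Fin n → ℝ} (hw : Antitone w) (ξ : Fin n → ℝ)
    {K : Matrix (Fin n) (Fin n) ℝ} (hK : K.transpose = -K) {B C : Matrix (Fin n) (Fin n) ℝ}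
    (hB : ∀ i j, B i j = ∑ c, ξ c * thirdDeriv u x i j c)
    (hC : ∀ i j, C i j = ∑ c, ∑ d, ξ c * ξ d * fourthDeriv u x i j c d) :
    ∑ i, w i * ∑ a, Dl i a * ξ a = ∑ i, w i * (E.transpose * B * E) i i ∧
      (1 / 2) * ∑ i, w i * ∑ a, ∑ b, D2l i a b * ξ a * ξ b ≤
        (1 / 2) * ∑ i, w i * (E.transpose * C * E) i i +
        ∑ i, ∑ j, (w i - w j) *
          ((E.transpose * B * E) i j * K j i + (1 / 2) * (lam x j - lam x i) * K j i ^ 2) := by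
  have hux : ContDiffAt ℝ 4 u x := hu.contDiffAt (hU.mem_nhds hx)
  set ζ : EuclideanSpace ℝ (Fin n) := WithLp.toLp 2 ξ with hζ
  have hl : Filter.Tendsto (fun t : ℝ => x + t • ζ) (nhds 0) (nhds x) := by
    have : Continuous fun t : ℝ => x + t • ζ := by fun_prop
    simpa using this.tendsto 0
  have hmem : ∀ᶠ t : ℝ in nhds 0, x + t • ζ ∈ U := hl.eventually (hU.mem_nhds hx)
  have key := Matrix.eigenvalue_second_variation (H := fun t => hessM u (x + t • ζ))
    (A := hessM u x) (B := B) (C := (1 / 2 : ℝ) • C) (E := E) (l := fun t => lam (x + t • ζ))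
    (l₀ := lam x) (w := w) (K := K)
    (p := fun i => ∑ a, Dl i a * ζ a) (q := fun i => (1 / 2) * ∑ a, ∑ b, D2l i a b * ζ a * ζ b)
    (fun i j => by
      have := (contDiffAt_hessM (m := 2) hux i j).hasTaylorTwo_line ζ
      rw [Matrix.smul_apply, hB, hC]
      exact this)
    (by
      filter_upwards [hmem] with t ht
      exact hessM_transpose ((hu.contDiffAt (hU.mem_nhds ht)).of_le (by norm_num)))
    (by
      filter_upwards [hmem] with t ht
      exact hlam _ ht)
    hE hA
    (by
      ext i j
      rw [Matrix.transpose_apply, hB, hB]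
      exact Finset.sum_congr rfl fun c _ => by rw [thirdDeriv_comm₁₂ (hux.of_le (by norm_num))])
    (fun i => hasTaylorTwo_of_isLittleO (hD i) ζ) hw hK
  refine ⟨key.1, ?_⟩
  have h2 := key.2
  have e1 : ∑ i, w i * ((1 / 2) * ∑ a, ∑ b, D2l i a b * ζ a * ζ b) =
      (1 / 2) * ∑ i, w i * ∑ a, ∑ b, D2l i a b * ξ a * ξ b := by
    rw [Finset.mul_sum]; exact Finset.sum_congr rfl fun i _ => by simp only [hζ]; ring
  have e2 : ∑ i, w i * (E.transpose * ((1 / 2 : ℝ) • C) * E) i i =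
      (1 / 2) * ∑ i, w i * (E.transpose * C * E) i i := by
    rw [Finset.mul_sum]
    refine Finset.sum_congr rfl fun i _ => ?_
    rw [Matrix.mul_smul, Matrix.smul_mul, Matrix.smul_apply, smul_eq_mul]; ring
  rw [e1, e2] at h2
  exact h2

end HigherDerivatives

section PointwiseVariation

variable {n : ℕ}

theorem sum_mul_nonneg_of_quadratic_nonneg {H M : Matrix (Fin n) (Fin n) ℝ}
    (hMs : M.transpose = M) (hH : ∀ ξ : Fin n → ℝ, 0 ≤ ∑ a, ∑ b, H a b * ξ a * ξ b)
    (hM : ∀ ξ : Fin n → ℝ, 0 ≤ ∑ a, ∑ b, M a b * ξ a * ξ b) :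
    0 ≤ ∑ a, ∑ b, H a b * M a b := by
  have hMh : M.IsHermitian := by simpa [Matrix.IsHermitian] using hMs
  obtain ⟨O, hO, hOM⟩ := Matrix.exists_orthogonal_diagonalization hMs
    (by simpa using hMh.charpoly_eq)
  set m := hMh.eigenvalues
  have hO' : O * O.transpose = 1 := mul_eq_one_comm.mp hO
  have hm : ∀ k, 0 ≤ m k := by
    intro k
    have h1 := congrFun (congrFun hOM k) k
    rw [Matrix.diagonal_apply_eq] at h1
    rw [← h1]
    refine (hM fun a => O a k).trans_eq ?_
    rw [Matrix.mul_apply, Finset.sum_comm]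
    refine Finset.sum_congr rfl fun b _ => ?_
    rw [Matrix.mul_apply, Finset.sum_mul]
    exact Finset.sum_congr rfl fun a _ => by rw [Matrix.transpose_apply]; ring
  have hMe : ∀ a b, M a b = ∑ k, m k * (O a k * O b k) := by
    intro a b
    have h1 : M = O * Matrix.diagonal m * O.transpose := by
      rw [← hOM]
      calc M = (O * O.transpose) * M * (O * O.transpose) := by rw [hO']; simp
        _ = _ := by simp only [Matrix.mul_assoc]
    rw [h1, Matrix.mul_apply]
    simp only [Matrix.mul_diagonal, Matrix.transpose_apply]
    exact Finset.sum_congr rfl fun k _ => by ring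
  have h2 : ∑ a, ∑ b, H a b * M a b = ∑ k, m k * ∑ a, ∑ b, H a b * O a k * O b k := by
    simp only [hMe, Finset.mul_sum]
    rw [Finset.sum_comm' (t' := Finset.univ) (s' := fun _ => Finset.univ) (by simp)]
    calc _ = ∑ b, ∑ k, ∑ a, H a b * (m k * (O a k * O b k)) :=
          Finset.sum_congr rfl fun b _ => Finset.sum_comm
      _ = ∑ k, ∑ b, ∑ a, H a b * (m k * (O a k * O b k)) := Finset.sum_comm
      _ = ∑ k, ∑ a, ∑ b, H a b * (m k * (O a k * O b k)) :=
          Finset.sum_congr rfl fun k _ => Finset.sum_comm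
      _ = _ := Finset.sum_congr rfl fun k _ => Finset.sum_congr rfl fun a _ =>
          Finset.sum_congr rfl fun b _ => by ring
  rw [h2]
  exact Finset.sum_nonneg fun k _ => mul_nonneg (hm k) (hH _)

/-- The gradient of the entry `(α, r)` of the Hessian in the frame `E`. -/
def frameGradient (E : Matrix (Fin n) (Fin n) ℝ) (T : Fin n → Fin n → Fin n → ℝ) (α r c : Fin n) :
    ℝ :=
  ∑ i, ∑ j, E i α * E j r * T i j c

theorem frameGradient_comm {E : Matrix (Fin n) (Fin n) ℝ} {T : Fin n → Fin n → Fin n → ℝ}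
    (hT : ∀ i j c, T i j c = T j i c) (α r c : Fin n) :
    frameGradient E T α r c = frameGradient E T r α c := by
  unfold frameGradient
  rw [Finset.sum_comm]
  exact Finset.sum_congr rfl fun i _ => Finset.sum_congr rfl fun j _ => by rw [hT]; ring

theorem transpose_mul_mul_apply_eq (E : Matrix (Fin n) (Fin n) ℝ) (T : Fin n → Fin n → Fin n → ℝ)
    (ξ : Fin n → ℝ) {B : Matrix (Fin n) (Fin n) ℝ} (hB : ∀ i j, B i j = ∑ c, ξ c * T i j c)
    (α r : Fin n) :
    (E.transpose * B * E) α r = ∑ c, ξ c * frameGradient E T α r c := by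
  simp only [Matrix.mul_apply, Matrix.transpose_apply, hB, frameGradient, Finset.mul_sum,
    Finset.sum_mul]
  calc _ = ∑ j, ∑ c, ∑ i, E i α * (ξ c * T i j c) * E j r :=
        Finset.sum_congr rfl fun j _ => Finset.sum_comm
    _ = ∑ c, ∑ j, ∑ i, E i α * (ξ c * T i j c) * E j r := Finset.sum_comm
    _ = ∑ c, ∑ i, ∑ j, E i α * (ξ c * T i j c) * E j r :=
        Finset.sum_congr rfl fun c _ => Finset.sum_comm
    _ = _ := Finset.sum_congr rfl fun c _ => Finset.sum_congr rfl fun i _ =>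
        Finset.sum_congr rfl fun j _ => by ring

theorem antitone_indicator_le (m : ℕ) : Antitone fun i : Fin n => if (i : ℕ) < m then (1 : ℝ) else 0 := by
  intro i j hij
  have : (i : ℕ) ≤ j := hij
  dsimp only
  split_ifs <;> linarith

section

variable {E : Matrix (Fin n) (Fin n) ℝ} {T : Fin n → Fin n → Fin n → ℝ}
  {Q : Fin n → Fin n → Fin n → Fin n → ℝ} {l : Fin n → ℝ} {Dl : Fin n → Fin n → ℝ}
  {D2l : Fin n → Matrix (Fin n) (Fin n) ℝ}

theorem eigenvalue_deriv_eq_frameGradient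
    (hV : ∀ (w : Fin n → ℝ), Antitone w → ∀ ξ : Fin n → ℝ,
      ∑ i, w i * ∑ a, Dl i a * ξ a = ∑ i, w i * ∑ c, ξ c * frameGradient E T i i c)
    (α c : Fin n) : Dl α c = frameGradient E T α α c := by
  have h : ∀ m : ℕ, ∑ i : Fin n, (if (i : ℕ) < m then (1 : ℝ) else 0) *
      (Dl i c - frameGradient E T i i c) = 0 := by
    intro m
    have := hV _ (antitone_indicator_le m) (Pi.single c 1)
    simp only [Pi.single_apply, mul_ite, mul_one, mul_zero, ite_mul, one_mul, zero_mul,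
      Finset.sum_ite_eq', Finset.mem_univ, if_true] at this
    simp only [mul_sub, Finset.sum_sub_distrib, ite_mul, one_mul, zero_mul]
    linarith
  have h1 := h (α + 1)
  have h2 := h α
  have h3 : ∑ i : Fin n, (if i = α then (1 : ℝ) else 0) * (Dl i c - frameGradient E T i i c) = 0 := by
    have h4 : ∀ i : Fin n, (if i = α then (1 : ℝ) else 0) =
        (if (i : ℕ) < α + 1 then 1 else 0) - (if (i : ℕ) < α then 1 else 0) := by
      intro i
      have : i = α ↔ (i : ℕ) = α := Fin.ext_iff
      split_ifs <;> first | omega | norm_num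
    simp only [h4, sub_mul _ _ (Dl _ c - _), Finset.sum_sub_distrib, h1, h2, sub_zero]
  simp only [ite_mul, one_mul, zero_mul, Finset.sum_ite_eq', Finset.mem_univ, if_true] at h3
  linarith

theorem frameGradient_eq_zero {w : Fin n → ℝ} {a b : (Fin n → ℝ) → ℝ}
    (hV : ∀ (ξ : Fin n → ℝ) (K : Matrix (Fin n) (Fin n) ℝ), K.transpose = -K →
      a ξ ≤ b ξ + ∑ i, ∑ j, (w i - w j) * ((∑ c, ξ c * frameGradient E T i j c) * K j i +
        (1 / 2) * (l j - l i) * K j i ^ 2))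
    (hTs : ∀ i j c, T i j c = T j i c)
    {α r : Fin n} (hw : w α ≠ w r) (hl : l α = l r) (c : Fin n) : frameGradient E T α r c = 0 := by
  have hne : α ≠ r := fun h => hw (by rw [h])
  have hys := frameGradient_comm (E := E) hTs r α c
  set ξ : Fin n → ℝ := Pi.single c 1
  have hy : ∀ i j, ∑ d, ξ d * frameGradient E T i j d = frameGradient E T i j c := by
    intro i j; simp [ξ, Pi.single_apply]
  have key : ∀ τ : ℝ, a ξ ≤ b ξ + τ * (2 * (w α - w r) * frameGradient E T α r c) := by
    intro τ
    have h := hV ξ (Matrix.of fun i j => (if i = r ∧ j = α then τ else 0) -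
      (if i = α ∧ j = r then τ else 0)) (by
        ext i j; simp [and_comm])
    refine h.trans_eq ?_
    congr 1
    have h1 : ∀ i j, (w i - w j) * ((∑ c, ξ c * frameGradient E T i j c) *
        (Matrix.of fun i j => (if i = r ∧ j = α then τ else 0) -
          (if i = α ∧ j = r then τ else 0)) j i + (1 / 2) * (l j - l i) *
        (Matrix.of fun i j => (if i = r ∧ j = α then τ else 0) -
          (if i = α ∧ j = r then τ else 0)) j i ^ 2) =
        (if i = α then (if j = r then (w α - w r) * frameGradient E T α r c * τ else 0) else 0) +
        (if i = r then (if j = α then (w α - w r) * frameGradient E T α r c * τ else 0) else 0) := by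
      intro i j
      rw [hy, Matrix.of_apply]
      by_cases h1 : i = α <;> by_cases h2 : j = r <;> by_cases h3 : i = r <;> by_cases h4 : j = α <;>
        simp_all <;> ring
    simp only [h1, Finset.sum_add_distrib]
    simp
    ring
  by_contra hne0
  have hs : 2 * (w α - w r) * frameGradient E T α r c ≠ 0 :=
    mul_ne_zero (mul_ne_zero two_ne_zero (sub_ne_zero.mpr hw)) hne0
  have := key ((a ξ - b ξ - 1) / (2 * (w α - w r) * frameGradient E T α r c))
  rw [div_mul_cancel₀ _ hs] at this
  linarith

/-- Contracted second variation of a weighted sum of eigenvalues. -/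
theorem contracted_second_variation {H : Matrix (Fin n) (Fin n) ℝ}
    (hH : ∀ ξ : Fin n → ℝ, 0 ≤ ∑ a, ∑ b, H a b * ξ a * ξ b) {w : Fin n → ℝ}
    (hV : ∀ (ξ : Fin n → ℝ) (K : Matrix (Fin n) (Fin n) ℝ), K.transpose = -K →
      (1 / 2) * ∑ i, w i * ∑ a, ∑ b, D2l i a b * ξ a * ξ b ≤
        (1 / 2) * ∑ i, w i * ∑ c, ∑ d, ξ c * ξ d * ∑ a, ∑ b, E a i * E b i * Q a b c d +
        ∑ i, ∑ j, (w i - w j) * ((∑ c, ξ c * frameGradient E T i j c) * K j i +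
        (1 / 2) * (l j - l i) * K j i ^ 2))
    (hTs : ∀ i j c, T i j c = T j i c) (hQs : ∀ a b c d, Q a b c d = Q a b d c)
    (hDs : ∀ i a b, D2l i a b = D2l i b a) :
    ∑ a, ∑ b, H a b * ∑ i, w i * D2l i a b ≤
      ∑ i, w i * ∑ c, ∑ d, H c d * ∑ a, ∑ b, E a i * E b i * Q a b c d -
      ∑ i, ∑ j, (w i - w j) / (l j - l i) *
        ∑ a, ∑ b, H a b * frameGradient E T i j a * frameGradient E T i j b := by
  have hys := frameGradient_comm (E := E) hTs
  set M : Matrix (Fin n) (Fin n) ℝ := Matrix.of fun c d =>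
    ∑ i, w i * (∑ a, ∑ b, E a i * E b i * Q a b c d) -
    ∑ i, ∑ j, (w i - w j) / (l j - l i) * (frameGradient E T i j c * frameGradient E T i j d) -
    ∑ i, w i * D2l i c d with hM
  have hMs : M.transpose = M := by
    ext c d
    simp only [hM, Matrix.transpose_apply, Matrix.of_apply, hDs _ d c, hQs _ _ d c,
      mul_comm (frameGradient E T _ _ d)]
  have hlin : ∀ G : Fin n → Fin n → ℝ, ∑ c, ∑ d, G c d * M c d =
      ∑ i, w i * (∑ c, ∑ d, G c d * ∑ a, ∑ b, E a i * E b i * Q a b c d) -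
      ∑ i, ∑ j, (w i - w j) / (l j - l i) *
        (∑ a, ∑ b, G a b * frameGradient E T i j a * frameGradient E T i j b) -
      ∑ i, w i * ∑ a, ∑ b, G a b * D2l i a b := by
    intro G
    simp only [hM, Matrix.of_apply, mul_sub, Finset.sum_sub_distrib]
    have sw1 : ∀ f : Fin n → Fin n → Fin n → ℝ,
        ∑ c, ∑ d, G c d * ∑ i, w i * f i c d = ∑ i, w i * ∑ c, ∑ d, G c d * f i c d := by
      intro f
      simp only [Finset.mul_sum]
      calc _ = ∑ c, ∑ i, ∑ d, G c d * (w i * f i c d) :=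
            Finset.sum_congr rfl fun c _ => Finset.sum_comm
        _ = ∑ i, ∑ c, ∑ d, G c d * (w i * f i c d) := Finset.sum_comm
        _ = _ := Finset.sum_congr rfl fun i _ => Finset.sum_congr rfl fun c _ =>
            Finset.sum_congr rfl fun d _ => by ring
    have sw2 : ∀ f : Fin n → Fin n → Fin n → Fin n → ℝ,
        ∑ c, ∑ d, G c d * ∑ i, ∑ j, f i j c d = ∑ i, ∑ j, ∑ c, ∑ d, G c d * f i j c d := by
      intro f
      simp only [Finset.mul_sum]
      calc _ = ∑ c, ∑ i, ∑ d, ∑ j, G c d * f i j c d :=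
            Finset.sum_congr rfl fun c _ => Finset.sum_comm
        _ = ∑ i, ∑ c, ∑ d, ∑ j, G c d * f i j c d := Finset.sum_comm
        _ = ∑ i, ∑ c, ∑ j, ∑ d, G c d * f i j c d :=
            Finset.sum_congr rfl fun i _ => Finset.sum_congr rfl fun c _ => Finset.sum_comm
        _ = _ := Finset.sum_congr rfl fun i _ => Finset.sum_comm
    rw [sw1 fun i c d => ∑ a, ∑ b, E a i * E b i * Q a b c d, sw1 fun i c d => D2l i c d,
      sw2 fun i j c d => (w i - w j) / (l j - l i) *
        (frameGradient E T i j c * frameGradient E T i j d)]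
    congr 2
    refine Finset.sum_congr rfl fun i _ => Finset.sum_congr rfl fun j _ => ?_
    simp only [Finset.mul_sum]
    exact Finset.sum_congr rfl fun c _ => Finset.sum_congr rfl fun d _ => by ring
  have hMpos : ∀ ξ : Fin n → ℝ, 0 ≤ ∑ a, ∑ b, M a b * ξ a * ξ b := by
    intro ξ
    have e0 : ∑ a, ∑ b, M a b * ξ a * ξ b = ∑ a, ∑ b, (ξ a * ξ b) * M a b :=
      Finset.sum_congr rfl fun a _ => Finset.sum_congr rfl fun b _ => by ring
    rw [e0, hlin]
    set s : Fin n → Fin n → ℝ := fun i j => ∑ c, ξ c * frameGradient E T i j c with hs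
    have hss : ∀ i j, s i j = s j i := fun i j => by simp only [hs, hys i j]
    have h := hV ξ (Matrix.of fun j i => -(s i j / (l j - l i))) (by
      ext i j
      simp only [Matrix.transpose_apply, Matrix.of_apply, Matrix.neg_apply, hss i j, neg_neg]
      rw [← neg_sub (l j) (l i), div_neg])
    have e1 : ∑ i, ∑ j, (w i - w j) * (s i j * (Matrix.of fun j i => -(s i j / (l j - l i))) j i +
        (1 / 2) * (l j - l i) * (Matrix.of fun j i => -(s i j / (l j - l i))) j i ^ 2) =
        -((1 / 2) * ∑ i, ∑ j, (w i - w j) / (l j - l i) * s i j ^ 2) := by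
      rw [Finset.mul_sum, ← Finset.sum_neg_distrib]
      refine Finset.sum_congr rfl fun i _ => ?_
      rw [Finset.mul_sum, ← Finset.sum_neg_distrib]
      refine Finset.sum_congr rfl fun j _ => ?_
      rw [Matrix.of_apply]
      by_cases h0 : l j - l i = 0
      · simp [h0]
      · field_simp; ring
    have e2 : ∀ i j, ∑ a, ∑ b, ξ a * ξ b * frameGradient E T i j a * frameGradient E T i j b =
        s i j ^ 2 := by
      intro i j
      rw [hs, sq, Finset.sum_mul_sum]
      exact Finset.sum_congr rfl fun a _ => Finset.sum_congr rfl fun b _ => by ring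
    have e3 : ∀ i, ∑ a, ∑ b, ξ a * ξ b * D2l i a b = ∑ a, ∑ b, D2l i a b * ξ a * ξ b :=
      fun i => Finset.sum_congr rfl fun a _ => Finset.sum_congr rfl fun b _ => by ring
    rw [e1] at h
    simp only [e2, e3]
    linarith
  have hfin := sum_mul_nonneg_of_quadratic_nonneg hMs hH hMpos
  rw [hlin fun a b => H a b] at hfin
  have e4 : ∑ a, ∑ b, H a b * ∑ i, w i * D2l i a b = ∑ i, w i * ∑ a, ∑ b, H a b * D2l i a b := by
    simp only [Finset.mul_sum]
    calc _ = ∑ c, ∑ i, ∑ d, H c d * (w i * D2l i c d) :=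
          Finset.sum_congr rfl fun c _ => Finset.sum_comm
      _ = ∑ i, ∑ c, ∑ d, H c d * (w i * D2l i c d) := Finset.sum_comm
      _ = _ := Finset.sum_congr rfl fun i _ => Finset.sum_congr rfl fun c _ =>
          Finset.sum_congr rfl fun d _ => by ring
  rw [e4]
  linarith

end

end PointwiseVariation

section DifferentiatedEquation

variable {n : ℕ}
  {F : (Fin n → Fin n → ℝ) × (Fin n → ℝ) × ℝ × EuclideanSpace ℝ (Fin n) → ℝ}
  {u : EuclideanSpace ℝ (Fin n) → ℝ} {x : EuclideanSpace ℝ (Fin n)}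
  {U : Set (EuclideanSpace ℝ (Fin n))}

/-- The second derivative of the equation `F (D²u, Du, u, x) = 0` in the direction `ξ`. -/
theorem second_derivative_equation (hU : IsOpen U) (hF : ContDiffOn ℝ 2 F {z | z.2.2.2 ∈ U})
    (hu : ContDiffOn ℝ 4 u U)
    (heq : ∀ y ∈ U, F (fun i j => hessM u y i j, fun l => pd u y l, u y, y) = 0) (hx : x ∈ U)
    (ξ : EuclideanSpace ℝ (Fin n))
    {z δ : (Fin n → Fin n → ℝ) × (Fin n → ℝ) × ℝ × EuclideanSpace ℝ (Fin n)}
    (hz : z = (fun i j => hessM u x i j, fun l : Fin n => pd u x l, u x, x))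
    (hδ : δ = (fun i j => ∑ c, ξ c * thirdDeriv u x i j c, fun l => ∑ c, ξ c * hessM u x c l,
      ∑ c : Fin n, ξ c * pd u x c, ξ)) :
    ∑ a, ∑ b, matrixGradient F z a b * ∑ c, ∑ d, ξ c * ξ d * fourthDeriv u x a b c d +
      fderiv ℝ F z (0, fun l => ∑ c, ∑ d, ξ c * ξ d * thirdDeriv u x c l d,
        ∑ c, ∑ d, ξ c * ξ d * hessM u x d c, 0) +
      fderiv ℝ (fderiv ℝ F) z δ δ = 0 := by
  have hux : ContDiffAt ℝ 4 u x := hu.contDiffAt (hU.mem_nhds hx)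
  have hFz : ContDiffAt ℝ 2 F z := by
    refine hF.contDiffAt ((hU.preimage (by fun_prop)).mem_nhds ?_)
    simpa [hz] using hx
  have hl : Filter.Tendsto (fun t : ℝ => x + t • ξ) (nhds 0) (nhds x) := by
    have : Continuous fun t : ℝ => x + t • ξ := by fun_prop
    simpa using this.tendsto 0
  have hmem : ∀ᶠ t : ℝ in nhds 0, x + t • ξ ∈ U := hl.eventually (hU.mem_nhds hx)
  have h1 : HasTaylorTwo (fun t : ℝ => fun i j => hessM u (x + t • ξ) i j)
      (fun i j => hessM u x i j) (fun i j => ∑ c, ξ c * thirdDeriv u x i j c)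
      (fun i j => (1 / 2) * ∑ c, ∑ d, ξ c * ξ d * fourthDeriv u x i j c d) :=
    HasTaylorTwo.pi fun i => HasTaylorTwo.pi fun j =>
      (contDiffAt_hessM (m := 2) hux i j).hasTaylorTwo_line ξ
  have h2 : HasTaylorTwo (fun t : ℝ => fun l : Fin n => pd u (x + t • ξ) l)
      (fun l => pd u x l) (fun l => ∑ c, ξ c * hessM u x c l)
      (fun l => (1 / 2) * ∑ c, ∑ d, ξ c * ξ d * thirdDeriv u x c l d) :=
    HasTaylorTwo.pi fun l =>
      (contDiffAt_pd (m := 2) (hux.of_le (by norm_num)) l).hasTaylorTwo_line ξ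
  have h3 : HasTaylorTwo (fun t : ℝ => u (x + t • ξ)) (u x) (∑ c : Fin n, ξ c * pd u x c)
      ((1 / 2) * ∑ c, ∑ d, ξ c * ξ d * hessM u x d c) :=
    (hux.of_le (by norm_num)).hasTaylorTwo_line ξ
  have hc := h1.prodMk (h2.prodMk (h3.prodMk (HasTaylorTwo.line x ξ)))
  rw [← hz, ← hδ] at hc
  have hFc := hc.comp_contDiffAt hFz
  have hF0 : F z = 0 := hz ▸ heq x hx
  have hconst := (HasTaylorTwo.const (0 : ℝ)).congr' (by
    filter_upwards [hmem] with t ht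
    exact (heq _ ht).symm)
  rw [hF0] at hFc
  have hle := (hFc.le hconst (Filter.Eventually.of_forall fun t => le_rfl)).2
  have hge := (hconst.le hFc (Filter.Eventually.of_forall fun t => le_rfl)).2
  have h0 := le_antisymm hle hge
  have hsplit : ((fun i j => (1 / 2) * ∑ c, ∑ d, ξ c * ξ d * fourthDeriv u x i j c d,
      fun l => (1 / 2) * ∑ c, ∑ d, ξ c * ξ d * thirdDeriv u x c l d,
      (1 / 2) * ∑ c, ∑ d, ξ c * ξ d * hessM u x d c, 0) :
      (Fin n → Fin n → ℝ) × (Fin n → ℝ) × ℝ × EuclideanSpace ℝ (Fin n)) =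
      (1 / 2 : ℝ) • ((fun i j => ∑ c, ∑ d, ξ c * ξ d * fourthDeriv u x i j c d, 0, 0, 0) +
      (0, fun l => ∑ c, ∑ d, ξ c * ξ d * thirdDeriv u x c l d,
        ∑ c, ∑ d, ξ c * ξ d * hessM u x d c, 0)) := by
    refine Prod.ext ?_ (Prod.ext ?_ (Prod.ext ?_ ?_))
    · ext i j; simp
    · ext l; simp
    · simp
    · simp
  rw [hsplit, map_smul, map_add, fderiv_apply_matrix, smul_eq_mul] at h0
  linarith

theorem matrixGradient_eq_Fmat (hU : IsOpen U) (hF : ContDiffOn ℝ 2 F {z | z.2.2.2 ∈ U})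
    (hx : x ∈ U) (i j : Fin n) :
    matrixGradient F (fun i j => hessM u x i j, fun l => pd u x l, u x, x) i j = Fmat F u x i j := by
  have hFz : DifferentiableAt ℝ F (fun i j => hessM u x i j, fun l => pd u x l, u x, x) := by
    refine (hF.contDiffAt ((hU.preimage (by fun_prop)).mem_nhds ?_)).differentiableAt (by norm_num)
    simpa using hx
  have h := hFz.hasFDerivAt.comp (fun a b => hessM u x a b)
    ((hasFDerivAt_id (𝕜 := ℝ) (fun a b => hessM u x a b)).prodMk
      (hasFDerivAt_const (𝕜 := ℝ) ((fun l => pd u x l, u x, x) :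
        (Fin n → ℝ) × ℝ × EuclideanSpace ℝ (Fin n)) (fun a b => hessM u x a b)))
  have h' := h.fderiv
  simp only [Function.comp_def, id] at h'
  rw [Fmat, h']
  rfl

theorem abs_bilin_add_sub_le {V : Type*} [NormedAddCommGroup V] [NormedSpace ℝ V]
    (B : V →L[ℝ] V →L[ℝ] ℝ) {K N r : ℝ} (hB : ‖B‖ ≤ K) {a ρ : V} (ha : ‖a‖ ≤ N) (hρ : ‖ρ‖ ≤ r) :
    |B (a + ρ) (a + ρ) - B a a| ≤ K * r * (2 * N + r) := by
  have hK := (norm_nonneg B).trans hB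
  have hN := (norm_nonneg a).trans ha
  have hr := (norm_nonneg ρ).trans hρ
  have h : ∀ (p q : V) (s t : ℝ), ‖p‖ ≤ s → ‖q‖ ≤ t → |B p q| ≤ K * s * t := by
    intro p q s t hs ht
    refine (B.le_opNorm₂ p q).trans ?_
    have := (norm_nonneg p).trans hs
    gcongr
  have e : B (a + ρ) (a + ρ) - B a a = B a ρ + B ρ a + B ρ ρ := by
    simp only [map_add, add_apply]; ring
  rw [e]
  refine (abs_add_le _ _).trans ?_
  refine (add_le_add ((abs_add_le _ _).trans (add_le_add (h _ _ _ _ ha hρ) (h _ _ _ _ hρ ha)))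
    (h _ _ _ _ hρ hρ)).trans_eq ?_
  ring

end DifferentiatedEquation

section FourthOrder

variable {n : ℕ}
  {F : (Fin n → Fin n → ℝ) × (Fin n → ℝ) × ℝ × EuclideanSpace ℝ (Fin n) → ℝ}
  {u : EuclideanSpace ℝ (Fin n) → ℝ} {x : EuclideanSpace ℝ (Fin n)}
  {U : Set (EuclideanSpace ℝ (Fin n))}

theorem sum_sq_column_eq_one {E : Matrix (Fin n) (Fin n) ℝ} (hE : E.transpose * E = 1)
    (α : Fin n) : ∑ c, E c α ^ 2 = 1 := by
  have := congrFun (congrFun hE α) α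
  rw [Matrix.mul_apply, Matrix.one_apply_eq] at this
  rw [← this]
  exact Finset.sum_congr rfl fun c _ => by rw [Matrix.transpose_apply, sq]

theorem abs_orthogonal_le_one {E : Matrix (Fin n) (Fin n) ℝ} (hE : E.transpose * E = 1)
    (c α : Fin n) : |E c α| ≤ 1 := by
  rw [← sq_le_one_iff_abs_le_one, ← sum_sq_column_eq_one hE α]
  exact Finset.single_le_sum (f := fun c => E c α ^ 2) (fun i _ => sq_nonneg _)
    (Finset.mem_univ c)

theorem abs_sum_orthogonal_mul_le {E : Matrix (Fin n) (Fin n) ℝ} (hE : E.transpose * E = 1)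
    (α : Fin n) {f : Fin n → ℝ} {K : ℝ} (hf : ∀ c, |f c| ≤ K) :
    |∑ c, E c α * f c| ≤ n * K := by
  refine (Finset.abs_sum_le_sum_abs _ _).trans ?_
  refine (Finset.sum_le_card_nsmul _ _ K fun c _ => ?_).trans_eq (by simp)
  rw [abs_mul]
  exact (mul_le_of_le_one_left (abs_nonneg _) (abs_orthogonal_le_one hE c α)).trans (hf c)

/-- The contraction of `F^{cd}` with the fourth derivatives `u_{ααcd}` in a Hessian eigenframe is
controlled by third derivatives and by the eigenvalue `l α`. -/
theorem contracted_fourthDeriv_le {L K : ℝ} (hL : 0 < L) (hK : 0 ≤ K) (hU : IsOpen U)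
    (hF : ContDiffOn ℝ 2 F {z | z.2.2.2 ∈ U})
    (hF1 : ∀ z : (Fin n → Fin n → ℝ) × (Fin n → ℝ) × ℝ × EuclideanSpace ℝ (Fin n), z.2.2.2 ∈ U →
      ‖fderiv ℝ F z‖ ≤ K)
    (hF2 : ∀ z : (Fin n → Fin n → ℝ) × (Fin n → ℝ) × ℝ × EuclideanSpace ℝ (Fin n), z.2.2.2 ∈ U →
      ‖fderiv ℝ (fderiv ℝ F) z‖ ≤ K)
    (hu : ContDiffOn ℝ 4 u U) (huK : ∀ i ≤ 3, ‖iteratedFDeriv ℝ i u x‖ ≤ K)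
    (heq : ∀ y ∈ U, F (fun i j => hessM u y i j, fun l => pd u y l, u y, y) = 0) (hx : x ∈ U)
    (hell : ∀ ξ : Fin n → ℝ,
      L⁻¹ * ∑ i, ξ i ^ 2 ≤ ∑ i, ∑ j, Fmat F u x i j * ξ i * ξ j ∧
      ∑ i, ∑ j, Fmat F u x i j * ξ i * ξ j ≤ L * ∑ i, ξ i ^ 2)
    (hconv : ∀ p : Fin n → ℝ, ∀ z ∈ {w : (Fin n → Fin n → ℝ) × ℝ × EuclideanSpace ℝ (Fin n) |
        (Matrix.of w.1).PosDef ∧ w.2.2 ∈ U},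
      ∃ t : Set ((Fin n → Fin n → ℝ) × ℝ × EuclideanSpace ℝ (Fin n)), IsOpen t ∧ z ∈ t ∧
        ConvexOn ℝ ({w | (Matrix.of w.1).PosDef ∧ w.2.2 ∈ U} ∩ t)
          (fun w => F (fun i j => (Matrix.of w.1)⁻¹ i j, p, w.2.1, w.2.2)))
    {E : Matrix (Fin n) (Fin n) ℝ} {l : Fin n → ℝ} (hE : E.transpose * E = 1) (hl : ∀ i, 0 ≤ l i)
    (hA : E.transpose * hessM u x * E = Matrix.diagonal l) (α : Fin n) (R : Finset (Fin n))
    (hR : ∀ c ∈ R, 0 < l c) :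
    ∑ c, ∑ d, Fmat F u x c d * ∑ a, ∑ b, E a α * E b α * fourthDeriv u x a b c d ≤
      2 * ∑ c ∈ R, (l c)⁻¹ * ∑ a, ∑ b, Fmat F u x a b *
        frameGradient E (thirdDeriv u x) α c a * frameGradient E (thirdDeriv u x) α c b +
      K * (2 * n ^ 2 * (2 * L) ^ 2 * n) *
        (2 * (n * K + 1) + 2 * n ^ 2 * (2 * L) ^ 2 * n * (n ^ 3 * (n * K + 1))) *
        ∑ c ∈ Rᶜ, ∑ a, |frameGradient E (thirdDeriv u x) α c a| +
      K * ∑ a, |frameGradient E (thirdDeriv u x) α α a| +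
      K * (1 + (2 * (n * K + 1) + n * (n * K))) * l α := by
  have hux : ContDiffAt ℝ 4 u x := hu.contDiffAt (hU.mem_nhds hx)
  have hu3 : ContDiffAt ℝ 3 u x := hux.of_le (by norm_num)
  have hu2 : ContDiffAt ℝ 2 u x := hux.of_le (by norm_num)
  have hu1 : ContDiffAt ℝ 1 u x := hux.of_le (by norm_num)
  have hE' : E * E.transpose = 1 := mul_eq_one_comm.mp hE
  have hnK : 0 ≤ n * K := by positivity
  set ξ : EuclideanSpace ℝ (Fin n) := WithLp.toLp 2 fun c => E c α with hξ
  have hξc : ∀ c, ξ c = E c α := fun c => rfl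
  have hξn : ‖ξ‖ = 1 := by
    rw [EuclideanSpace.norm_eq]
    simp [hξc, sum_sq_column_eq_one hE α]
  set S : Matrix (Fin n) (Fin n) ℝ := Matrix.of fun i j => ∑ c, E c α * thirdDeriv u x i j c with hS
  have hST : S.transpose = S := by
    ext i j
    simp only [hS, Matrix.transpose_apply, Matrix.of_apply, thirdDeriv_comm₁₂ hu3 j i]
  set τ : ℝ := ∑ c : Fin n, E c α * pd u x c with hτ
  have hAE : hessM u x = E * Matrix.diagonal l * E.transpose := by
    rw [← hA]
    calc hessM u x = (E * E.transpose) * hessM u x * (E * E.transpose) := by rw [hE']; simp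
      _ = _ := by simp only [Matrix.mul_assoc]
  have hcol : ∀ c, ∑ d, E d α * hessM u x d c = l α * E c α := by
    intro c
    have h1 : hessM u x * E = E * Matrix.diagonal l := by
      rw [hAE, Matrix.mul_assoc, hE, Matrix.mul_one]
    have h2 := congrFun (congrFun h1 c) α
    rw [Matrix.mul_apply, Matrix.mul_diagonal] at h2
    rw [mul_comm (l α), ← h2]
    exact Finset.sum_congr rfl fun d _ => by rw [hessM_comm hu2 d c, mul_comm]
  have hll : ∑ c, ∑ d, E c α * E d α * hessM u x d c = l α := by
    calc _ = ∑ c, E c α * (l α * E c α) := Finset.sum_congr rfl fun c _ => by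
          rw [← hcol, Finset.mul_sum]; exact Finset.sum_congr rfl fun d _ => by ring
      _ = l α * ∑ c, E c α ^ 2 := by
          rw [Finset.mul_sum]; exact Finset.sum_congr rfl fun c _ => by ring
      _ = l α := by rw [sum_sq_column_eq_one hE, mul_one]
  have hlK : l α ≤ n * (n * K) := by
    rw [← hll]
    refine (le_abs_self _).trans ?_
    simp only [mul_assoc, ← Finset.mul_sum]
    exact abs_sum_orthogonal_mul_le hE α fun c => abs_sum_orthogonal_mul_le hE α fun d =>
      abs_hessM_le hu2 (huK 2 (by norm_num)) d c
  have hy : ∀ l', ∑ c, ∑ d, E c α * E d α * thirdDeriv u x c l' d =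
      frameGradient E (thirdDeriv u x) α α l' := fun l' =>
    Finset.sum_congr rfl fun c _ => Finset.sum_congr rfl fun d _ => by
      rw [thirdDeriv_comm₂₃ hu3]
  have hSE : ∀ a c, (S * E) a c = frameGradient E (thirdDeriv u x) α c a := by
    intro a c
    rw [Matrix.mul_apply, frameGradient, Finset.sum_comm]
    refine Finset.sum_congr rfl fun j _ => ?_
    rw [hS, Matrix.of_apply, Finset.sum_mul]
    exact Finset.sum_congr rfl fun i _ => by rw [thirdDeriv_comm₁₃ hu3]; ring
  set z : (Fin n → Fin n → ℝ) × (Fin n → ℝ) × ℝ × EuclideanSpace ℝ (Fin n) :=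
    (fun i j => hessM u x i j, fun l => pd u x l, u x, x) with hz
  have hzU : z.2.2.2 ∈ U := hx
  set δ₀ : (Fin n → Fin n → ℝ) × (Fin n → ℝ) × ℝ × EuclideanSpace ℝ (Fin n) :=
    (fun i j => S i j, 0, τ, ξ) with hδ₀
  set ρ : (Fin n → Fin n → ℝ) × (Fin n → ℝ) × ℝ × EuclideanSpace ℝ (Fin n) :=
    (0, fun c => l α * E c α, 0, 0) with hρ
  have hδ₀n : ‖δ₀‖ ≤ n * K + 1 := by
    rw [hδ₀]
    refine norm_prod_le_iff.mpr ⟨?_, norm_prod_le_iff.mpr ⟨?_, norm_prod_le_iff.mpr ⟨?_, ?_⟩⟩⟩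
    · refine (pi_norm_le_iff_of_nonneg (by positivity)).mpr fun i =>
        (pi_norm_le_iff_of_nonneg (by positivity)).mpr fun j => ?_
      have := abs_sum_orthogonal_mul_le hE α fun c =>
        abs_thirdDeriv_le hu3 (huK 3 le_rfl) i j c
      exact this.trans (by linarith)
    · simp only [norm_zero]; positivity
    · have := abs_sum_orthogonal_mul_le hE α fun c => abs_pd_le hu1 (huK 1 (by norm_num)) c
      exact this.trans (by linarith)
    · simp only [hξn]; linarith
  have hρn : ‖ρ‖ ≤ l α := by
    rw [hρ]
    refine norm_prod_le_iff.mpr ⟨?_, norm_prod_le_iff.mpr ⟨?_, norm_prod_le_iff.mpr ⟨?_, ?_⟩⟩⟩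
    · simpa using hl α
    · refine (pi_norm_le_iff_of_nonneg (hl α)).mpr fun c => ?_
      rw [Real.norm_eq_abs, abs_mul, abs_of_nonneg (hl α)]
      exact mul_le_of_le_one_right (hl α) (abs_orthogonal_le_one hE c α)
    · simpa using hl α
    · simpa using hl α
  have heq2 := second_derivative_equation hU hF hu heq hx ξ (z := z) (δ := δ₀ + ρ) hz (by
    refine Prod.ext ?_ (Prod.ext ?_ (Prod.ext ?_ ?_))
    · ext i j; simp [hδ₀, hρ, hS, hξc]
    · ext c; simp [hδ₀, hρ, hcol, hξc]
    · simp [hδ₀, hρ, hτ, hξc]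
    · simp [hδ₀, hρ])
  simp only [hξc, hy, hll] at heq2
  have hmain := neg_second_derivative_le hL hK (N := n * K + 1) (by linarith) hU hF hF2 hE hl hAE
    hx (p := fun l => pd u x l) (r := u x)
    (by simpa only [matrixGradient_eq_Fmat hU hF hx] using hell) (hconv _) hST τ ξ hδ₀n R hR
  simp only [hSE, matrixGradient_eq_Fmat hU hF hx] at hmain
  have hpert := (abs_le.mp (abs_bilin_add_sub_le _ (hF2 z hzU) hδ₀n hρn)).1
  have hlow : -(fderiv ℝ F z (0, fun a => frameGradient E (thirdDeriv u x) α α a, l α, 0)) ≤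
      K * (∑ a, |frameGradient E (thirdDeriv u x) α α a| + l α) := by
    refine (neg_le_abs _).trans (((fderiv ℝ F z).le_opNorm _).trans ?_)
    have h0 : 0 ≤ ∑ a, |frameGradient E (thirdDeriv u x) α α a| :=
      Finset.sum_nonneg fun a _ => abs_nonneg _
    have h1 := hl α
    refine mul_le_mul (hF1 z hzU) ?_ (norm_nonneg _) hK
    refine norm_prod_le_iff.mpr ⟨?_, norm_prod_le_iff.mpr ⟨?_, norm_prod_le_iff.mpr ⟨?_, ?_⟩⟩⟩
    · simp only [norm_zero]; linarith
    · refine (pi_norm_le_iff_of_nonneg (by linarith)).mpr fun c => ?_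
      have := Finset.single_le_sum (f := fun a => |frameGradient E (thirdDeriv u x) α α a|)
        (fun a _ => abs_nonneg _) (Finset.mem_univ c)
      exact this.trans (by linarith)
    · simp only [Real.norm_eq_abs, abs_of_nonneg h1]; linarith
    · simp only [norm_zero]; linarith
  have hquad : K * l α * (2 * (n * K + 1) + l α) ≤
      K * l α * (2 * (n * K + 1) + n * (n * K)) := by
    have := hl α
    gcongr
  have e : ∑ c, ∑ d, Fmat F u x c d * ∑ a, ∑ b, E a α * E b α * fourthDeriv u x a b c d =
      ∑ a, ∑ b, matrixGradient F z a b * ∑ c, ∑ d, E c α * E d α * fourthDeriv u x a b c d := by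
    refine Finset.sum_congr rfl fun c _ => Finset.sum_congr rfl fun d _ => ?_
    rw [hz, matrixGradient_eq_Fmat hU hF hx]
    congr 1
    exact Finset.sum_congr rfl fun a _ => Finset.sum_congr rfl fun b _ => by
      rw [fourthDeriv_swap hux]
  rw [e]
  linarith

end FourthOrder

section WeightedSums

variable {n : ℕ}

theorem mul_le_sq_div_add {s q C : ℝ} (hq : 0 < q) : C * s ≤ s ^ 2 / q + C ^ 2 * q := by
  have h : 0 ≤ (s ^ 2 - C * s * q + (C * q) ^ 2) / q := by
    refine div_nonneg ?_ hq.le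
    nlinarith [sq_nonneg (s - C * q), sq_nonneg s, sq_nonneg (C * q)]
  have e : (s ^ 2 - C * s * q + (C * q) ^ 2) / q = s ^ 2 / q - C * s + C ^ 2 * q := by
    field_simp
  linarith

/-- The good terms produced by the concavity of the weighted eigenvalue sum absorb the third order
terms of the linearized equation. -/
theorem weighted_sum_sub_le {k : ℕ} (hk : 1 ≤ k) (hkn : k ≤ n) {l : Fin n → ℝ} (hl : Monotone l)
    (hl0 : ∀ i, 0 ≤ l i) {φ s : Fin n → Fin n → ℝ} {f : Fin n → ℝ} {M C : ℝ} (hM : 0 < M)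
    (hC : 0 ≤ C) (hφ : ∀ i j, φ i j = φ j i) (hs : ∀ i j, 0 ≤ s i j)
    (hsφ : ∀ i j, s i j ^ 2 ≤ M * φ i j)
    (hs0 : ∀ i j : Fin n, ((k - (i : ℕ) : ℕ) : ℝ) ≠ ((k - (j : ℕ) : ℕ) : ℝ) → l i = l j → s i j = 0)
    (hf : ∀ (i : Fin n) (R : Finset (Fin n)), (∀ c ∈ R, 0 < l c) →
      f i ≤ 2 * ∑ c ∈ R, (l c)⁻¹ * φ i c + C * ∑ c ∈ Rᶜ, s i c + C * s i i + C * l i) :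
    ∑ i : Fin n, ((k - (i : ℕ) : ℕ) : ℝ) * f i -
        ∑ i : Fin n, ∑ j : Fin n,
          (((k - (i : ℕ) : ℕ) : ℝ) - ((k - (j : ℕ) : ℕ) : ℝ)) / (l j - l i) * φ i j ≤
      2 * n * C * ∑ i ∈ Finset.univ.filter (fun i : Fin n => (i : ℕ) < k), s i i +
      (C + n ^ 4 * C ^ 2 * M) * ∑ i ∈ Finset.univ.filter (fun i : Fin n => (i : ℕ) < k),
        ((k - (i : ℕ) : ℕ) : ℝ) * l i := by
  set w : Fin n → ℝ := fun i => ((k - (i : ℕ) : ℕ) : ℝ) with hw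
  set I : Finset (Fin n) := Finset.univ.filter (fun i : Fin n => (i : ℕ) < k) with hI
  set κ : Fin n := ⟨k - 1, by omega⟩ with hκ
  set R : Finset (Fin n) := Finset.univ.filter fun c => l κ < l c with hR
  set g : Fin n → Fin n → ℝ := fun i j => (w i - w j) / (l j - l i) * φ i j with hg
  have hw0 : ∀ i, 0 ≤ w i := fun i => Nat.cast_nonneg _
  have hwn : ∀ i, w i ≤ n := fun i => by
    simp only [hw]; exact_mod_cast (Nat.sub_le _ _).trans hkn
  have hwanti : Antitone w := by
    intro i j hij
    have : (i : ℕ) ≤ j := hij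
    simp only [hw, Nat.cast_le]; omega
  have hwz : ∀ i, i ∉ I → w i = 0 := by
    intro i hi
    simp only [hI, Finset.mem_filter, Finset.mem_univ, true_and, not_lt] at hi
    simp [hw, hi]
  have hφ0 : ∀ i j, 0 ≤ φ i j := fun i j =>
    nonneg_of_mul_nonneg_right ((sq_nonneg _).trans (hsφ i j)) hM
  have hg0 : ∀ i j, 0 ≤ g i j := by
    intro i j
    refine mul_nonneg ?_ (hφ0 i j)
    rcases le_total i j with h | h
    · exact div_nonneg (sub_nonneg.mpr (hwanti h)) (sub_nonneg.mpr (hl h))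
    · exact div_nonneg_of_nonpos (sub_nonpos.mpr (hwanti h)) (sub_nonpos.mpr (hl h))
  have hgs : ∀ i j, g i j = g j i := by
    intro i j
    simp only [hg]
    rw [hφ i j, ← neg_sub (w j) (w i), ← neg_sub (l i) (l j), neg_div_neg_eq]
  have hIκ : ∀ i ∈ I, l i ≤ l κ := by
    intro i hi
    simp only [hI, Finset.mem_filter, Finset.mem_univ, true_and] at hi
    exact hl (Fin.le_def.mpr (by simp only [hκ]; omega))
  have hIR : Disjoint I R := by
    refine Finset.disjoint_left.mpr fun i hi hiR => ?_
    simp only [hR, Finset.mem_filter, Finset.mem_univ, true_and] at hiR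
    exact absurd (hIκ i hi) (not_le.mpr hiR)
  have hRpos : ∀ c ∈ R, 0 < l c := by
    intro c hc
    simp only [hR, Finset.mem_filter, Finset.mem_univ, true_and] at hc
    exact (hl0 κ).trans_lt hc
  have hsum : ∑ i ∈ I, (2 * ∑ c ∈ R, g i c + ∑ c ∈ Rᶜ, g i c) ≤ ∑ i, ∑ j, g i j := by
    have h1 : ∑ i ∈ I ∪ R, ∑ j, g i j ≤ ∑ i, ∑ j, g i j :=
      Finset.sum_le_sum_of_subset_of_nonneg (Finset.subset_univ _)
        fun i _ _ => Finset.sum_nonneg fun j _ => hg0 i j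
    rw [Finset.sum_union hIR] at h1
    have h2 : ∑ i ∈ I, ∑ c ∈ R, g i c ≤ ∑ c ∈ R, ∑ j, g c j := by
      rw [Finset.sum_comm]
      refine Finset.sum_le_sum fun c _ => ?_
      simp only [fun i => hgs i c]
      exact Finset.sum_le_sum_of_subset_of_nonneg (Finset.subset_univ _) fun j _ _ => hg0 c j
    have h3 : ∑ i ∈ I, (2 * ∑ c ∈ R, g i c + ∑ c ∈ Rᶜ, g i c) =
        ∑ i ∈ I, ∑ j, g i j + ∑ i ∈ I, ∑ c ∈ R, g i c := by
      rw [← Finset.sum_add_distrib]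
      refine Finset.sum_congr rfl fun i _ => ?_
      rw [← Finset.sum_add_sum_compl R fun j => g i j]; ring
    linarith
  have hgood : ∀ i ∈ I, ∀ c ∈ R, w i * ((l c)⁻¹ * φ i c) ≤ g i c := by
    intro i hi c hc
    have hci := hwz c (Finset.disjoint_right.mp hIR hc)
    have h1 : l κ < l c := by simpa [hR] using hc
    have h2 := hIκ i hi
    simp only [hg, hci, sub_zero, div_eq_mul_inv, mul_assoc]
    refine mul_le_mul_of_nonneg_left (mul_le_mul_of_nonneg_right ?_ (hφ0 i c)) (hw0 i)
    exact inv_anti₀ (by linarith) (by linarith [hl0 i])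
  have hbad : ∀ i ∈ I, ∀ c ∈ Rᶜ, c ≠ i →
      w i * (C * s i c) - g i c ≤ n ^ 2 * C ^ 2 * M * l κ := by
    intro i hi c hc hci
    have hcκ : l c ≤ l κ := by simpa [hR] using hc
    have hiκ := hIκ i hi
    have hwne : w i ≠ w c := by
      have hi' : (i : ℕ) < k := by simpa [hI] using hi
      simp only [hw, ne_eq, Nat.cast_inj]
      have : (c : ℕ) ≠ i := fun h => hci (Fin.ext h)
      omega
    have hnn : 0 ≤ n ^ 2 * C ^ 2 * M * l κ := by have := hl0 κ; positivity
    by_cases hli : l i = l c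
    · have := hg0 i c
      rw [hs0 i c hwne hli]; linarith
    have hD : 0 < |l c - l i| := abs_pos.mpr (sub_ne_zero.mpr (Ne.symm hli))
    have hDκ : |l c - l i| ≤ l κ := by
      rw [abs_le]; constructor <;> linarith [hl0 i, hl0 c]
    have hw1 : 1 ≤ |w i - w c| := by
      have : ((k - (i : ℕ) : ℕ) : ℤ) - ((k - (c : ℕ) : ℕ) : ℤ) ≠ 0 := by
        intro h
        apply hwne
        simp only [hw]
        exact_mod_cast sub_eq_zero.mp h
      have := Int.one_le_abs this
      simp only [hw]
      exact_mod_cast this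
    have hglow : s i c ^ 2 / (M * |l c - l i|) ≤ g i c := by
      have e : g i c = |w i - w c| / |l c - l i| * φ i c := by
        rw [← abs_div]
        conv_lhs => rw [← abs_of_nonneg (hg0 i c)]
        simp only [hg]
        rw [abs_mul, abs_of_nonneg (hφ0 i c)]
      rw [e]
      calc s i c ^ 2 / (M * |l c - l i|) ≤ M * φ i c / (M * |l c - l i|) := by
            gcongr; exact hsφ i c
        _ = 1 / |l c - l i| * φ i c := by field_simp
        _ ≤ _ := by
          have := hφ0 i c
          gcongr
    have h1 := mul_le_sq_div_add (s := s i c) (C := n * C) (mul_pos hM hD)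
    have h2 : (n * C) ^ 2 * (M * |l c - l i|) ≤ n ^ 2 * C ^ 2 * M * l κ := by
      rw [mul_pow, ← mul_assoc]; gcongr
    have h3 : w i * (C * s i c) ≤ n * C * s i c := by
      rw [mul_assoc]
      exact mul_le_mul_of_nonneg_right (hwn i) (mul_nonneg hC (hs i c))
    linarith
  have hrow : ∀ i ∈ I, w i * f i - (2 * ∑ c ∈ R, g i c + ∑ c ∈ Rᶜ, g i c) ≤
      2 * n * C * s i i + C * (w i * l i) + n ^ 3 * C ^ 2 * M * l κ := by
    intro i hi
    have h1 := mul_le_mul_of_nonneg_left (hf i R hRpos) (hw0 i)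
    have h2 : w i * ∑ c ∈ R, (l c)⁻¹ * φ i c ≤ ∑ c ∈ R, g i c := by
      rw [Finset.mul_sum]
      exact Finset.sum_le_sum (hgood i hi)
    have h3 : w i * (C * ∑ c ∈ Rᶜ, s i c) - ∑ c ∈ Rᶜ, g i c ≤
        n * (n ^ 2 * C ^ 2 * M * l κ) + n * C * s i i := by
      have hX : 0 ≤ n ^ 2 * C ^ 2 * M * l κ := by have := hl0 κ; positivity
      rw [Finset.mul_sum, Finset.mul_sum, ← Finset.sum_sub_distrib]
      have hb : ∀ c ∈ Rᶜ, w i * (C * s i c) - g i c ≤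
          n ^ 2 * C ^ 2 * M * l κ + if c = i then n * C * s i i else 0 := by
        intro c hc
        split_ifs with h
        · subst h
          have h4 := hg0 c c
          have h5 := mul_le_mul_of_nonneg_right (hwn c) (mul_nonneg hC (hs c c))
          linarith
        · simpa using hbad i hi c hc h
      refine (Finset.sum_le_sum hb).trans ?_
      refine (Finset.sum_le_sum_of_subset_of_nonneg (Finset.subset_univ _) fun c _ _ => ?_).trans_eq
        (by simp [Finset.sum_add_distrib])
      have := hs i i
      split_ifs <;> positivity
    have h4 : w i * (C * s i i) ≤ n * C * s i i := by
      rw [mul_assoc]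
      exact mul_le_mul_of_nonneg_right (hwn i) (mul_nonneg hC (hs i i))
    linarith
  have htot : ∑ i, w i * f i = ∑ i ∈ I, w i * f i :=
    (Finset.sum_subset (Finset.subset_univ I) fun i _ hi => by rw [hwz i hi, zero_mul]).symm
  have hκQ : l κ ≤ ∑ i ∈ I, w i * l i := by
    have hκI : κ ∈ I := by simp only [hI, hκ, Finset.mem_filter, Finset.mem_univ, true_and]; omega
    have hwκ : w κ = 1 := by
      change ((k - (k - 1) : ℕ) : ℝ) = 1
      rw [show k - (k - 1) = 1 by omega, Nat.cast_one]
    have := Finset.single_le_sum (f := fun i => w i * l i)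
      (fun i _ => mul_nonneg (hw0 i) (hl0 i)) hκI
    simpa [hwκ] using this
  have hcard : (I.card : ℝ) ≤ n := by
    exact_mod_cast (Finset.card_le_univ I).trans_eq (Fintype.card_fin n)
  have hfin := Finset.sum_le_sum hrow
  simp only [Finset.sum_sub_distrib, Finset.sum_add_distrib (s := I), Finset.sum_const,
    ← Finset.mul_sum, nsmul_eq_mul] at hfin hsum
  have hX : 0 ≤ n ^ 3 * C ^ 2 * M := by positivity
  have hlast : I.card * (n ^ 3 * C ^ 2 * M * l κ) ≤ n ^ 4 * C ^ 2 * M * ∑ i ∈ I, w i * l i := by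
    calc I.card * (n ^ 3 * C ^ 2 * M * l κ) ≤ n * (n ^ 3 * C ^ 2 * M * ∑ i ∈ I, w i * l i) := by
          have := hl0 κ
          gcongr
      _ = _ := by ring
  rw [htot]
  linarith

end WeightedSums

section KeyInequality

variable {n : ℕ}
  {F : (Fin n → Fin n → ℝ) × (Fin n → ℝ) × ℝ × EuclideanSpace ℝ (Fin n) → ℝ}
  {u : EuclideanSpace ℝ (Fin n) → ℝ} {x : EuclideanSpace ℝ (Fin n)}
  {U : Set (EuclideanSpace ℝ (Fin n))}

theorem transpose_mul_mul_apply_eq_sum (E : Matrix (Fin n) (Fin n) ℝ)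
    (Q : Fin n → Fin n → Fin n → Fin n → ℝ) (ξ : Fin n → ℝ) {C : Matrix (Fin n) (Fin n) ℝ}
    (hC : ∀ i j, C i j = ∑ c, ∑ d, ξ c * ξ d * Q i j c d) (i : Fin n) :
    (E.transpose * C * E) i i =
      ∑ c, ∑ d, ξ c * ξ d * ∑ a, ∑ b, E a i * E b i * Q a b c d := by
  have h := transpose_mul_mul_apply_eq E (fun a b c => ∑ d, ξ d * Q a b c d) ξ (B := C)
    (fun a b => by
      rw [hC]
      refine Finset.sum_congr rfl fun c _ => ?_
      rw [Finset.mul_sum]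
      exact Finset.sum_congr rfl fun d _ => by ring) i i
  rw [h]
  refine Finset.sum_congr rfl fun c _ => ?_
  simp only [frameGradient, Finset.mul_sum]
  calc _ = ∑ a, ∑ d, ∑ b, ξ c * (E a i * E b i * (ξ d * Q a b c d)) :=
        Finset.sum_congr rfl fun a _ => Finset.sum_comm
    _ = ∑ d, ∑ a, ∑ b, ξ c * (E a i * E b i * (ξ d * Q a b c d)) := Finset.sum_comm
    _ = _ := Finset.sum_congr rfl fun d _ => Finset.sum_congr rfl fun a _ =>
        Finset.sum_congr rfl fun b _ => by ring

/-- A constant dominating the lower order terms of the linearized equation. -/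
noncomputable def lowerOrderBound (n : ℕ) (L K : ℝ) : ℝ :=
  K * (2 * n ^ 2 * (2 * L) ^ 2 * n) *
      (2 * (n * K + 1) + 2 * n ^ 2 * (2 * L) ^ 2 * n * (n ^ 3 * (n * K + 1))) +
    K + K * (1 + (2 * (n * K + 1) + n * (n * K)))

/-- The differential inequality for the weighted eigenvalue sum, at a point where the eigenvalues
have second order expansions, in terms of a Hessian eigenframe `E`. -/
theorem eigenvalue_sum_inequality {L K : ℝ} (hL : 0 < L) (hK : 0 ≤ K) (hU : IsOpen U)
    (hF : ContDiffOn ℝ 2 F {z | z.2.2.2 ∈ U})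
    (hFK : ∀ z : (Fin n → Fin n → ℝ) × (Fin n → ℝ) × ℝ × EuclideanSpace ℝ (Fin n), z.2.2.2 ∈ U →
      ∀ i ≤ 2, ‖iteratedFDeriv ℝ i F z‖ ≤ K)
    (hu : ContDiffOn ℝ 4 u U) (huK : ∀ i ≤ 3, ‖iteratedFDeriv ℝ i u x‖ ≤ K)
    (heq : ∀ y ∈ U, F (fun i j => hessM u y i j, fun l => pd u y l, u y, y) = 0) (hx : x ∈ U)
    (hell : ∀ ξ : Fin n → ℝ,
      L⁻¹ * ∑ i, ξ i ^ 2 ≤ ∑ i, ∑ j, Fmat F u x i j * ξ i * ξ j ∧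
      ∑ i, ∑ j, Fmat F u x i j * ξ i * ξ j ≤ L * ∑ i, ξ i ^ 2)
    (hconv : ∀ p : Fin n → ℝ, ∀ z ∈ {w : (Fin n → Fin n → ℝ) × ℝ × EuclideanSpace ℝ (Fin n) |
        (Matrix.of w.1).PosDef ∧ w.2.2 ∈ U},
      ∃ t : Set ((Fin n → Fin n → ℝ) × ℝ × EuclideanSpace ℝ (Fin n)), IsOpen t ∧ z ∈ t ∧
        ConvexOn ℝ ({w | (Matrix.of w.1).PosDef ∧ w.2.2 ∈ U} ∩ t)
          (fun w => F (fun i j => (Matrix.of w.1)⁻¹ i j, p, w.2.1, w.2.2)))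
    {lam : EuclideanSpace ℝ (Fin n) → Fin n → ℝ}
    (hlam : ∀ y ∈ U, Monotone (lam y) ∧ (∀ i, 0 ≤ lam y i) ∧
      (hessM u y).charpoly = ∏ i, (Polynomial.X - Polynomial.C (lam y i)))
    {k : ℕ} (hk : 1 ≤ k) (hkn : k ≤ n) {E : Matrix (Fin n) (Fin n) ℝ} (hE : E.transpose * E = 1)
    (hA : E.transpose * hessM u x * E = Matrix.diagonal (lam x))
    {Dl : Fin n → Fin n → ℝ} {D2l : Fin n → Matrix (Fin n) (Fin n) ℝ}
    (hDs : ∀ i a b, D2l i a b = D2l i b a)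
    (hD : ∀ i, (fun y => lam y i - lam x i - ∑ a, Dl i a * (y - x) a -
      (1 / 2) * ∑ a, ∑ b, D2l i a b * (y - x) a * (y - x) b) =o[nhds x] fun y => ‖y - x‖ ^ 2) :
    (∀ i j, Dl i j = frameGradient E (thirdDeriv u x) i i j) ∧
    ∑ a, ∑ b, Fmat F u x a b * ∑ i : Fin n, ((k - (i : ℕ) : ℕ) : ℝ) * D2l i a b ≤
      2 * n * lowerOrderBound n L K * ∑ i ∈ Finset.univ.filter (fun i : Fin n => (i : ℕ) < k),
        ∑ j, |frameGradient E (thirdDeriv u x) i i j| +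
      (lowerOrderBound n L K + n ^ 4 * lowerOrderBound n L K ^ 2 * (n * L)) *
        ∑ i ∈ Finset.univ.filter (fun i : Fin n => (i : ℕ) < k),
          ((k - (i : ℕ) : ℕ) : ℝ) * lam x i := by
  have hux : ContDiffAt ℝ 4 u x := hu.contDiffAt (hU.mem_nhds hx)
  have hu3 : ContDiffAt ℝ 3 u x := hux.of_le (by norm_num)
  have hTs := thirdDeriv_comm₁₂ hu3
  have hV : ∀ w : Fin n → ℝ, Antitone w → ∀ (ξ : Fin n → ℝ) (Z : Matrix (Fin n) (Fin n) ℝ),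
      Z.transpose = -Z →
      ∑ i, w i * ∑ a, Dl i a * ξ a =
        ∑ i, w i * ∑ c, ξ c * frameGradient E (thirdDeriv u x) i i c ∧
      (1 / 2) * ∑ i, w i * ∑ a, ∑ b, D2l i a b * ξ a * ξ b ≤
        (1 / 2) * ∑ i, w i * ∑ c, ∑ d, ξ c * ξ d *
          ∑ a, ∑ b, E a i * E b i * fourthDeriv u x a b c d +
        ∑ i, ∑ j, (w i - w j) * ((∑ c, ξ c * frameGradient E (thirdDeriv u x) i j c) * Z j i +
        (1 / 2) * (lam x j - lam x i) * Z j i ^ 2) := by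
    intro w hw ξ Z hZ
    obtain ⟨B, hB⟩ : ∃ B : Matrix (Fin n) (Fin n) ℝ,
        ∀ i j, B i j = ∑ c, ξ c * thirdDeriv u x i j c := ⟨Matrix.of _, fun _ _ => rfl⟩
    obtain ⟨C, hC⟩ : ∃ C : Matrix (Fin n) (Fin n) ℝ,
        ∀ i j, C i j = ∑ c, ∑ d, ξ c * ξ d * fourthDeriv u x i j c d :=
      ⟨Matrix.of _, fun _ _ => rfl⟩
    have h := hessM_eigenvalue_second_variation hU hu
      (fun y hy => ⟨(hlam y hy).1, (hlam y hy).2.2⟩) hx hD hE hA hw ξ hZ hB hC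
    simpa only [transpose_mul_mul_apply_eq E (thirdDeriv u x) ξ hB,
      transpose_mul_mul_apply_eq_sum E (fourthDeriv u x) ξ hC] using h
  set w : Fin n → ℝ := fun i => ((k - (i : ℕ) : ℕ) : ℝ) with hw
  have hwanti : Antitone w := by
    intro i j hij
    have : (i : ℕ) ≤ j := hij
    simp only [hw, Nat.cast_le]; omega
  refine ⟨eigenvalue_deriv_eq_frameGradient fun w hw ξ => (hV w hw ξ 0 (by simp)).1, ?_⟩
  have hHpos : ∀ ξ : Fin n → ℝ, 0 ≤ ∑ a, ∑ b, Matrix.of (Fmat F u x) a b * ξ a * ξ b := by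
    intro ξ
    refine le_trans ?_ (hell ξ).1
    exact mul_nonneg (inv_nonneg.mpr hL.le) (Finset.sum_nonneg fun i _ => sq_nonneg _)
  have h1 := contracted_second_variation hHpos (fun ξ Z hZ => (hV w hwanti ξ Z hZ).2) hTs
    (fourthDeriv_comm₃₄ hux) hDs
  have hF1 : ∀ z : (Fin n → Fin n → ℝ) × (Fin n → ℝ) × ℝ × EuclideanSpace ℝ (Fin n),
      z.2.2.2 ∈ U → ‖fderiv ℝ F z‖ ≤ K := fun z hz => by
    rw [← norm_iteratedFDeriv_one]; exact hFK z hz 1 (by norm_num)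
  have hF2 : ∀ z : (Fin n → Fin n → ℝ) × (Fin n → ℝ) × ℝ × EuclideanSpace ℝ (Fin n),
      z.2.2.2 ∈ U → ‖fderiv ℝ (fderiv ℝ F) z‖ ≤ K := fun z hz => by
    rw [← norm_iteratedFDeriv_one, norm_iteratedFDeriv_fderiv]; exact hFK z hz 2 le_rfl
  have hC1 : 0 ≤ K * (2 * n ^ 2 * (2 * L) ^ 2 * n) *
      (2 * (n * K + 1) + 2 * n ^ 2 * (2 * L) ^ 2 * n * (n ^ 3 * (n * K + 1))) := by positivity
  have hC2 : 0 ≤ K * (1 + (2 * (n * K + 1) + n * (n * K))) := by positivity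
  have hn : (0 : ℝ) < n := by exact_mod_cast lt_of_lt_of_le hk hkn
  have h2 := weighted_sum_sub_le (M := n * L) (C := lowerOrderBound n L K) hk hkn (hlam x hx).1
    (hlam x hx).2.1
    (φ := fun i j => ∑ a, ∑ b, Fmat F u x a b * frameGradient E (thirdDeriv u x) i j a *
      frameGradient E (thirdDeriv u x) i j b)
    (s := fun i j => ∑ a, |frameGradient E (thirdDeriv u x) i j a|)
    (f := fun i => ∑ c, ∑ d, Fmat F u x c d *
      ∑ a, ∑ b, E a i * E b i * fourthDeriv u x a b c d)
    (by positivity) (by unfold lowerOrderBound; linarith)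
    (fun i j => by simp only [frameGradient_comm (E := E) hTs i j])
    (fun i j => Finset.sum_nonneg fun a _ => abs_nonneg _)
    (fun i j => by
      have e1 := sq_sum_le_card_mul_sum_sq (s := Finset.univ)
        (f := fun a => |frameGradient E (thirdDeriv u x) i j a|)
      simp only [Finset.card_univ, Fintype.card_fin, sq_abs] at e1
      have e2 := (hell (frameGradient E (thirdDeriv u x) i j)).1
      rw [inv_mul_le_iff₀ hL] at e2
      refine e1.trans ?_
      rw [mul_assoc]
      exact mul_le_mul_of_nonneg_left e2 hn.le)
    (fun i j hij hl => by
      simp only [fun c => frameGradient_eq_zero (fun ξ Z hZ => (hV w hwanti ξ Z hZ).2) hTs hij hl c]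
      simp)
    (fun i R hR => by
      refine (contracted_fourthDeriv_le hL hK hU hF hF1 hF2 hu huK heq hx hell hconv hE
        (hlam x hx).2.1 hA i R hR).trans ?_
      have n1 : 0 ≤ ∑ c ∈ Rᶜ, ∑ a, |frameGradient E (thirdDeriv u x) i c a| :=
        Finset.sum_nonneg fun c _ => Finset.sum_nonneg fun a _ => abs_nonneg _
      have n2 : 0 ≤ ∑ a, |frameGradient E (thirdDeriv u x) i i a| :=
        Finset.sum_nonneg fun a _ => abs_nonneg _
      have n3 := (hlam x hx).2.1 i
      refine add_le_add (add_le_add (add_le_add le_rfl ?_) ?_) ?_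
      · exact mul_le_mul_of_nonneg_right (by unfold lowerOrderBound; linarith) n1
      · exact mul_le_mul_of_nonneg_right (by unfold lowerOrderBound; linarith) n2
      · exact mul_le_mul_of_nonneg_right (by unfold lowerOrderBound; linarith) n3)
  exact h1.trans h2

end KeyInequality

/-- the key differential inequality, Lemma 3.1 of the paper.  With the
hypotheses of the main theorem but `u ∈ C⁴(B)`, set (0-based indexing)
`Q = Q_k = ∑_{i<k} (k-i) λ_i = λ_k + 2λ_{k-1} + ⋯ + kλ₁`.  Then there are a constant
`C` and functions `b^{i,j}` on `B` bounded by `C`, with `C` depending only on `n`, `Λ`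
and the bounds `K` for `‖u‖_{C³(B)}` and `‖F‖_{C²}` (and not on any `C⁴` bound for `u`),
such that `F^{ab} Q_{ab} ≤ C Q + ∑_{i<k} b^{i,j} (λ_i)_j` holds almost everywhere on
`B`; the first and second derivatives `(λ_i)_j` and `(λ_i)_{ab}` of the eigenvalues are
interpreted via the second-order (Alexandrov) Taylor expansions, which exist at almost
every point, and `Q_{ab} = ∑_{i<k} (k-i) (λ_i)_{ab}`. -/
theorem key_differential_inequality (n : ℕ) (Λ K : ℝ) (hΛ : 0 < Λ) (hK : 0 ≤ K) :
    ∃ C : ℝ, 0 < C ∧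
      ∀ (F : (Fin n → Fin n → ℝ) × (Fin n → ℝ) × ℝ × EuclideanSpace ℝ (Fin n) → ℝ)
        (u : EuclideanSpace ℝ (Fin n) → ℝ)
        (lam : EuclideanSpace ℝ (Fin n) → Fin n → ℝ),
        -- F is C² on Symₙ(ℝ) × ℝⁿ × ℝ × B, with C² norm at most K
        ContDiffOn ℝ 2 F {z | z.2.2.2 ∈ ball (0 : EuclideanSpace ℝ (Fin n)) 1} →
        (∀ z : (Fin n → Fin n → ℝ) × (Fin n → ℝ) × ℝ × EuclideanSpace ℝ (Fin n),
          z.2.2.2 ∈ ball (0 : EuclideanSpace ℝ (Fin n)) 1 →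
          ∀ i ≤ 2, ‖iteratedFDeriv ℝ i F z‖ ≤ K) →
        -- structure condition: (A,u,x) ↦ F(A⁻¹,p,u,x) is locally convex on Sym⁺ₙ×ℝ×B
        (∀ p : Fin n → ℝ,
          ∀ z ∈ {w : (Fin n → Fin n → ℝ) × ℝ × EuclideanSpace ℝ (Fin n) |
              (Matrix.of w.1).PosDef ∧ w.2.2 ∈ ball (0 : EuclideanSpace ℝ (Fin n)) 1},
            ∃ t, IsOpen t ∧ z ∈ t ∧
              ConvexOn ℝ
                ({w : (Fin n → Fin n → ℝ) × ℝ × EuclideanSpace ℝ (Fin n) |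
                    (Matrix.of w.1).PosDef ∧
                      w.2.2 ∈ ball (0 : EuclideanSpace ℝ (Fin n)) 1} ∩ t)
                (fun w => F (fun i j => (Matrix.of w.1)⁻¹ i j, p, w.2.1, w.2.2))) →
        -- u is C⁴ and convex on B, with C³ norm at most K
        ContDiffOn ℝ 4 u (ball 0 1) →
        ConvexOn ℝ (ball 0 1) u →
        (∀ x ∈ ball (0 : EuclideanSpace ℝ (Fin n)) 1,
          ∀ i ≤ 3, ‖iteratedFDeriv ℝ i u x‖ ≤ K) →
        -- u solves F(D²u, Du, u, x) = 0 on B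
        (∀ x ∈ ball (0 : EuclideanSpace ℝ (Fin n)) 1,
          F (fun i j => hessM u x i j, fun l => pd u x l, u x, x) = 0) →
        -- uniform ellipticity
        (∀ x ∈ ball (0 : EuclideanSpace ℝ (Fin n)) 1, ∀ ξ : Fin n → ℝ,
          Λ⁻¹ * ∑ i, ξ i ^ 2 ≤ ∑ i, ∑ j, Fmat F u x i j * ξ i * ξ j ∧
          ∑ i, ∑ j, Fmat F u x i j * ξ i * ξ j ≤ Λ * ∑ i, ξ i ^ 2) →
        -- lam lists the (nonnegative) eigenvalues of D²u in increasing order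
        (∀ x ∈ ball (0 : EuclideanSpace ℝ (Fin n)) 1,
          Monotone (lam x) ∧ (∀ i, 0 ≤ lam x i) ∧
          (hessM u x).charpoly = ∏ i, (Polynomial.X - Polynomial.C (lam x i))) →
        ∀ k : ℕ, 1 ≤ k → k ≤ n →
        -- the bounded coefficient functions b^{i,j}
        ∃ b : Fin n → Fin n → EuclideanSpace ℝ (Fin n) → ℝ,
          (∀ i j : Fin n, ∀ x ∈ ball (0 : EuclideanSpace ℝ (Fin n)) 1, |b i j x| ≤ C) ∧
          -- the differential inequality, almost everywhere on B
          ∀ᵐ x ∂(volume.restrict (ball (0 : EuclideanSpace ℝ (Fin n)) 1)),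
            ∀ (Dl : Fin n → Fin n → ℝ) (D2l : Fin n → Matrix (Fin n) (Fin n) ℝ),
              (∀ i : Fin n, (∀ a b' : Fin n, D2l i a b' = D2l i b' a) ∧
                (fun y => lam y i - lam x i - ∑ a, Dl i a * (y - x) a
                    - (1 / 2) * ∑ a, ∑ b', D2l i a b' * (y - x) a * (y - x) b')
                  =o[nhds x] (fun y => ‖y - x‖ ^ 2)) →
              ∑ a : Fin n, ∑ b' : Fin n, Fmat F u x a b' *
                  (∑ i ∈ Finset.univ.filter (fun i : Fin n => (i : ℕ) < k),
                    ((k - (i : ℕ) : ℕ) : ℝ) * D2l i a b')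
                ≤ C * (∑ i ∈ Finset.univ.filter (fun i : Fin n => (i : ℕ) < k),
                      ((k - (i : ℕ) : ℕ) : ℝ) * lam x i)
                  + ∑ i ∈ Finset.univ.filter (fun i : Fin n => (i : ℕ) < k),
                      ∑ j : Fin n, b i j x * Dl i j := by
  have hw0 : 0 ≤ lowerOrderBound n Λ K := by unfold lowerOrderBound; positivity
  set C : ℝ := 2 * n * lowerOrderBound n Λ K +
    (lowerOrderBound n Λ K + n ^ 4 * lowerOrderBound n Λ K ^ 2 * (n * Λ)) + 1 with hC
  have hC1 : 2 * n * lowerOrderBound n Λ K ≤ C := by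
    have : 0 ≤ lowerOrderBound n Λ K + n ^ 4 * lowerOrderBound n Λ K ^ 2 * (n * Λ) := by positivity
    linarith
  have hC2 : lowerOrderBound n Λ K + n ^ 4 * lowerOrderBound n Λ K ^ 2 * (n * Λ) ≤ C := by
    have : 0 ≤ 2 * n * lowerOrderBound n Λ K := by positivity
    linarith
  have hC0 : 0 < C := by positivity
  refine ⟨C, hC0, fun F u lam hF hFK hconv hu _ huK heq hell hlam k hk hkn => ?_⟩
  have hframe : ∀ x ∈ ball (0 : EuclideanSpace ℝ (Fin n)) 1, ∃ E : Matrix (Fin n) (Fin n) ℝ,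
      E.transpose * E = 1 ∧ E.transpose * hessM u x * E = Matrix.diagonal (lam x) := fun x hx =>
    Matrix.exists_orthogonal_diagonalization
      (hessM_transpose ((hu.contDiffAt (isOpen_ball.mem_nhds hx)).of_le (by norm_num)))
      (hlam x hx).2.2
  choose! E hE hA using hframe
  refine ⟨fun i j x => C * SignType.sign (frameGradient (E x) (thirdDeriv u x) i i j), ?_,
    ae_restrict_of_forall_mem measurableSet_ball fun x hx Dl D2l hD => ?_⟩
  · intro i j x _
    rw [abs_mul, abs_of_pos hC0]
    refine mul_le_of_le_one_right hC0.le ?_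
    rcases lt_trichotomy (frameGradient (E x) (thirdDeriv u x) i i j) 0 with h | h | h <;> simp [h]
  obtain ⟨hDl, hineq⟩ := eigenvalue_sum_inequality hΛ hK isOpen_ball hF hFK hu (huK x hx) heq hx
    (hell x hx) hconv hlam hk hkn (hE x hx) (hA x hx) (fun i => (hD i).1) fun i => (hD i).2
  have hfull : ∀ a b, ∑ i ∈ Finset.univ.filter (fun i : Fin n => (i : ℕ) < k),
      ((k - (i : ℕ) : ℕ) : ℝ) * D2l i a b = ∑ i : Fin n, ((k - (i : ℕ) : ℕ) : ℝ) * D2l i a b := by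
    intro a b
    refine Finset.sum_subset (Finset.subset_univ _) fun i _ hi => ?_
    have hi' : k ≤ i := by simpa using hi
    simp [Nat.sub_eq_zero_of_le hi']
  simp only [hfull]
  have hsign : ∑ i ∈ Finset.univ.filter (fun i : Fin n => (i : ℕ) < k), ∑ j,
      C * (SignType.sign (frameGradient (E x) (thirdDeriv u x) i i j) : ℝ) * Dl i j =
      C * ∑ i ∈ Finset.univ.filter (fun i : Fin n => (i : ℕ) < k),
        ∑ j, |frameGradient (E x) (thirdDeriv u x) i i j| := by
    simp only [Finset.mul_sum, hDl, mul_assoc, sign_mul_self]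
  rw [hsign]
  have hQ : 0 ≤ ∑ i ∈ Finset.univ.filter (fun i : Fin n => (i : ℕ) < k),
      ((k - (i : ℕ) : ℕ) : ℝ) * lam x i :=
    Finset.sum_nonneg fun i _ => mul_nonneg (Nat.cast_nonneg _) ((hlam x hx).2.1 i)
  have hS : 0 ≤ ∑ i ∈ Finset.univ.filter (fun i : Fin n => (i : ℕ) < k),
      ∑ j, |frameGradient (E x) (thirdDeriv u x) i i j| :=
    Finset.sum_nonneg fun i _ => Finset.sum_nonneg fun j _ => abs_nonneg _
  linarith [mul_le_mul_of_nonneg_right hC1 hS, mul_le_mul_of_nonneg_right hC2 hQ]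
end

section
/- Let u be C⁴ in a neighborhood of a point x₀ ∈ ℝⁿ, with eigenvalues λ₁(x) ≤ ⋯ ≤ λₙ(x) of D²u(x), and suppose each λ_i is differentiable at x₀. Choose coordinates in which D²u(x₀) is diagonal with u_{ii}(x₀) = λ_i(x₀), and let 0 = μ₀ < μ₁ < ⋯ < μ_N = n record the eigenvalue blocks, i.e. λ_{1+μ_{j−1}}(x₀) = ⋯ = λ_{μ_j}(x₀) for each j and λ_{μ_j}(x₀) < λ_{1+μ_j}(x₀). Then for each j = 1, …, N, each pair of indices 1+μ_{j−1} ≤ k, ℓ ≤ μ_j, and each i = 1, …, n, the third derivative satisfies u_{kℓi}(x₀) = (λ_{1+μ_{j−1}})_i(x₀) · δ_{kℓ}, where (λ_{1+μ_{j−1}})_i denotes the i-th partial derivative of the eigenvalue function λ_{1+μ_{j−1}} at x₀. -/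
open Metric

/-- Third partial derivative `u_{ijk}` (0-based indices). -/
noncomputable def pd3 {n : ℕ} (u : EuclideanSpace ℝ (Fin n) → ℝ)
    (x : EuclideanSpace ℝ (Fin n)) (i j k : ℕ) : ℝ :=
  pd (fun y => pd (fun z => pd u z k) y j) x i

open Topology Filter Matrix

/-- First-order perturbation of the eigenvalues of a diagonal matrix, at a group of coinciding
eigenvalues: their derivatives are the eigenvalues of the compressed derivative. -/
theorem det_block_deriv_eq_prod {ι : Type*} [Fintype ι] [DecidableEq ι]
    {A : ℝ → Matrix ι ι ℝ} {B : Matrix ι ι ℝ} {l : ℝ → ι → ℝ} {l' : ι → ℝ} {a : ℝ}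
    (hA : ∀ i j, HasDerivAt (fun t => A t i j) (B i j) 0)
    (hl : ∀ i, HasDerivAt (fun t => l t i) (l' i) 0)
    (hdiag : A 0 = diagonal (l 0))
    (hchar : ∀ᶠ t in 𝓝 0, (A t).charpoly = ∏ i, (Polynomial.X - Polynomial.C (l t i)))
    (z : ℝ) :
    (of fun i j : {i // l 0 i = a} => (if i = j then z else 0) - B i j).det =
      ∏ i : {i // l 0 i = a}, (z - l' i) := by
  classical
  have quot : ∀ {f : ℝ → ℝ} {f' b : ℝ}, HasDerivAt f f' 0 → f 0 = a * b →
      Tendsto (fun t => t⁻¹ * ((a + t * z) * b - f t)) (𝓝[≠] 0) (𝓝 (z * b - f')) := by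
    intro f f' b hf h0
    have h : HasDerivAt (fun t => (a + t * z) * b - f t) (z * b - f') 0 := by
      have h' := (((hasDerivAt_id (0 : ℝ)).mul_const z).const_add a).mul_const b
      rw [one_mul] at h'
      exact h'.fun_sub hf
    simpa [h0] using h.tendsto_slope_zero
  have cont : ∀ {f : ℝ → ℝ} {f' b : ℝ}, HasDerivAt f f' 0 →
      Tendsto (fun t => (a + t * z) * b - f t) (𝓝[≠] 0) (𝓝 (a * b - f 0)) := by
    intro f f' b hf
    have h : ContinuousAt (fun t => (a + t * z) * b - f t) 0 :=
      ContinuousAt.sub (by fun_prop) hf.continuousAt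
    simpa using h.tendsto.mono_left nhdsWithin_le_nhds
  let c : ℝ → ι → ℝ := fun t i => if l 0 i = a then t⁻¹ else 1
  let M : ℝ → Matrix ι ι ℝ := fun t =>
    of fun i j => c t i * ((a + t * z) * (1 : Matrix ι ι ℝ) i j - A t i j)
  let M₀ : Matrix ι ι ℝ := of fun i j =>
    if l 0 i = a then z * (1 : Matrix ι ι ℝ) i j - B i j
    else a * (1 : Matrix ι ι ℝ) i j - A 0 i j
  have hM : Tendsto M (𝓝[≠] 0) (𝓝 M₀) := by
    refine tendsto_pi_nhds.2 fun i => tendsto_pi_nhds.2 fun j => ?_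
    by_cases hi : l 0 i = a
    · have := quot (b := (1 : Matrix ι ι ℝ) i j) (hA i j) (by
        rw [hdiag, diagonal_apply, one_apply]; split_ifs <;> simp [hi])
      simpa [M, M₀, c, hi] using this
    · simpa [M, M₀, c, hi] using cont (b := (1 : Matrix ι ι ℝ) i j) (hA i j)
  have hprod : Tendsto (fun t => ∏ i, c t i * ((a + t * z) - l t i)) (𝓝[≠] 0)
      (𝓝 (∏ i, if l 0 i = a then z - l' i else a - l 0 i)) := by
    refine tendsto_finsetProd _ fun i _ => ?_
    by_cases hi : l 0 i = a
    · simpa [c, hi] using quot (b := 1) (hl i) (by simp [hi])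
    · simpa [c, hi] using cont (b := 1) (hl i)
  have hdet : ∀ᶠ t in 𝓝[≠] 0, (M t).det = ∏ i, c t i * ((a + t * z) - l t i) := by
    filter_upwards [nhdsWithin_le_nhds hchar] with t ht
    have hMt : M t = of fun i j => c t i * (scalar ι (a + t * z) - A t) i j := by
      ext i j
      simp [M, scalar_apply, diagonal_apply, one_apply]
    rw [hMt, det_mul_column, ← eval_charpoly, ht, Polynomial.eval_prod, ← Finset.prod_mul_distrib]
    simp
  have key : M₀.det = ∏ i, if l 0 i = a then z - l' i else a - l 0 i :=
    tendsto_nhds_unique (((continuous_id.matrix_det).tendsto M₀).comp hM)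
      (hprod.congr' (hdet.mono fun _ h => h.symm))
  have hlow : ∀ i, ¬ l 0 i = a → ∀ j, l 0 j = a → M₀ i j = 0 := by
    intro i hi j hj
    have hij : i ≠ j := by rintro rfl; exact hi hj
    simp [M₀, hi, hdiag, hij]
  rw [twoBlockTriangular_det M₀ (fun i => l 0 i = a) hlow,
    ← Fintype.prod_subtype_mul_prod_subtype (fun i => l 0 i = a)] at key
  have h1 : M₀.toSquareBlockProp (fun i => l 0 i = a) =
      of fun i j : {i // l 0 i = a} => (if i = j then z else 0) - B i j := by
    ext i j
    simp [toSquareBlockProp, M₀, i.2, one_apply, Subtype.ext_iff]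
  have h2 : M₀.toSquareBlockProp (fun i => ¬ l 0 i = a) =
      diagonal fun i : {i // ¬ l 0 i = a} => a - l 0 i := by
    ext i j
    by_cases hij : i = j
    · subst hij
      simp [toSquareBlockProp, M₀, i.2, hdiag]
    · have : (i : ι) ≠ j := fun h => hij (Subtype.ext h)
      simp [toSquareBlockProp, M₀, i.2, hdiag, hij, this]
  have h3 : ∏ i : {i // l 0 i = a}, (if l 0 i = a then z - l' i else a - l 0 i) =
      ∏ i : {i // l 0 i = a}, (z - l' i) :=
    Finset.prod_congr rfl fun i _ => if_pos i.2
  have h4 : ∏ i : {i // ¬ l 0 i = a}, (if l 0 i = a then z - l' i else a - l 0 i) =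
      ∏ i : {i // ¬ l 0 i = a}, (a - l 0 i) :=
    Finset.prod_congr rfl fun i _ => if_neg i.2
  rw [h1, h2, det_diagonal, h3, h4] at key
  exact mul_right_cancel₀
    (Finset.prod_ne_zero_iff.2 fun i _ => sub_ne_zero.2 fun h => i.2 h.symm) key

theorem Matrix.IsHermitian.eq_diagonal_of_det_eq_pow {ι : Type*} [Fintype ι] [DecidableEq ι]
    {B : Matrix ι ι ℝ} (hB : B.IsHermitian) {d : ℝ}
    (h : ∀ z, (scalar ι z - B).det = (z - d) ^ Fintype.card ι) : B = scalar ι d := by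
  have hH : (scalar ι d - B).IsHermitian :=
    (isHermitian_diagonal fun _ => d).sub hB
  have h0 : hH.eigenvalues = 0 := by
    funext i
    have hroot : (scalar ι (hH.eigenvalues i) - (scalar ι d - B)).det = 0 := by
      rw [← eval_charpoly, hH.charpoly_eq, Polynomial.eval_prod]
      exact Finset.prod_eq_zero (Finset.mem_univ i) (by simp)
    have hneg : scalar ι (hH.eigenvalues i) - (scalar ι d - B) =
        -(scalar ι (d - hH.eigenvalues i) - B) := by
      rw [map_sub]; abel
    rw [hneg, det_neg, h] at hroot
    have hz := eq_zero_of_pow_eq_zero (mul_eq_zero.1 hroot |>.resolve_left (by simp))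
    simpa using hz
  exact (sub_eq_zero.1 (hH.eigenvalues_eq_zero_iff.1 h0)).symm

theorem ContDiffAt.pd {n : ℕ} {f : EuclideanSpace ℝ (Fin n) → ℝ} {x : EuclideanSpace ℝ (Fin n)}
    {m k : WithTop ℕ∞} (hf : ContDiffAt ℝ k f x) (hmk : m + 1 ≤ k) (i : ℕ) :
    ContDiffAt ℝ m (fun y => pd f y i) x := by
  by_cases h : i < n
  · simpa only [_root_.pd, h, dite_true] using
      (hf.fderiv_right hmk).clm_apply contDiffAt_const
  · simpa only [_root_.pd, h, dite_false] using contDiffAt_const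

theorem pd_comm {n : ℕ} {f : EuclideanSpace ℝ (Fin n) → ℝ} {x : EuclideanSpace ℝ (Fin n)}
    (hf : ContDiffAt ℝ 2 f x) (i j : ℕ) :
    pd (fun y => pd f y j) x i = pd (fun y => pd f y i) x j := by
  have hd : DifferentiableAt ℝ (fderiv ℝ f) x :=
    (hf.fderiv_right (m := 1) (by norm_num)).differentiableAt (by norm_num)
  by_cases hi : i < n <;> by_cases hj : j < n <;> simp only [pd, hi, hj, dite_true, dite_false,
    fderiv_fun_const, Pi.zero_apply, _root_.zero_apply]
  rw [fderiv_clm_apply hd (differentiableAt_const _), fderiv_clm_apply hd (differentiableAt_const _)]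
  simpa using hf.isSymmSndFDerivAt (by simp) _ _

theorem pd_congr {n : ℕ} {f g : EuclideanSpace ℝ (Fin n) → ℝ} {x : EuclideanSpace ℝ (Fin n)}
    (h : f =ᶠ[𝓝 x] g) (i : ℕ) : pd f x i = pd g x i := by
  simp only [pd, h.fderiv_eq]

theorem pd3_eq_pd_hessM {n : ℕ} {u : EuclideanSpace ℝ (Fin n) → ℝ} {x : EuclideanSpace ℝ (Fin n)}
    (hu : ContDiffAt ℝ 4 u x) (k ℓ : Fin n) (i : ℕ) :
    pd3 u x k ℓ i = pd (fun y => hessM u y k ℓ) x i := by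
  have hev : (fun y => pd (fun z => pd u z i) y ℓ) =ᶠ[𝓝 x]
      fun y => pd (fun z => pd u z ℓ) y i :=
    (hu.eventually (by simp)).mono fun y hy => pd_comm (hy.of_le (by norm_num)) _ _
  rw [pd3, pd_congr hev]
  exact pd_comm (hu.pd (by norm_num) _) _ _

theorem DifferentiableAt.hasDerivAt_pd {n : ℕ} {f : EuclideanSpace ℝ (Fin n) → ℝ}
    {x : EuclideanSpace ℝ (Fin n)} (hf : DifferentiableAt ℝ f x) (i : Fin n) :
    HasDerivAt (fun t : ℝ => f (x + t • EuclideanSpace.single i 1)) (pd f x i) 0 := by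
  have hx : HasDerivAt (fun t : ℝ => x + t • EuclideanSpace.single i (1 : ℝ))
      (EuclideanSpace.single i 1) 0 := by
    simpa using ((hasDerivAt_id (0 : ℝ)).smul_const (EuclideanSpace.single i (1 : ℝ))).const_add x
  have hf' : HasFDerivAt f (fderiv ℝ f x) (x + (0 : ℝ) • EuclideanSpace.single i (1 : ℝ)) := by
    simpa using hf.hasFDerivAt
  have hpd : pd f x i = fderiv ℝ f x (EuclideanSpace.single i 1) := by simp [pd]
  rw [hpd]
  exact hf'.comp_hasDerivAt (0 : ℝ) hx

theorem fderiv_eq_of_le_of_eq {E : Type*} [NormedAddCommGroup E] [NormedSpace ℝ E] {f g : E → ℝ}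
    {x : E} (hf : DifferentiableAt ℝ f x) (hg : DifferentiableAt ℝ g x)
    (hle : ∀ᶠ y in 𝓝 x, f y ≤ g y) (heq : f x = g x) : fderiv ℝ f x = fderiv ℝ g x := by
  have hmin : IsLocalMin (fun y => g y - f y) x := by
    filter_upwards [hle] with y hy
    linarith
  have := hmin.fderiv_eq_zero
  rw [fderiv_fun_sub hg hf, sub_eq_zero] at this
  exact this.symm

/-- first variation of the eigenvalues, Lemma 3.2 of the paper.
Let `u` be `C⁴` near `x₀`, let `lam x 0 ≤ ⋯ ≤ lam x (n-1)` be the increasing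
eigenvalues of `D²u(x)` (encoded by the factorization of the characteristic
polynomial), each differentiable at `x₀`, and suppose `D²u(x₀)` is diagonal with
entries `lam x₀ i`.  Let `0 = μ₀ < μ₁ < ⋯ < μ_N = n` record the eigenvalue blocks
(with 0-based indexing the `j`-th block consists of the indices `μ j ≤ p < μ (j+1)`).
Then for block indices `k, ℓ` in the `j`-th block and any `i < n`,
`u_{kℓi}(x₀) = (λ_{μ j})_i(x₀) · δ_{kℓ}`, where `λ_{μ j}` is the smallest-index
eigenvalue of the block. -/
theorem eigenvalue_first_variation (n : ℕ)
    (u : EuclideanSpace ℝ (Fin n) → ℝ) (x₀ : EuclideanSpace ℝ (Fin n))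
    (V : Set (EuclideanSpace ℝ (Fin n))) (hV : IsOpen V) (hx₀ : x₀ ∈ V)
    (hu : ContDiffOn ℝ 4 u V)
    (lam : EuclideanSpace ℝ (Fin n) → ℕ → ℝ)
    (hlam : ∀ x ∈ V, (∀ i j : Fin n, i ≤ j → lam x i ≤ lam x j) ∧
      (hessM u x).charpoly = ∏ i : Fin n, (Polynomial.X - Polynomial.C (lam x (i : ℕ))))
    (hdiff : ∀ i < n, DifferentiableAt ℝ (fun x => lam x i) x₀)
    (hdiag : ∀ i j : Fin n, hessM u x₀ i j = if i = j then lam x₀ (i : ℕ) else 0)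
    (N : ℕ) (μ : ℕ → ℕ)
    (hμ0 : μ 0 = 0) (hμN : μ N = n)
    (hμs : ∀ j < N, μ j < μ (j + 1))
    (hblocks : ∀ j < N, ∀ p, μ j ≤ p → p < μ (j + 1) → lam x₀ p = lam x₀ (μ j))
    (hsep : ∀ j, 0 < j → j < N → lam x₀ (μ j - 1) < lam x₀ (μ j)) :
    ∀ j < N, ∀ k ℓ, μ j ≤ k → k < μ (j + 1) → μ j ≤ ℓ → ℓ < μ (j + 1) →
      ∀ i < n,
        pd3 u x₀ k ℓ i =
          if k = ℓ then pd (fun y => lam y (μ j)) x₀ i else 0 := by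
  intro j hj k ℓ hk hk' hℓ hℓ' i hi
  have hVx : V ∈ 𝓝 x₀ := hV.mem_nhds hx₀
  have hu' : ContDiffAt ℝ 4 u x₀ := hu.contDiffAt hVx
  have hend : ∀ m ≤ N, μ m ≤ n := by
    intro m hm
    rw [← hμN]
    exact Nat.decreasingInduction (motive := fun m _ => μ m ≤ μ N)
      (fun m hm ih => (hμs m hm).le.trans ih) le_rfl hm
  have hjn : μ (j + 1) ≤ n := hend _ hj
  have hmn : μ j < n := (hμs j hj).trans_le hjn
  let e : EuclideanSpace ℝ (Fin n) := EuclideanSpace.single ⟨i, hi⟩ 1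
  let A : ℝ → Matrix (Fin n) (Fin n) ℝ := fun t => hessM u (x₀ + t • e)
  let B : Matrix (Fin n) (Fin n) ℝ := of fun p q => pd3 u x₀ p q i
  let l : ℝ → Fin n → ℝ := fun t p => lam (x₀ + t • e) p
  let l' : Fin n → ℝ := fun p => pd (fun y => lam y p) x₀ i
  have hl0 : ∀ p, l 0 p = lam x₀ p := fun p => by simp [l]
  have hA : ∀ p q, HasDerivAt (fun t => A t p q) (B p q) 0 := by
    intro p q
    have hd : DifferentiableAt ℝ (fun y => hessM u y p q) x₀ :=
      ((hu'.pd (m := 3) (by norm_num) q).pd (m := 2) (by norm_num) p).differentiableAt (by norm_num)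
    simpa [A, B, e, pd3_eq_pd_hessM hu' p q i] using hd.hasDerivAt_pd ⟨i, hi⟩
  have hl : ∀ p, HasDerivAt (fun t => l t p) (l' p) 0 := fun p =>
    (hdiff p p.2).hasDerivAt_pd ⟨i, hi⟩
  have hA0 : A 0 = diagonal (l 0) := by
    ext p q
    simp [A, l, hdiag, diagonal_apply]
  have htend : Tendsto (fun t : ℝ => x₀ + t • e) (𝓝 0) (𝓝 x₀) := by
    have : Continuous fun t : ℝ => x₀ + t • e := by fun_prop
    simpa using this.tendsto 0
  have hchar : ∀ᶠ t in 𝓝 0, (A t).charpoly = ∏ p, (Polynomial.X - Polynomial.C (l t p)) :=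
    (htend.eventually hVx).mono fun t ht => (hlam _ ht).2
  have hle : ∀ p q : Fin n, p ≤ q → lam x₀ p = lam x₀ q → l' p = l' q := by
    intro p q hpq h
    have := fderiv_eq_of_le_of_eq (hdiff p p.2) (hdiff q q.2)
      (eventually_of_mem hVx fun y hy => (hlam y hy).1 p q hpq) h
    simp only [l', pd, this]
  have hl' : ∀ p : {p // l 0 p = lam x₀ (μ j)}, l' p = pd (fun y => lam y (μ j)) x₀ i := by
    rintro ⟨p, hp⟩
    rw [hl0] at hp
    rcases le_total p ⟨μ j, hmn⟩ with h | h
    · exact hle p ⟨μ j, hmn⟩ h hp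
    · exact (hle ⟨μ j, hmn⟩ p h hp.symm).symm
  let C : Matrix {p // l 0 p = lam x₀ (μ j)} {p // l 0 p = lam x₀ (μ j)} ℝ :=
    of fun p q => B p q
  have hC : C.IsHermitian := by
    ext p q
    have hev : (fun y => hessM u y q p) =ᶠ[𝓝 x₀] fun y => hessM u y p q :=
      (hu'.eventually (by simp)).mono fun y hy => pd_comm (hy.of_le (by norm_num)) _ _
    simpa [C, B, pd3_eq_pd_hessM hu'] using pd_congr hev i
  have hCd := hC.eq_diagonal_of_det_eq_pow (d := pd (fun y => lam y (μ j)) x₀ i) fun z => by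
    have := det_block_deriv_eq_prod (a := lam x₀ (μ j)) hA hl hA0 hchar z
    simp only [hl', Finset.prod_const, Finset.card_univ] at this
    rw [← this]
    rfl
  have := congrFun (congrFun hCd
    ⟨⟨k, hk'.trans_le hjn⟩, (hl0 _).trans (hblocks j hj k hk hk')⟩)
    ⟨⟨ℓ, hℓ'.trans_le hjn⟩, (hl0 _).trans (hblocks j hj ℓ hℓ hℓ')⟩
  simpa [C, B, diagonal_apply] using this
end
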